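/- arXiv:2603.25098 — 4 statements merged into one kernel-verified Lean document; each statement's English description precedes it below -/
import Mathlib

section
/- Let k be ℝ, ℂ, or a nonarchimedean local field, let n ≥ 3, h ∈ GL_n(k), κ_1, κ_n ∈ k^×, and A ∈ GL_{n−2}(k) with ‖A‖ < |κ_1| and ‖A⁻¹‖ < |κ_n|⁻¹, and let g := h·diag(κ_1, A, κ_n)·h⁻¹ have determinant 1. Fix α, δ, ε > 0 with ε ≤ min{dist(g⁺, ℙ(V_g⁻)), dist(g⁻, ℙ(V_g⁺))} and δ ≤ 10⁻²·ε, and set U_δ := {w ∈ GL_n(k) : ‖w − I‖ < δ/10 and ‖w⁻¹ − I‖ < δ/10}. Assume min{|κ_1|/‖A‖, (|κ_n|·‖A⁻¹‖)⁻¹} ≥ 10⁶·e^{α+8}·(ε²δ)⁻¹·C(h)⁴ and min{|κ_1|, |κ_n|⁻¹} ≥ 10³·e^{α+8}·ε⁻¹·C(h)². Then for every g' = g·w with w ∈ U_δ, every integer p ≠ 0, and every nonzero v ∈ k^n with [v] ∈ M_ε(g): [(g')^p v] ∈ B_δ(g⁺) ∪ B_δ(g⁻), and ‖(g')^p v‖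 ≥ e^{α|p|}·‖v‖. -/
noncomputable section

/-- Projective distance between (the lines of) two nonzero vectors, with respect to a norm
function `N` on `Fin n → k`. -/
def dPg {k : Type*} [NormedField k] {n : ℕ} (N : (Fin n → k) → ℝ) (u v : Fin n → k) : ℝ :=
  sInf {r : ℝ | ∃ a b ζ : k, N (a • u) = 1 ∧ N (b • v) = 1 ∧ ‖ζ‖ = 1 ∧
    r = N (ζ • a • u - b • v)}

/-- Distance from a projective point to the projectivization of a subspace. -/
def distPSg {k : Type*} [NormedField k] {n : ℕ} (N : (Fin n → k) → ℝ) (u : Fin n → k)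
    (W : Submodule k (Fin n → k)) : ℝ :=
  sInf {r : ℝ | ∃ w : Fin n → k, w ∈ W ∧ w ≠ 0 ∧ r = dPg N u w}

/-- Operator norm of a square matrix with respect to a norm function `N`. -/
def opNg {k : Type*} [NormedField k] {n : ℕ} (N : (Fin n → k) → ℝ)
    (A : Matrix (Fin n) (Fin n) k) : ℝ :=
  sInf {c : ℝ | 0 ≤ c ∧ ∀ v : Fin n → k, N (A.mulVec v) ≤ c * N v}

/-- The block diagonal matrix `diag(κ₁, A, κₙ)`. -/
def blockD {k : Type*} [Field k] {n : ℕ} (κ₁ κₙ : k)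
    (A : Matrix (Fin (n - 2)) (Fin (n - 2)) k) : Matrix (Fin n) (Fin n) k :=
  Matrix.of fun i j =>
    if _h1 : (i : ℕ) = 0 then (if (j : ℕ) = 0 then κ₁ else 0)
    else if _h2 : (i : ℕ) = n - 1 then (if (j : ℕ) = n - 1 then κₙ else 0)
    else if _h3 : ((j : ℕ) = 0 ∨ (j : ℕ) = n - 1) then 0
    else A ⟨(i : ℕ) - 1, by have := i.2; omega⟩ ⟨(j : ℕ) - 1, by have := j.2; omega⟩

/-- The properties of the standard norms on the spaces `k^m` used below. -/
structure IsStandardNorm {k : Type*} [NormedField k] (N : ∀ m : ℕ, (Fin m → k) → ℝ) : Prop where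
  add_le : ∀ (m : ℕ) (x y : Fin m → k), N m (x + y) ≤ N m x + N m y
  smul_eq : ∀ (m : ℕ) (a : k) (x : Fin m → k), N m (a • x) = ‖a‖ * N m x
  coord_le : ∀ (m : ℕ) (x : Fin m → k) (i : Fin m), ‖x i‖ ≤ N m x
  single_le : ∀ (m : ℕ) (i : Fin m) (c : k), N m (Pi.single i c) ≤ ‖c‖
  comp_le : ∀ (m n : ℕ) (f : Fin m → Fin n), Function.Injective f →
    ∀ x : Fin n → k, N m (x ∘ f) ≤ N n x
  extend_le : ∀ (m n : ℕ) (f : Fin m → Fin n), Function.Injective f →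
    ∀ x : Fin m → k, N n (Function.extend f x 0) ≤ N m x
  exists_normalize : ∀ (m : ℕ) (x : Fin m → k), x ≠ 0 → ∃ b : k, N m (b • x) = 1
  exists_rescale : ∀ (m : ℕ) (x y : Fin m → k), N m (x - y) < N m y →
    ∃ s : k, ‖s‖ * N m x = N m y ∧ ‖s - 1‖ * N m x ≤ N m (x - y)

section StandardNorms

variable {k : Type*} [NormedField k] {N : ∀ m : ℕ, (Fin m → k) → ℝ}

theorem isStandardNorm_of_sup (hk : IsNonarchimedean fun x : k => ‖x‖)
    (hN : ∀ (m : ℕ) (v : Fin m → k), N m v = ⨆ i, ‖v i‖) : IsStandardNorm N := by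
  have hN' : ∀ (m : ℕ) (v : Fin m → k), N m v = ‖v‖ := by
    intro m v
    rw [hN]
    refine le_antisymm (Real.iSup_le (fun i => norm_le_pi_norm v i) (norm_nonneg v)) ?_
    refine (pi_norm_le_iff_of_nonneg (Real.iSup_nonneg fun i => norm_nonneg _)).2 fun i => ?_
    exact le_ciSup (f := fun i => ‖v i‖) (Set.finite_range _).bddAbove i
  have hmax : ∀ (m : ℕ) (v : Fin m → k), 0 < ‖v‖ → ∃ i, ‖v i‖ = ‖v‖ := by
    intro m v hv
    have : Nonempty (Fin m) := by
      by_contra hempty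
      rw [not_nonempty_iff] at hempty
      simp [Subsingleton.elim v 0] at hv
    obtain ⟨i, hi⟩ := Finite.exists_max fun i => ‖v i‖
    exact ⟨i, le_antisymm (norm_le_pi_norm v i) ((pi_norm_le_iff_of_nonneg (norm_nonneg _)).2 hi)⟩
  refine ⟨?_, ?_, ?_, ?_, ?_, ?_, ?_, ?_⟩ <;> simp only [hN']
  · exact fun m x y => norm_add_le x y
  · exact fun m a x => norm_smul a x
  · exact fun m x i => norm_le_pi_norm x i
  · exact fun m i c => (Pi.norm_single (G := fun _ : Fin m => k) c).le
  · exact fun m n f _ x =>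
      (pi_norm_le_iff_of_nonneg (norm_nonneg _)).2 fun i => norm_le_pi_norm x (f i)
  · intro m n f hf x
    refine (pi_norm_le_iff_of_nonneg (norm_nonneg _)).2 fun j => ?_
    by_cases hj : ∃ i, f i = j
    · obtain ⟨i, rfl⟩ := hj
      rw [hf.extend_apply]
      exact norm_le_pi_norm x i
    · rw [Function.extend_apply' _ _ _ hj]
      simp
  · intro m x hx
    have hx0 : 0 < ‖x‖ := norm_pos_iff.2 hx
    obtain ⟨i, hi⟩ := hmax m x hx0
    refine ⟨(x i)⁻¹, ?_⟩
    rw [norm_smul, norm_inv, hi, inv_mul_cancel₀ hx0.ne']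
  · intro m x y hxy
    refine ⟨1, ?_, by simp⟩
    rw [norm_one, one_mul]
    have hy0 : 0 < ‖y‖ := (norm_nonneg _).trans_lt hxy
    refine le_antisymm ((pi_norm_le_iff_of_nonneg hy0.le).2 fun i => ?_) ?_
    · have h1 := hk (x i - y i) (y i)
      simp only [sub_add_cancel] at h1
      refine h1.trans (max_le ?_ (norm_le_pi_norm y i))
      exact (norm_le_pi_norm (x - y) i).trans hxy.le
    · obtain ⟨i, hi⟩ := hmax m y hy0
      have h1 := hk (y i - x i) (x i)
      simp only [sub_add_cancel] at h1
      have h2 : ‖y i - x i‖ < ‖y i‖ := by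
        rw [norm_sub_rev, hi]
        exact (norm_le_pi_norm (x - y) i).trans_lt hxy
      rcases le_max_iff.1 h1 with h3 | h3
      · exact absurd h2 h3.not_gt
      · rw [← hi]
        exact h3.trans (norm_le_pi_norm x i)

theorem isStandardNorm_of_euclidean
    (hk : ∀ r : ℝ, 0 ≤ r → ∃ s : k, ‖s‖ = r ∧ ‖s - 1‖ = |r - 1|)
    (hN : ∀ (m : ℕ) (v : Fin m → k), N m v = Real.sqrt (∑ i, ‖v i‖ ^ 2)) :
    IsStandardNorm N := by
  have hN' : ∀ (m : ℕ) (v : Fin m → k),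
      N m v = ‖(WithLp.toLp 2 v : PiLp 2 fun _ : Fin m => k)‖ := by
    intro m v
    rw [hN, PiLp.norm_eq_of_L2]
  have hpos : ∀ (m : ℕ) (v : Fin m → k), v ≠ 0 → 0 < N m v := by
    intro m v hv
    rw [hN', norm_pos_iff]
    simpa using hv
  refine ⟨?_, ?_, ?_, ?_, ?_, ?_, ?_, ?_⟩
  · intro m x y
    simp only [hN', WithLp.toLp_add]
    exact norm_add_le _ _
  · intro m a x
    simp only [hN', WithLp.toLp_smul]
    exact norm_smul _ _
  · intro m x i
    rw [hN']
    exact PiLp.norm_apply_le (WithLp.toLp 2 x : PiLp 2 fun _ : Fin m => k) i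
  · intro m i c
    rw [hN, Finset.sum_eq_single i (fun j _ hj => by simp [hj]) (by simp)]
    simp
  · intro m n f hf x
    rw [hN, hN]
    refine Real.sqrt_le_sqrt ?_
    have h1 := Finset.sum_image (s := Finset.univ) (g := f) (f := fun j => ‖x j‖ ^ 2)
      (fun a _ b _ hab => hf hab)
    simp only [Function.comp_apply]
    rw [← h1]
    exact Finset.sum_le_sum_of_subset_of_nonneg (Finset.subset_univ _) fun _ _ _ => sq_nonneg _
  · intro m n f hf x
    rw [hN, hN]
    refine Real.sqrt_le_sqrt (le_of_eq ?_)
    rw [← Finset.sum_subset (Finset.subset_univ (Finset.univ.image f)),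
      Finset.sum_image (fun a _ b _ hab => hf hab)]
    · exact Finset.sum_congr rfl fun i _ => by rw [hf.extend_apply]
    · intro j _ hj
      rw [Function.extend_apply' _ _ _ (by simpa using hj)]
      simp
  · intro m x hx
    obtain ⟨s, hs, -⟩ := hk (N m x)⁻¹ (inv_nonneg.2 (hpos m x hx).le)
    refine ⟨s, ?_⟩
    have h1 := hpos m x hx
    rw [hN', WithLp.toLp_smul, norm_smul, ← hN', hs, inv_mul_cancel₀ h1.ne']
  · intro m x y hxy
    have hx : x ≠ 0 := by
      rintro rfl
      rw [hN', hN', zero_sub, WithLp.toLp_neg, norm_neg] at hxy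
      exact hxy.false
    have hx0 := hpos m x hx
    have hy0 : 0 ≤ N m y := by rw [hN']; exact norm_nonneg _
    obtain ⟨s, hs, hs1⟩ := hk (N m y / N m x) (div_nonneg hy0 hx0.le)
    refine ⟨s, ?_, ?_⟩
    · rw [hs, div_mul_cancel₀ _ hx0.ne']
    · rw [hs1]
      calc |N m y / N m x - 1| * N m x = |(N m y / N m x - 1) * N m x| := by
            rw [abs_mul, abs_of_pos hx0]
        _ = |N m x - N m y| := by
            rw [sub_mul, div_mul_cancel₀ _ hx0.ne', one_mul, abs_sub_comm]
        _ ≤ N m (x - y) := by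
            simp only [hN', WithLp.toLp_sub]
            exact abs_norm_sub_norm_le _ _

theorem opNg_nonneg {m : ℕ} (p : (Fin m → k) → ℝ) (A : Matrix (Fin m) (Fin m) k) :
    0 ≤ opNg p A :=
  Real.sInf_nonneg fun _ hc => hc.1

namespace IsStandardNorm

theorem nonneg (hN : IsStandardNorm N) {m : ℕ} (x : Fin m → k) : 0 ≤ N m x := by
  have h1 := hN.add_le m x (-x)
  have h2 := hN.smul_eq m (-1) x
  have h3 := hN.smul_eq m 0 x
  simp only [neg_smul, one_smul, norm_neg, norm_one, one_mul] at h2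
  simp only [zero_smul, norm_zero, zero_mul] at h3
  rw [add_neg_cancel, h2, h3] at h1
  linarith

theorem pos (hN : IsStandardNorm N) {m : ℕ} {x : Fin m → k} (hx : x ≠ 0) : 0 < N m x := by
  obtain ⟨i, hi⟩ := Function.ne_iff.1 hx
  exact (norm_pos_iff.2 hi).trans_le (hN.coord_le m x i)

theorem dPg_nonneg (hN : IsStandardNorm N) {m : ℕ} (x y : Fin m → k) : 0 ≤ dPg (N m) x y := by
  refine Real.sInf_nonneg ?_
  rintro r ⟨a, b, ζ, -, -, -, rfl⟩
  exact hN.nonneg _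

theorem dPg_le (hN : IsStandardNorm N) {m : ℕ} {x y : Fin m → k} {a b : k} (hx : N m (a • x) = 1)
    (hy : N m (b • y) = 1) : dPg (N m) x y ≤ N m (a • x - b • y) := by
  refine csInf_le ⟨0, ?_⟩ ⟨a, b, 1, hx, hy, norm_one, by rw [one_smul]⟩
  rintro r ⟨a, b, ζ, -, -, -, rfl⟩
  exact hN.nonneg _

theorem dPg_le_two (hN : IsStandardNorm N) {m : ℕ} {x y : Fin m → k} (hx : x ≠ 0) (hy : y ≠ 0) :
    dPg (N m) x y ≤ 2 := by
  obtain ⟨a, ha⟩ := hN.exists_normalize m x hx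
  obtain ⟨b, hb⟩ := hN.exists_normalize m y hy
  refine (hN.dPg_le ha hb).trans ?_
  have h1 := hN.add_le m (a • x) ((-1 : k) • b • y)
  rw [hN.smul_eq m (-1), ha, hb, norm_neg, norm_one, neg_one_smul, ← sub_eq_add_neg] at h1
  linarith

/-- A vector `x` close to a nonzero multiple of `y` is projectively close to `y`. -/
theorem dPg_le_of_sub_lt (hN : IsStandardNorm N) {m : ℕ} {x y : Fin m → k} (a : k)
    (hxy : N m (x - a • y) < N m (a • y)) :
    dPg (N m) y x ≤ 2 * (N m (x - a • y) / N m (a • y)) := by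
  have hy0 : a • y ≠ 0 := by
    intro h0
    rw [h0, sub_zero] at hxy
    have h1 := hN.smul_eq m 0 (0 : Fin m → k)
    rw [zero_smul, norm_zero, zero_mul] at h1
    rw [h1] at hxy
    exact (hN.nonneg x).not_gt hxy
  have hpos := hN.pos hy0
  obtain ⟨b, hb⟩ := hN.exists_normalize m _ hy0
  obtain ⟨s, hs, hs1⟩ := hN.exists_rescale m _ _ hxy
  have hb' : ‖b‖ = 1 / N m (a • y) := by
    rw [eq_div_iff hpos.ne', ← hN.smul_eq, hb]
  have hbx : N m ((b * s) • x) = 1 := by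
    rw [hN.smul_eq, norm_mul, mul_assoc, hs, hb', one_div, inv_mul_cancel₀ hpos.ne']
  have hby : N m ((b * a) • y) = 1 := by rw [mul_smul, hb]
  refine (hN.dPg_le hby hbx).trans ?_
  have h1 : (b * a) • y - (b * s) • x = (-b) • ((x - a • y) + (s - 1) • x) := by
    module
  rw [h1, hN.smul_eq, norm_neg, hb']
  have h2 := hN.add_le m (x - a • y) ((s - 1) • x)
  rw [hN.smul_eq m (s - 1) x] at h2
  rw [one_div, inv_mul_eq_div, ← mul_div_assoc]
  gcongr
  linarith

theorem distPSg_le (hN : IsStandardNorm N) {m : ℕ} {u w : Fin m → k}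
    {V : Submodule k (Fin m → k)} (hw : w ∈ V) (hw0 : w ≠ 0) :
    distPSg (N m) u V ≤ dPg (N m) u w := by
  refine csInf_le ⟨0, ?_⟩ ⟨w, hw, hw0, rfl⟩
  rintro r ⟨w, -, -, rfl⟩
  exact hN.dPg_nonneg u w

/-- A lower bound on the projective distance to a subspace bounds the linear distance below. -/
theorem le_sub_of_le_distPSg (hN : IsStandardNorm N) {m : ℕ} {u w : Fin m → k}
    {V : Submodule k (Fin m → k)} {ε : ℝ} (hε : ε ≤ 2) (hu : u ≠ 0)
    (huV : ε ≤ distPSg (N m) u V) (hw : w ∈ V) : ε / 2 * N m u ≤ N m (u - w) := by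
  by_contra! hlt
  have hu0 := hN.pos hu
  have hswap : N m (w - (1 : k) • u) = N m (u - w) := by
    have h1 := hN.smul_eq m (-1) (u - w)
    rw [neg_one_smul, neg_sub, norm_neg, norm_one, one_mul] at h1
    rwa [one_smul]
  have hlt1 : N m (u - w) < N m u := by nlinarith
  have hw0 : w ≠ 0 := by
    rintro rfl
    rw [sub_zero] at hlt1
    exact hlt1.false
  have h2 := hN.dPg_le_of_sub_lt (x := w) (y := u) 1 (by rw [hswap, one_smul]; exact hlt1)
  rw [hswap, one_smul] at h2
  have h3 : N m (u - w) / N m u < ε / 2 := by rwa [div_lt_iff₀ hu0]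
  linarith [huV.trans (hN.distPSg_le hw hw0)]

theorem le_opNg (hN : IsStandardNorm N) {m : ℕ} (A : Matrix (Fin m) (Fin m) k)
    (v : Fin m → k) : N m (A.mulVec v) ≤ opNg (N m) A * N m v := by
  have hzero : N m 0 = 0 := by
    have h1 := hN.smul_eq m 0 (0 : Fin m → k)
    rwa [zero_smul, norm_zero, zero_mul] at h1
  have hne : {c : ℝ | 0 ≤ c ∧ ∀ v : Fin m → k, N m (A.mulVec v) ≤ c * N m v}.Nonempty := by
    refine ⟨∑ j, N m (A.col j), Finset.sum_nonneg fun j _ => hN.nonneg _, fun v => ?_⟩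
    rw [Matrix.mulVec_eq_sum, Finset.sum_mul]
    refine (Finset.le_sum_of_subadditive (N m) hzero.le (hN.add_le m) _ _).trans ?_
    refine Finset.sum_le_sum fun j _ => ?_
    rw [op_smul_eq_smul, hN.smul_eq, mul_comm]
    exact mul_le_mul_of_nonneg_left (hN.coord_le m v j) (hN.nonneg _)
  rcases (hN.nonneg v).eq_or_lt with hv | hv
  · obtain ⟨c, hc0, hc⟩ := hne
    have := hc v
    rwa [← hv, mul_zero] at this ⊢
  · rw [← div_le_iff₀ hv]
    refine le_csInf hne ?_
    rintro c ⟨-, hc⟩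
    rw [div_le_iff₀ hv]
    exact hc v

theorem one_le_opNg_mul (hN : IsStandardNorm N) {m : ℕ} (hm : 0 < m)
    (A : (Matrix (Fin m) (Fin m) k)ˣ) :
    1 ≤ opNg (N m) (A : Matrix (Fin m) (Fin m) k) *
      opNg (N m) ((A⁻¹ : _) : Matrix (Fin m) (Fin m) k) := by
  have he : (Pi.single ⟨0, hm⟩ 1 : Fin m → k) ≠ 0 := by
    rw [Ne, Pi.single_eq_zero_iff]
    exact one_ne_zero
  have hpos := hN.pos he
  set e : Fin m → k := Pi.single ⟨0, hm⟩ 1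
  have h1 := hN.le_opNg (A : Matrix (Fin m) (Fin m) k)
    (((A⁻¹ : _) : Matrix (Fin m) (Fin m) k).mulVec e)
  rw [Matrix.mulVec_mulVec, Units.mul_inv, Matrix.one_mulVec] at h1
  have h2 := mul_le_mul_of_nonneg_left
    (hN.le_opNg ((A⁻¹ : _) : Matrix (Fin m) (Fin m) k) e)
    (opNg_nonneg (N m) (A : Matrix (Fin m) (Fin m) k))
  rw [← mul_assoc] at h2
  nlinarith

/-- The seminorm on `k^m` underlying a standard norm. -/
def toSeminorm (hN : IsStandardNorm N) (m : ℕ) : Seminorm k (Fin m → k) :=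
  Seminorm.of (N m) (hN.add_le m) (hN.smul_eq m)

end IsStandardNorm

end StandardNorms

section BlockDiagonal

variable {k : Type*} [NormedField k] {m : ℕ}

theorem fin_cases_first_last {q : Fin (m + 2) → Prop} (h0 : q 0) (hl : q (Fin.last (m + 1)))
    (hm : ∀ i : Fin m, q i.castSucc.succ) (i : Fin (m + 2)) : q i := by
  refine Fin.cases h0 (fun j => ?_) i
  exact Fin.lastCases hl hm j

theorem blockD_mulVec_zero (a b : k) (A : Matrix (Fin m) (Fin m) k) (y : Fin (m + 2) → k) :
    (blockD (n := m + 2) a b A).mulVec y 0 = a * y 0 := by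
  rw [Matrix.mulVec, dotProduct, Finset.sum_eq_single 0]
  · simp [blockD]
  · intro j _ hj
    simp [blockD, hj]
  · simp

theorem blockD_mulVec_last (a b : k) (A : Matrix (Fin m) (Fin m) k) (y : Fin (m + 2) → k) :
    (blockD (n := m + 2) a b A).mulVec y (Fin.last (m + 1)) = b * y (Fin.last (m + 1)) := by
  rw [Matrix.mulVec, dotProduct, Finset.sum_eq_single (Fin.last (m + 1))]
  · simp [blockD]
  · intro j _ hj
    have : (j : ℕ) ≠ m + 1 := fun h => hj (Fin.ext h)
    simp [blockD, this]
  · simp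

theorem blockD_mulVec_middle (a b : k) (A : Matrix (Fin m) (Fin m) k) (y : Fin (m + 2) → k)
    (i : Fin m) :
    (blockD (n := m + 2) a b A).mulVec y i.castSucc.succ =
      A.mulVec (y ∘ fun j => j.castSucc.succ) i := by
  have hi : (i : ℕ) ≠ m := i.2.ne
  rw [Matrix.mulVec, dotProduct, Fin.sum_univ_succ, Fin.sum_univ_castSucc, Matrix.mulVec,
    dotProduct]
  have hj : ∀ j : Fin m, (j : ℕ) ≠ m := fun j => j.2.ne
  simp [blockD, hi, hj]

theorem blockD_mul_eq_one {a b a' b' : k} {A A' : Matrix (Fin m) (Fin m) k} (ha : a * a' = 1)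
    (hb : b * b' = 1) (hA : A * A' = 1) :
    blockD (n := m + 2) a b A * blockD (n := m + 2) a' b' A' = 1 := by
  refine Matrix.ext_of_mulVec_single fun j => ?_
  rw [← Matrix.mulVec_mulVec, Matrix.one_mulVec]
  generalize (Pi.single j 1 : Fin (m + 2) → k) = y
  funext i
  induction i using fin_cases_first_last with
  | h0 =>
    rw [blockD_mulVec_zero, blockD_mulVec_zero, ← mul_assoc, ha, one_mul]
  | hl =>
    rw [blockD_mulVec_last, blockD_mulVec_last, ← mul_assoc, hb, one_mul]
  | hm i =>
    rw [blockD_mulVec_middle]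
    have : (blockD (n := m + 2) a' b' A').mulVec y ∘ (fun j : Fin m => j.castSucc.succ) =
        A'.mulVec (y ∘ fun j => j.castSucc.succ) :=
      funext fun i => blockD_mulVec_middle a' b' A' y i
    rw [this, Matrix.mulVec_mulVec, hA, Matrix.one_mulVec]
    rfl

theorem blockD_mulVec_eq (a b : k) (A : Matrix (Fin m) (Fin m) k) (y : Fin (m + 2) → k) :
    (blockD (n := m + 2) a b A).mulVec y = Pi.single 0 (a * y 0) +
      Pi.single (Fin.last (m + 1)) (b * y (Fin.last (m + 1))) +
      Function.extend (fun j : Fin m => j.castSucc.succ)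
        (A.mulVec (y ∘ fun j => j.castSucc.succ)) 0 := by
  have hinj : Function.Injective fun j : Fin m => j.castSucc.succ :=
    (Fin.succ_injective _).comp (Fin.castSucc_injective _)
  have h0 : ¬ ∃ j : Fin m, j.castSucc.succ = 0 := fun ⟨j, hj⟩ => Fin.succ_ne_zero _ hj
  have hl : ∀ j : Fin m, j.castSucc.succ ≠ Fin.last (m + 1) := fun j hj => by
    have := congrArg Fin.val hj
    simp only [Fin.val_succ, Fin.val_castSucc, Fin.val_last] at this
    have := j.2
    omega
  funext i
  induction i using fin_cases_first_last with
  | h0 =>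
    rw [blockD_mulVec_zero, Pi.add_apply, Pi.add_apply, Function.extend_apply' _ _ _ h0]
    simp
  | hl =>
    rw [blockD_mulVec_last, Pi.add_apply, Pi.add_apply,
      Function.extend_apply' _ _ _ (fun ⟨j, hj⟩ => hl j hj)]
    simp
  | hm i =>
    rw [blockD_mulVec_middle, Pi.add_apply, Pi.add_apply, hinj.extend_apply,
      Pi.single_eq_of_ne (Fin.succ_ne_zero _), Pi.single_eq_of_ne (hl i), zero_add, zero_add]

variable {N : ∀ m : ℕ, (Fin m → k) → ℝ}

theorem IsStandardNorm.extend_add_single_le (hN : IsStandardNorm N) (i : Fin (m + 2)) (c : k)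
    (A : Matrix (Fin m) (Fin m) k) (y : Fin (m + 2) → k) :
    N (m + 2) (Pi.single i (c * y i) + Function.extend (fun j : Fin m => j.castSucc.succ)
      (A.mulVec (y ∘ fun j => j.castSucc.succ)) 0) ≤
      (opNg (N m) A + ‖c‖) * N (m + 2) y := by
  have hinj : Function.Injective fun j : Fin m => j.castSucc.succ :=
    (Fin.succ_injective _).comp (Fin.castSucc_injective _)
  refine (hN.add_le _ _ _).trans ?_
  have h1 := hN.single_le (m + 2) i (c * y i)
  have h2 := hN.extend_le _ _ _ hinj (A.mulVec (y ∘ fun j => j.castSucc.succ))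
  have h3 := hN.le_opNg A (y ∘ fun j => j.castSucc.succ)
  have h4 := mul_le_mul_of_nonneg_left (hN.comp_le _ _ _ hinj y) (opNg_nonneg (N m) A)
  have h5 := mul_le_mul_of_nonneg_left (hN.coord_le _ y i) (norm_nonneg c)
  rw [norm_mul] at h1
  linarith

end BlockDiagonal

section Dynamics

variable {k E : Type*} [NormedField k] [AddCommGroup E] [Module k E] (p : Seminorm k E)

/-- `u` has relative distance at least `ρ` from the subspace `V`. -/
def IsFarFrom (V : Submodule k E) (ρ : ℝ) (u : E) : Prop :=
  ∀ w ∈ V, ρ * p u ≤ p (u - w)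

/-- `u` is within relative distance `τ` of a multiple of `v`. -/
def IsNearLine (v : E) (τ : ℝ) (u : E) : Prop :=
  ∃ a : k, p (u - a • v) ≤ τ * p (a • v)

variable {p} {V : Submodule k E} {ρ : ℝ} {v u : E}

theorem IsFarFrom.smul (hu : IsFarFrom p V ρ u) (a : k) : IsFarFrom p V ρ (a • u) := by
  intro w hw
  rcases eq_or_ne a 0 with rfl | ha
  · simp
  · have h1 := hu (a⁻¹ • w) (V.smul_mem _ hw)
    have h2 : a • u - w = a • (u - a⁻¹ • w) := by rw [smul_sub, smul_inv_smul₀ ha]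
    rw [h2, map_smul_eq_mul, map_smul_eq_mul, mul_left_comm]
    exact mul_le_mul_of_nonneg_left h1 (norm_nonneg a)

theorem IsFarFrom.mono {ρ' : ℝ} (hu : IsFarFrom p V ρ u) (h : ρ' ≤ ρ) : IsFarFrom p V ρ' u :=
  fun w hw => (mul_le_mul_of_nonneg_right h (apply_nonneg p u)).trans (hu w hw)

/-- Perturbing a vector by a small relative error keeps it far from a subspace. -/
theorem IsFarFrom.of_sub_le {ρ' τ : ℝ} {u' : E} (hu : IsFarFrom p V ρ u)
    (huu' : p (u' - u) ≤ τ * p u) (hρ' : 0 ≤ ρ') (h : ρ' * (1 + τ) ≤ ρ - τ) :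
    IsFarFrom p V ρ' u' := by
  intro w hw
  have h1 := hu w hw
  have h2 := map_add_le_add p (u' - u) u
  rw [sub_add_cancel] at h2
  have h3 := map_add_le_add p (u' - w) (u - u')
  rw [add_comm, sub_add_sub_cancel, map_sub_rev p u u'] at h3
  have h4 : ρ' * p u' ≤ ρ' * ((1 + τ) * p u) := mul_le_mul_of_nonneg_left (by linarith) hρ'
  have h5 := mul_le_mul_of_nonneg_right h (apply_nonneg p u)
  linarith

theorem IsNearLine.isFarFrom {ρ' τ : ℝ} (hu : IsNearLine p v τ u) (hv : IsFarFrom p V ρ v)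
    (hρ' : 0 ≤ ρ') (h : ρ' * (1 + τ) ≤ ρ - τ) : IsFarFrom p V ρ' u := by
  obtain ⟨a, ha⟩ := hu
  exact (hv.smul a).of_sub_le ha hρ' h

variable {φ : E → k} {κ : k} {K δ ε L : ℝ} {G W₁ W₂ : E → E}

/-- One step of the perturbed dynamics: a vector far from the repelling hyperplane is sent
close to the attracting line and is stretched. -/
theorem isNearLine_and_le_of_isFarFrom (hδ0 : 0 < δ) (hε0 : 0 < ε) (hε2 : ε ≤ 2)
    (hδε : δ ≤ ε / 100) (hL : 0 ≤ L)
    (hφ : ∀ u, u - φ u • v ∈ V) (hG : ∀ u, p (G u - (κ * φ u) • v) ≤ K * p u)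
    (hW₁ : ∀ u, p (W₁ u - u) ≤ δ / 10 * p u) (hW₂ : ∀ u, p (W₂ u - u) ≤ δ / 10 * p u)
    (hK : K ≤ δ / 100 * (ε / 5 * ‖κ‖)) (hκ : 1000 * L ≤ ‖κ‖ * ε)
    (hu : IsFarFrom p V (ε / 4) u) :
    IsNearLine p v (δ / 4) (W₁ (G (W₂ u))) ∧ L * p u ≤ p (W₁ (G (W₂ u))) := by
  have hfar : IsFarFrom p V (ε / 5) (W₂ u) :=
    hu.of_sub_le (hW₂ u) (by positivity) (by nlinarith)
  have hW₂u := map_add_le_add p (W₂ u) (u - W₂ u)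
  rw [add_sub_cancel, map_sub_rev p u] at hW₂u
  have hW₂u' := hW₂ u
  set x := W₂ u
  have h1 := hfar _ (hφ x)
  rw [sub_sub_cancel] at h1
  have h2 : ‖κ‖ * (ε / 5 * p x) ≤ p ((κ * φ x) • v) := by
    rw [mul_smul, map_smul_eq_mul p κ]
    exact mul_le_mul_of_nonneg_left h1 (norm_nonneg κ)
  have h3 := hG x
  have hx0 := apply_nonneg p x
  have hu0 := apply_nonneg p u
  have h4 : K * p x ≤ δ / 100 * p ((κ * φ x) • v) := by
    have h5 := mul_le_mul_of_nonneg_right hK hx0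
    have h6 := mul_le_mul_of_nonneg_left h2 (by positivity : 0 ≤ δ / 100)
    linarith
  have h5 := map_add_le_add p (G x - (κ * φ x) • v) ((κ * φ x) • v)
  rw [sub_add_cancel] at h5
  have h6 := map_add_le_add p (G x) ((κ * φ x) • v - G x)
  rw [add_sub_cancel, map_sub_rev p _ (G x)] at h6
  have h7 := hW₁ (G x)
  have h8 := map_add_le_add p (W₁ (G x)) (G x - W₁ (G x))
  rw [add_sub_cancel, map_sub_rev p (G x)] at h8
  have h9 := map_add_le_add p (W₁ (G x) - G x) (G x - (κ * φ x) • v)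
  rw [sub_add_sub_cancel] at h9
  have hδ1 : δ ≤ 1 / 50 := by linarith
  have hy0 := apply_nonneg p ((κ * φ x) • v)
  have hGx0 := apply_nonneg p (G x)
  set T := p ((κ * φ x) • v)
  have hGx : p (G x) ≤ 2 * T := by nlinarith
  refine ⟨⟨κ * φ x, ?_⟩, ?_⟩
  · change p (W₁ (G x) - (κ * φ x) • v) ≤ δ / 4 * T
    have := mul_le_mul_of_nonneg_left hGx (by positivity : 0 ≤ δ / 10)
    nlinarith [mul_nonneg hδ0.le hy0]
  · have e1 : p u ≤ 2 * p x := by nlinarith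
    have e2 : 1000 * L * p x ≤ ‖κ‖ * ε * p x := mul_le_mul_of_nonneg_right hκ hx0
    have e3 : T ≤ 2 * p (G x) := by nlinarith
    have e4 : p (G x) ≤ 2 * p (W₁ (G x)) := by nlinarith
    have e5 := mul_le_mul_of_nonneg_left e1 hL
    linarith [mul_nonneg hL hx0]

theorem isNearLine_and_pow_le_iterate (hδ0 : 0 < δ) (hε0 : 0 < ε) (hε2 : ε ≤ 2)
    (hδε : δ ≤ ε / 100) (hL : 0 ≤ L)
    (hφ : ∀ u, u - φ u • v ∈ V) (hG : ∀ u, p (G u - (κ * φ u) • v) ≤ K * p u)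
    (hW₁ : ∀ u, p (W₁ u - u) ≤ δ / 10 * p u) (hW₂ : ∀ u, p (W₂ u - u) ≤ δ / 10 * p u)
    (hK : K ≤ δ / 100 * (ε / 5 * ‖κ‖)) (hκ : 1000 * L ≤ ‖κ‖ * ε)
    (hv : IsFarFrom p V (ε / 2) v) (hu : IsFarFrom p V (ε / 2) u) (j : ℕ) :
    IsNearLine p v (δ / 4) ((fun x => W₁ (G (W₂ x)))^[j + 1] u) ∧
      L ^ (j + 1) * p u ≤ p ((fun x => W₁ (G (W₂ x)))^[j + 1] u) := by
  induction j with
  | zero =>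
    simpa using isNearLine_and_le_of_isFarFrom hδ0 hε0 hε2 hδε hL hφ hG hW₁ hW₂ hK hκ
      (hu.mono (by linarith))
  | succ j ih =>
    rw [Function.iterate_succ_apply']
    have hfar := ih.1.isFarFrom (ρ' := ε / 4) hv (by positivity) (by nlinarith)
    have h1 := isNearLine_and_le_of_isFarFrom hδ0 hε0 hε2 hδε hL hφ hG hW₁ hW₂ hK hκ hfar
    refine ⟨h1.1, le_trans ?_ h1.2⟩
    rw [pow_succ', mul_assoc]
    exact mul_le_mul_of_nonneg_left ih.2 hL

end Dynamics

section Attraction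

variable {k : Type*} [NormedField k] {N : ∀ m : ℕ, (Fin m → k) → ℝ} {n : ℕ}

theorem IsStandardNorm.dPg_le_and_pow_le (hN : IsStandardNorm N)
    (h : (Matrix (Fin n) (Fin n) k)ˣ) {D G S W₁ W₂ : Matrix (Fin n) (Fin n) k} {i j : Fin n}
    (hij : j ≠ i) {κ : k} {M δ ε L : ℝ} (hδ0 : 0 < δ) (hε0 : 0 < ε) (hδε : δ ≤ ε / 100)
    (hL : 0 < L)
    (hD : ∀ y, N n (D.mulVec y - Pi.single i (κ * y i)) ≤ M * N n y)
    (hG : G = (h : Matrix (Fin n) (Fin n) k) * D * ((h⁻¹ : _) : Matrix (Fin n) (Fin n) k))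
    (hS : S = W₁ * G * W₂) {v : Fin n → k} {V : Submodule k (Fin n → k)}
    (hv : v = (h : Matrix (Fin n) (Fin n) k).mulVec (Pi.single i 1))
    (hV : V = (LinearMap.ker (LinearMap.proj i : (Fin n → k) →ₗ[k] k)).map
      (Matrix.mulVecLin (h : Matrix (Fin n) (Fin n) k)))
    (hεv : ε ≤ distPSg (N n) v V)
    (hW₁ : opNg (N n) (W₁ - 1) ≤ δ / 10) (hW₂ : opNg (N n) (W₂ - 1) ≤ δ / 10)
    (hM : ε ≤ 2 → M * (opNg (N n) (h : Matrix (Fin n) (Fin n) k) *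
      opNg (N n) ((h⁻¹ : _) : Matrix (Fin n) (Fin n) k)) ≤ δ / 100 * (ε / 5 * ‖κ‖))
    (hM0 : 0 ≤ M) (hκ : 1000 * L ≤ ‖κ‖ * ε) {u : Fin n → k} (hu0 : u ≠ 0)
    (hu : ε ≤ distPSg (N n) u V) (r : ℕ) :
    dPg (N n) v ((S ^ (r + 1)).mulVec u) ≤ δ ∧
      L ^ (r + 1) * N n u ≤ N n ((S ^ (r + 1)).mulVec u) := by
  have hinv : ∀ y, ((h⁻¹ : _) : Matrix (Fin n) (Fin n) k).mulVec
      ((h : Matrix (Fin n) (Fin n) k).mulVec y) = y := fun y => by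
    rw [Matrix.mulVec_mulVec, Units.inv_mul, Matrix.one_mulVec]
  have hinv' : ∀ y, (h : Matrix (Fin n) (Fin n) k).mulVec
      (((h⁻¹ : _) : Matrix (Fin n) (Fin n) k).mulVec y) = y := fun y => by
    rw [Matrix.mulVec_mulVec, Units.mul_inv, Matrix.one_mulVec]
  have hne : ∀ l : Fin n, (h : Matrix (Fin n) (Fin n) k).mulVec (Pi.single l 1) ≠ 0 := by
    intro l hl
    have h1 := hinv (Pi.single l 1)
    rw [hl, Matrix.mulVec_zero] at h1
    exact one_ne_zero (Pi.single_eq_zero_iff.1 h1.symm)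
  have hε2 : ε ≤ 2 := by
    refine (hεv.trans (hN.distPSg_le (w := (h : Matrix (Fin n) (Fin n) k).mulVec
      (Pi.single j 1)) ?_ (hne j))).trans (hN.dPg_le_two (hv ▸ hne i) (hne j))
    rw [hV]
    exact Submodule.mem_map_of_mem (by simp [hij.symm])
  have hsingle : ∀ c : k, (h : Matrix (Fin n) (Fin n) k).mulVec (Pi.single i c) = c • v := by
    intro c
    rw [hv, ← Matrix.mulVec_smul, ← Pi.single_smul, smul_eq_mul, mul_one]
  have hW : ∀ W : Matrix (Fin n) (Fin n) k, opNg (N n) (W - 1) ≤ δ / 10 →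
      ∀ x, hN.toSeminorm n (W.mulVec x - x) ≤ δ / 10 * hN.toSeminorm n x := by
    intro W hW x
    have h1 := hN.le_opNg (W - 1) x
    rw [Matrix.sub_mulVec, Matrix.one_mulVec] at h1
    exact h1.trans (mul_le_mul_of_nonneg_right hW (hN.nonneg x))
  have key := isNearLine_and_pow_le_iterate (p := hN.toSeminorm n) (V := V) (v := v) (u := u)
    (φ := fun x => ((h⁻¹ : _) : Matrix (Fin n) (Fin n) k).mulVec x i) (κ := κ)
    (K := M * (opNg (N n) (h : Matrix (Fin n) (Fin n) k) *
      opNg (N n) ((h⁻¹ : _) : Matrix (Fin n) (Fin n) k)))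
    (G := G.mulVec) (W₁ := W₁.mulVec) (W₂ := W₂.mulVec) hδ0 hε0 hε2 hδε hL.le ?_ ?_
    (hW W₁ hW₁) (hW W₂ hW₂) (hM hε2) hκ
    (fun w hw => hN.le_sub_of_le_distPSg hε2 (hv ▸ hne i) hεv hw)
    (fun w hw => hN.le_sub_of_le_distPSg hε2 hu0 hu hw) r
  · have hiter : ∀ l : ℕ, (fun x => W₁.mulVec (G.mulVec (W₂.mulVec x)))^[l] u =
        (S ^ l).mulVec u := by
      intro l
      induction l with
      | zero => simp
      | succ l ih =>
        rw [Function.iterate_succ_apply', ih, pow_succ', hS]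
        simp only [Matrix.mulVec_mulVec, Matrix.mul_assoc]
    rw [hiter] at key
    obtain ⟨⟨a, ha⟩, hgrow⟩ := key
    change N n ((S ^ (r + 1)).mulVec u - a • v) ≤ δ / 4 * N n (a • v) at ha
    change L ^ (r + 1) * N n u ≤ N n ((S ^ (r + 1)).mulVec u) at hgrow
    refine ⟨?_, hgrow⟩
    have hx : 0 < N n ((S ^ (r + 1)).mulVec u) :=
      (mul_pos (pow_pos hL _) (hN.pos hu0)).trans_le hgrow
    have hav : 0 < N n (a • v) := by
      have h1 := hN.add_le n ((S ^ (r + 1)).mulVec u - a • v) (a • v)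
      rw [sub_add_cancel] at h1
      by_contra! hle
      have := mul_nonpos_of_nonneg_of_nonpos (by positivity : 0 ≤ δ / 4) hle
      linarith
    refine (hN.dPg_le_of_sub_lt a (ha.trans_lt ?_)).trans ?_
    · nlinarith
    · have := (div_le_iff₀ hav).2 ha
      linarith
  · intro x
    rw [hV]
    refine ⟨((h⁻¹ : _) : Matrix (Fin n) (Fin n) k).mulVec x -
      Pi.single i (((h⁻¹ : _) : Matrix (Fin n) (Fin n) k).mulVec x i), by simp, ?_⟩
    rw [Matrix.mulVecLin_apply, Matrix.mulVec_sub, hinv', hsingle]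
  · intro x
    set y := ((h⁻¹ : _) : Matrix (Fin n) (Fin n) k).mulVec x with hy
    have h1 : G.mulVec x - (κ * y i) • v = (h : Matrix (Fin n) (Fin n) k).mulVec
        (D.mulVec y - Pi.single i (κ * y i)) := by
      rw [Matrix.mulVec_sub, hsingle, hG, hy, Matrix.mulVec_mulVec, Matrix.mulVec_mulVec]
    change N n (G.mulVec x - (κ * y i) • v) ≤ _ * N n x
    have h2 := mul_le_mul_of_nonneg_left
      (hN.le_opNg ((h⁻¹ : _) : Matrix (Fin n) (Fin n) k) x) hM0
    have h3 := mul_le_mul_of_nonneg_left ((hD y).trans h2)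
      (opNg_nonneg (N n) (h : Matrix (Fin n) (Fin n) k))
    rw [h1]
    refine (hN.le_opNg _ _).trans (h3.trans (le_of_eq ?_))
    ring

/-- The numerical bound on the non-dominant part extracted from the spectral gap. -/
theorem mul_half_le_of_gap {a b x B C T δ ε : ℝ} (hδ : 0 < δ) (hε : 0 < ε) (hε2 : ε ≤ 2)
    (hT : 1 ≤ T) (hC : 2 ≤ C) (hx : 0 ≤ x) (hB : B = 10 ^ 6 * T * (ε ^ 2 * δ)⁻¹ * C ^ 4)
    (ha : B * a ≤ x) (hb : B * b ≤ x) :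
    (a + b) * (C / 2) ≤ δ / 100 * (ε / 5 * x) := by
  have hC0 : 0 < C := by linarith
  have hT0 : 0 < T := by linarith
  have hBpos : 0 < B := by rw [hB]; positivity
  have h1 : a + b ≤ 2 * (x / B) := by
    have ha' := (le_div_iff₀' hBpos).2 ha
    have hb' := (le_div_iff₀' hBpos).2 hb
    linarith
  have h2 : C ≤ δ * ε / 500 * B := by
    have h3 : δ * ε / 500 * B = 2000 * T * C ^ 4 / ε := by
      rw [hB]
      field_simp
      norm_num
    rw [h3, le_div_iff₀ hε]
    have h4 : (1 : ℝ) ≤ C ^ 3 := one_le_pow₀ (by linarith)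
    have h5 : 1 ≤ T * C ^ 3 := one_le_mul_of_one_le_of_one_le hT h4
    nlinarith
  calc (a + b) * (C / 2) ≤ 2 * (x / B) * (C / 2) := by gcongr
    _ = x / B * C := by ring
    _ ≤ x / B * (δ * ε / 500 * B) := by gcongr
    _ = δ / 100 * (ε / 5 * x) := by
      field_simp
      ring

end Attraction

/-- perturbation lemma for biproximal elements: with `g = h·diag(κ₁,A,κₙ)·h⁻¹`
of determinant one, strong domination hypotheses on `κ₁, κₙ` relative to `α, δ, ε, C(h)`,
every `g' = g·w` with `‖w^{±1} − I‖ < δ/10` satisfies, for all `p ≠ 0` and `[v] ∈ M_ε(g)`: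
`[(g')^p v] ∈ B_δ(g⁺) ∪ B_δ(g⁻)` and `‖(g')^p v‖ ≥ e^{α|p|}·‖v‖`. -/
theorem stmt4 {k : Type*} [NormedField k] (N : ∀ m : ℕ, (Fin m → k) → ℝ)
    (hLF :
      ((IsNonarchimedean fun x : k => ‖x‖) ∧ CompleteSpace k ∧ LocallyCompactSpace k ∧
        (∃ x : k, 1 < ‖x‖) ∧ ∀ (m : ℕ) (v : Fin m → k), N m v = ⨆ i, ‖v i‖) ∨
      (((∃ e : k ≃+* ℝ, ∀ x : k, ‖e x‖ = ‖x‖) ∨ (∃ e : k ≃+* ℂ, ∀ x : k, ‖e x‖ = ‖x‖)) ∧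
        ∀ (m : ℕ) (v : Fin m → k), N m v = Real.sqrt (∑ i, ‖v i‖ ^ 2)))
    (n : ℕ) (hn : 3 ≤ n)
    (h : (Matrix (Fin n) (Fin n) k)ˣ) (κ₁ κₙ : k) (hκ₁ : κ₁ ≠ 0) (hκₙ : κₙ ≠ 0)
    (A : (Matrix (Fin (n - 2)) (Fin (n - 2)) k)ˣ)
    (hA1 : opNg (N (n - 2)) (A : Matrix (Fin (n - 2)) (Fin (n - 2)) k) < ‖κ₁‖)
    (hA2 : opNg (N (n - 2)) ((A⁻¹ : _) : Matrix (Fin (n - 2)) (Fin (n - 2)) k) < ‖κₙ‖⁻¹)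
    (g : (Matrix (Fin n) (Fin n) k)ˣ)
    (hg : (g : Matrix (Fin n) (Fin n) k) =
      (h : Matrix (Fin n) (Fin n) k) * blockD κ₁ κₙ (A : Matrix (Fin (n - 2)) (Fin (n - 2)) k) *
        ((h⁻¹ : _) : Matrix (Fin n) (Fin n) k))
    (hdet : (g : Matrix (Fin n) (Fin n) k).det = 1)
    (C : ℝ)
    (hC : C = 2 * opNg (N n) (h : Matrix (Fin n) (Fin n) k) *
      opNg (N n) ((h⁻¹ : _) : Matrix (Fin n) (Fin n) k))
    (gplus gminus : Fin n → k)
    (hgp : gplus = (h : Matrix (Fin n) (Fin n) k).mulVec (Pi.single ⟨0, by omega⟩ 1))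
    (hgm : gminus = (h : Matrix (Fin n) (Fin n) k).mulVec (Pi.single ⟨n - 1, by omega⟩ 1))
    (Vminus Vplus : Submodule k (Fin n → k))
    (hVm : Vminus = (LinearMap.ker
        (LinearMap.proj (⟨0, by omega⟩ : Fin n) : (Fin n → k) →ₗ[k] k)).map
      (Matrix.mulVecLin (h : Matrix (Fin n) (Fin n) k)))
    (hVp : Vplus = (LinearMap.ker
        (LinearMap.proj (⟨n - 1, by omega⟩ : Fin n) : (Fin n → k) →ₗ[k] k)).map
      (Matrix.mulVecLin (h : Matrix (Fin n) (Fin n) k)))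
    (α δ ε : ℝ) (hα : 0 < α) (hδ0 : 0 < δ) (hε0 : 0 < ε)
    (hεle : ε ≤ min (distPSg (N n) gplus Vminus) (distPSg (N n) gminus Vplus))
    (hδle : δ ≤ (10 : ℝ)⁻¹ ^ 2 * ε)
    (hcond1 : 10 ^ 6 * Real.exp (α + 8) * (ε ^ 2 * δ)⁻¹ * C ^ 4 ≤
      min (‖κ₁‖ / opNg (N (n - 2)) (A : Matrix (Fin (n - 2)) (Fin (n - 2)) k))
        ((‖κₙ‖ * opNg (N (n - 2)) ((A⁻¹ : _) : Matrix (Fin (n - 2)) (Fin (n - 2)) k))⁻¹))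
    (hcond2 : 10 ^ 3 * Real.exp (α + 8) * ε⁻¹ * C ^ 2 ≤ min ‖κ₁‖ ‖κₙ‖⁻¹) :
    ∀ w : (Matrix (Fin n) (Fin n) k)ˣ,
      opNg (N n) ((w : Matrix (Fin n) (Fin n) k) - 1) < δ / 10 →
      opNg (N n) (((w⁻¹ : _) : Matrix (Fin n) (Fin n) k) - 1) < δ / 10 →
      ∀ p : ℤ, p ≠ 0 →
        ∀ v : Fin n → k, v ≠ 0 →
          ε ≤ distPSg (N n) v Vplus → ε ≤ distPSg (N n) v Vminus →
          ((dPg (N n) gplus ((((g * w) ^ p : _) : Matrix (Fin n) (Fin n) k).mulVec v) ≤ δ ∨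
            dPg (N n) gminus ((((g * w) ^ p : _) : Matrix (Fin n) (Fin n) k).mulVec v) ≤ δ) ∧
          Real.exp (α * (p.natAbs : ℝ)) * N n v ≤
            N n ((((g * w) ^ p : _) : Matrix (Fin n) (Fin n) k).mulVec v)) := by
  have hN : IsStandardNorm N := by
    rcases hLF with ⟨hna, -, -, -, hsup⟩ | ⟨⟨e, he⟩ | ⟨e, he⟩, heuc⟩
    · exact isStandardNorm_of_sup hna hsup
    · refine isStandardNorm_of_euclidean (fun r hr => ⟨e.symm r, ?_, ?_⟩) heuc
      · rw [← he, e.apply_symm_apply, Real.norm_of_nonneg hr]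
      · rw [← he, map_sub, e.apply_symm_apply, map_one, Real.norm_eq_abs]
    · refine isStandardNorm_of_euclidean (fun r hr => ⟨e.symm r, ?_, ?_⟩) heuc
      · rw [← he, e.apply_symm_apply, Complex.norm_of_nonneg hr]
      · rw [← he, map_sub, e.apply_symm_apply, map_one, ← Complex.ofReal_one,
          ← Complex.ofReal_sub, Complex.norm_real, Real.norm_eq_abs]
  intro w hw hw' p hp v hv0 hvp hvm
  obtain ⟨m, rfl⟩ : ∃ m, n = m + 2 := ⟨n - 2, by omega⟩
  change (Matrix (Fin m) (Fin m) k)ˣ at A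
  change opNg (N m) (A : Matrix (Fin m) (Fin m) k) < ‖κ₁‖ at hA1
  change opNg (N m) ((A⁻¹ : _) : Matrix (Fin m) (Fin m) k) < ‖κₙ‖⁻¹ at hA2
  change _ ≤ min (‖κ₁‖ / opNg (N m) (A : Matrix (Fin m) (Fin m) k))
    ((‖κₙ‖ * opNg (N m) ((A⁻¹ : _) : Matrix (Fin m) (Fin m) k))⁻¹) at hcond1
  have hab := hN.one_le_opNg_mul (by omega : 0 < m) A
  have ha0 := opNg_nonneg (N m) (A : Matrix (Fin m) (Fin m) k)
  have hb0 := opNg_nonneg (N m) ((A⁻¹ : _) : Matrix (Fin m) (Fin m) k)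
  have hC2 : 2 ≤ C := by
    have := hN.one_le_opNg_mul (by omega : 0 < m + 2) h
    rw [hC]
    linarith
  have hC0 : 0 < C := by linarith
  have hhC : opNg (N (m + 2)) (h : Matrix (Fin (m + 2)) (Fin (m + 2)) k) *
      opNg (N (m + 2)) ((h⁻¹ : _) : Matrix (Fin (m + 2)) (Fin (m + 2)) k) = C / 2 := by
    rw [hC]
    ring
  have ha_pos : 0 < opNg (N m) (A : Matrix (Fin m) (Fin m) k) :=
    ha0.lt_of_ne fun h0 => by
      rw [← h0, zero_mul] at hab
      linarith
  have hb_pos : 0 < opNg (N m) ((A⁻¹ : _) : Matrix (Fin m) (Fin m) k) :=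
    hb0.lt_of_ne fun h0 => by
      rw [← h0, mul_zero] at hab
      linarith
  set a := opNg (N m) (A : Matrix (Fin m) (Fin m) k)
  set b := opNg (N m) ((A⁻¹ : _) : Matrix (Fin m) (Fin m) k)
  obtain ⟨B, hB⟩ : ∃ B, B = 10 ^ 6 * Real.exp (α + 8) * (ε ^ 2 * δ)⁻¹ * C ^ 4 := ⟨_, rfl⟩
  have hB0 : 0 < B := by rw [hB]; positivity
  rw [← hB, le_min_iff] at hcond1
  rw [le_min_iff] at hcond2 hεle
  have hx0 : 0 < ‖κ₁‖ := norm_pos_iff.2 hκ₁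
  have hz0 : 0 < ‖κₙ‖ := norm_pos_iff.2 hκₙ
  have hT : 1 ≤ Real.exp (α + 8) := Real.one_le_exp (by linarith)
  have hBa : B * a ≤ ‖κ₁‖ := (le_div_iff₀ ha_pos).1 hcond1.1
  have hBb : B * b ≤ ‖κₙ‖⁻¹ := by
    have h1 := hcond1.2
    rw [mul_inv] at h1
    rwa [← div_eq_mul_inv, le_div_iff₀ hb_pos] at h1
  have hBn : B * ‖κₙ‖ ≤ ‖κ₁‖ := by
    have h1 : B * b * ‖κₙ‖ ≤ 1 := by
      rwa [← le_div_iff₀ hz0, one_div]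
    have h2 : B * ‖κₙ‖ * 1 ≤ B * ‖κₙ‖ * (a * b) := by gcongr
    nlinarith
  have hB1 : B * ‖κ₁‖⁻¹ ≤ ‖κₙ‖⁻¹ := by
    rw [← div_eq_mul_inv, div_le_iff₀ hx0, inv_mul_eq_div, le_div_iff₀ hz0]
    exact hBn
  have hexp : Real.exp α ≤ Real.exp (α + 8) * C ^ 2 := by
    have h1 : Real.exp α ≤ Real.exp (α + 8) := Real.exp_le_exp.2 (by linarith)
    have h2 : 1 ≤ C ^ 2 := one_le_pow₀ (by linarith)
    nlinarith [Real.exp_pos α]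
  have hgrowth : ∀ x : ℝ, 10 ^ 3 * Real.exp (α + 8) * ε⁻¹ * C ^ 2 ≤ x →
      1000 * Real.exp α ≤ x * ε := by
    intro x hx
    have h1 := mul_le_mul_of_nonneg_right hx hε0.le
    have h2 : 10 ^ 3 * Real.exp (α + 8) * ε⁻¹ * C ^ 2 * ε =
        1000 * (Real.exp (α + 8) * C ^ 2) := by
      field_simp
      norm_num
    linarith
  have hδε : δ ≤ ε / 100 := by
    norm_num at hδle
    linarith
  have hone : opNg (N (m + 2)) ((1 : Matrix (Fin (m + 2)) (Fin (m + 2)) k) - 1) ≤ δ / 10 := by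
    have h1 : opNg (N (m + 2)) ((1 : Matrix (Fin (m + 2)) (Fin (m + 2)) k) - 1) ≤ 0 := by
      refine csInf_le ⟨0, fun _ hc => hc.1⟩ ⟨le_rfl, fun x => ?_⟩
      have h2 := hN.smul_eq (m + 2) 0 (0 : Fin (m + 2) → k)
      rw [zero_smul, norm_zero, zero_mul] at h2
      rw [sub_self, Matrix.zero_mulVec, h2, zero_mul]
    exact h1.trans (by positivity)
  have hginv : ((g⁻¹ : _) : Matrix (Fin (m + 2)) (Fin (m + 2)) k) =
      (h : Matrix (Fin (m + 2)) (Fin (m + 2)) k) *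
        blockD κ₁⁻¹ κₙ⁻¹ ((A⁻¹ : _) : Matrix (Fin m) (Fin m) k) *
        ((h⁻¹ : _) : Matrix (Fin (m + 2)) (Fin (m + 2)) k) := by
    refine Units.inv_eq_of_mul_eq_one_right ?_
    have h1 := blockD_mul_eq_one (mul_inv_cancel₀ hκ₁) (mul_inv_cancel₀ hκₙ) A.mul_inv
    calc _ = (h : Matrix (Fin (m + 2)) (Fin (m + 2)) k) *
          (blockD (n := m + 2) κ₁ κₙ (A : Matrix (Fin m) (Fin m) k) *
            (((h⁻¹ : _) : Matrix (Fin (m + 2)) (Fin (m + 2)) k) *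
              (h : Matrix (Fin (m + 2)) (Fin (m + 2)) k)) *
            blockD (n := m + 2) κ₁⁻¹ κₙ⁻¹ ((A⁻¹ : _) : Matrix (Fin m) (Fin m) k)) *
          ((h⁻¹ : _) : Matrix (Fin (m + 2)) (Fin (m + 2)) k) := by
          rw [hg]
          simp only [Matrix.mul_assoc]
      _ = 1 := by rw [Units.inv_mul, Matrix.mul_one, h1, Matrix.mul_one, Units.mul_inv]
  have hpow : ∀ r : ℕ, Real.exp (α * ((r + 1 : ℕ) : ℝ)) = Real.exp α ^ (r + 1) := by
    intro r
    rw [mul_comm, Real.exp_nat_mul]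
  have hlast : (Fin.last (m + 1)) ≠ 0 := Fin.last_pos.ne'
  rcases lt_or_gt_of_ne hp with hneg | hpos
  · obtain ⟨r, rfl⟩ : ∃ r : ℕ, p = -((r + 1 : ℕ) : ℤ) := ⟨(-p).toNat - 1, by omega⟩
    have key := hN.dPg_le_and_pow_le h
      (D := blockD κ₁⁻¹ κₙ⁻¹ ((A⁻¹ : _) : Matrix (Fin m) (Fin m) k))
      (S := (((g * w)⁻¹ : _) : Matrix (Fin (m + 2)) (Fin (m + 2)) k))
      (W₁ := ((w⁻¹ : _) : Matrix (Fin (m + 2)) (Fin (m + 2)) k)) (W₂ := 1)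
      (κ := κₙ⁻¹) (M := b + ‖κ₁⁻¹‖) (L := Real.exp α) hlast.symm hδ0 hε0 hδε (Real.exp_pos α) ?_
      hginv (by rw [mul_inv_rev, Units.val_mul, Matrix.mul_one]) hgm hVp hεle.2 hw'.le hone ?_
      (by positivity) (hgrowth _ (by rw [norm_inv]; exact hcond2.2)) hv0 hvp r
    · rw [zpow_neg, zpow_natCast, ← inv_pow, Units.val_pow_eq_pow_val, Int.natAbs_neg,
        Int.natAbs_natCast, hpow]
      exact ⟨Or.inr key.1, key.2⟩
    · intro y
      refine le_of_eq_of_le ?_ (hN.extend_add_single_le 0 κ₁⁻¹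
        ((A⁻¹ : _) : Matrix (Fin m) (Fin m) k) y)
      rw [blockD_mulVec_eq]
      congr 1
      abel
    · intro hε2
      rw [hhC]
      exact mul_half_le_of_gap hδ0 hε0 hε2 hT hC2 (norm_nonneg _) hB
        (by rwa [norm_inv]) (by rwa [norm_inv, norm_inv])
  · obtain ⟨r, rfl⟩ : ∃ r : ℕ, p = ((r + 1 : ℕ) : ℤ) := ⟨p.toNat - 1, by omega⟩
    have key := hN.dPg_le_and_pow_le h (D := blockD κ₁ κₙ (A : Matrix (Fin m) (Fin m) k))
      (S := ((g * w : _) : Matrix (Fin (m + 2)) (Fin (m + 2)) k))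
      (W₁ := 1) (W₂ := (w : Matrix (Fin (m + 2)) (Fin (m + 2)) k))
      (κ := κ₁) (M := a + ‖κₙ‖) (L := Real.exp α) hlast hδ0 hε0 hδε (Real.exp_pos α) ?_
      hg (by rw [Units.val_mul, Matrix.one_mul]) hgp hVm hεle.1 hone hw.le ?_
      (by positivity) (hgrowth _ hcond2.1) hv0 hvm r
    · rw [zpow_natCast, Units.val_pow_eq_pow_val, Int.natAbs_natCast, hpow]
      exact ⟨Or.inl key.1, key.2⟩
    · intro y
      refine le_of_eq_of_le ?_ (hN.extend_add_single_le (Fin.last (m + 1)) κₙ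
        (A : Matrix (Fin m) (Fin m) k) y)
      rw [blockD_mulVec_eq]
      congr 1
      abel
    · intro hε2
      rw [hhC]
      exact mul_half_le_of_gap hδ0 hε0 hε2 hT hC2 (norm_nonneg _) hB hBa hBn
end
end

section
/- Let k be ℝ, ℂ, or a nonarchimedean local field, let n ≥ 2 and m ≥ 1 be integers, α > 0, 0 < ε < 1, and let x ∈ ℙ(k^n) and V ⊂ k^n be a hyperplane with x ∈ ℙ(V). Then there exist a homomorphism ψ : F_m → GL_n(k) with det ψ(γ) = 1 for all γ, and a real δ > 0, such that every homomorphism ψ' : F_m → GL_n(k) with ‖ψ'(a_i) − ψ(a_i)‖ < δ for all i = 1, …, m satisfies, for every g ∈ F_m with g ≠ 1: ψ'(g) maps ℙ(k^n) \ N_ε(ℙ(V)) into B_ε(x), and for every nonzero v ∈ k^n with [v] ∉ N_ε(ℙ(V)) one has ‖ψ'(g)·v‖ ≥ e^{α·|g|}·‖v‖, where |g| is the reduced word length of g in F_m. -/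
noncomputable section

/-- The properties of the norm function that the ping-pong argument uses. -/
structure IsProjNorm {k : Type*} [NormedField k] {n : ℕ} (N : (Fin n → k) → ℝ) : Prop where
  add_le : ∀ u v, N (u + v) ≤ N u + N v
  smul : ∀ (a : k) v, N (a • v) = ‖a‖ * N v
  coord_le : ∀ v i, ‖v i‖ ≤ N v
  exists_normalized : ∀ u w, u ≠ 0 → ∀ η < 1, N (u - w) ≤ η * N u →
    ∃ a b : k, N (a • u) = 1 ∧ N (b • w) = 1 ∧ N (a • u - b • w) ≤ 2 * η

namespace IsProjNorm

variable {k : Type*} [NormedField k] {n : ℕ} {N : (Fin n → k) → ℝ}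

theorem map_zero (h : IsProjNorm N) : N 0 = 0 := by
  simpa using h.smul 0 0

theorem map_neg (h : IsProjNorm N) (v : Fin n → k) : N (-v) = N v := by
  simpa using h.smul (-1) v

theorem nonneg (h : IsProjNorm N) (v : Fin n → k) : 0 ≤ N v := by
  have := h.add_le v (-v)
  rw [h.map_neg, add_neg_cancel, h.map_zero] at this
  linarith

theorem pos (h : IsProjNorm N) {v : Fin n → k} (hv : v ≠ 0) : 0 < N v := by
  obtain ⟨i, hi⟩ := Function.ne_iff.mp hv
  exact (norm_pos_iff.mpr hi).trans_le (h.coord_le v i)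

theorem sub_le (h : IsProjNorm N) (u v : Fin n → k) : N (u - v) ≤ N u + N v := by
  simpa [sub_eq_add_neg, h.map_neg] using h.add_le u (-v)

theorem le_add_sub (h : IsProjNorm N) (u v : Fin n → k) : N u ≤ N v + N (u - v) := by
  simpa using h.add_le v (u - v)

theorem sub_comm (h : IsProjNorm N) (u v : Fin n → k) : N (u - v) = N (v - u) := by
  rw [← h.map_neg, neg_sub]

theorem sum_le (h : IsProjNorm N) {ι : Type*} (s : Finset ι) (f : ι → Fin n → k) :
    N (∑ i ∈ s, f i) ≤ ∑ i ∈ s, N (f i) := by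
  classical
  induction s using Finset.induction_on with
  | empty => simp [h.map_zero]
  | insert a s ha ih =>
    rw [Finset.sum_insert ha, Finset.sum_insert ha]
    exact (h.add_le _ _).trans (by gcongr)

theorem exists_mulVec_le (h : IsProjNorm N) (A : Matrix (Fin n) (Fin n) k) :
    ∃ C : ℝ, 0 < C ∧ ∀ v, N (A.mulVec v) ≤ C * N v := by
  have h0 : 0 ≤ ∑ j, N (A.col j) := Finset.sum_nonneg fun j _ => h.nonneg _
  refine ⟨∑ j, N (A.col j) + 1, by positivity, fun v => ?_⟩
  have hsum : A.mulVec v = ∑ j, v j • A.col j := by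
    ext i
    simp [Matrix.mulVec, dotProduct, Matrix.col_apply, mul_comm]
  calc N (A.mulVec v) ≤ ∑ j, N (v j • A.col j) := hsum ▸ h.sum_le _ _
    _ ≤ ∑ j, N (A.col j) * N v := by
        refine Finset.sum_le_sum fun j _ => ?_
        rw [h.smul, mul_comm]
        exact mul_le_mul_of_nonneg_left (h.coord_le v j) (h.nonneg _)
    _ ≤ (∑ j, N (A.col j) + 1) * N v := by
        rw [← Finset.sum_mul]
        have := h.nonneg v
        gcongr
        linarith

theorem exists_functional_le (h : IsProjNorm N) (f : (Fin n → k) →ₗ[k] k) :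
    ∃ C : ℝ, 0 < C ∧ ∀ v, ‖f v‖ ≤ C * N v := by
  have h0 : 0 ≤ ∑ j, ‖f (fun i => if j = i then 1 else 0)‖ := by positivity
  refine ⟨∑ j, ‖f (fun i => if j = i then 1 else 0)‖ + 1, by positivity, fun v => ?_⟩
  calc ‖f v‖ = ‖∑ j, v j * f (fun i => if j = i then 1 else 0)‖ := by
        conv_lhs => rw [LinearMap.pi_apply_eq_sum_univ f v]
        simp only [smul_eq_mul]
    _ ≤ ∑ j, ‖v j * f (fun i => if j = i then 1 else 0)‖ := norm_sum_le _ _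
    _ ≤ ∑ j, ‖f (fun i => if j = i then 1 else 0)‖ * N v := by
        refine Finset.sum_le_sum fun j _ => ?_
        rw [norm_mul, mul_comm]
        exact mul_le_mul_of_nonneg_left (h.coord_le v j) (norm_nonneg _)
    _ ≤ (∑ j, ‖f (fun i => if j = i then 1 else 0)‖ + 1) * N v := by
        rw [← Finset.sum_mul]
        have := h.nonneg v
        gcongr
        linarith

theorem mulVec_le_of_opNg_lt (h : IsProjNorm N) {A : Matrix (Fin n) (Fin n) k} {δ : ℝ}
    (hA : opNg N A < δ) (v : Fin n → k) : N (A.mulVec v) ≤ δ * N v := by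
  obtain ⟨C, hC, hCA⟩ := h.exists_mulVec_le A
  have hne : {c : ℝ | 0 ≤ c ∧ ∀ v : Fin n → k, N (A.mulVec v) ≤ c * N v}.Nonempty :=
    ⟨C, hC.le, hCA⟩
  obtain ⟨c, ⟨-, hc⟩, hcδ⟩ := exists_lt_of_csInf_lt hne hA
  exact (hc v).trans (mul_le_mul_of_nonneg_right hcδ.le (h.nonneg v))

theorem bddBelow_dPg (h : IsProjNorm N) (u v : Fin n → k) :
    BddBelow {r : ℝ | ∃ a b ζ : k, N (a • u) = 1 ∧ N (b • v) = 1 ∧ ‖ζ‖ = 1 ∧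
      r = N (ζ • a • u - b • v)} := by
  refine ⟨0, ?_⟩
  rintro r ⟨a, b, ζ, -, -, -, rfl⟩
  exact h.nonneg _

theorem dPg_nonneg (h : IsProjNorm N) (u v : Fin n → k) : 0 ≤ dPg N u v := by
  refine Real.sInf_nonneg ?_
  rintro r ⟨a, b, ζ, -, -, -, rfl⟩
  exact h.nonneg _

theorem dPg_smul_le (h : IsProjNorm N) {u w : Fin n → k} (hu : u ≠ 0) {η : ℝ} (hη : η < 1)
    (huw : N (u - w) ≤ η * N u) {ρ : k} (hρ : ρ ≠ 0) : dPg N u (ρ • w) ≤ 2 * η := by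
  obtain ⟨a, b, ha, hb, hab⟩ := h.exists_normalized u w hu η hη huw
  refine (csInf_le (h.bddBelow_dPg _ _) ⟨a, b * ρ⁻¹, 1, ha, ?_, norm_one, rfl⟩).trans ?_
  · rwa [smul_smul, mul_assoc, inv_mul_cancel₀ hρ, mul_one]
  · rwa [smul_smul (b * ρ⁻¹), mul_assoc, inv_mul_cancel₀ hρ, mul_one, one_smul]

/-- A vector whose projective point is far from `ℙ(ker φ)` has a large value under `φ`. -/
theorem le_norm_of_le_distPSg (h : IsProjNorm N) {φ : (Fin n → k) →ₗ[k] k} {y : Fin n → k}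
    (hy : φ y = 1) {ε c : ℝ} (hε0 : 0 < ε) (hε1 : ε < 1) (hc : c * N y ≤ ε / 4)
    {v : Fin n → k} (hv : v ≠ 0) (hd : ε ≤ distPSg N v (LinearMap.ker φ)) :
    c * N v ≤ ‖φ v‖ := by
  by_contra! hlt
  have hNv := h.pos hv
  have hsub : N (v - (v - φ v • y)) ≤ ε / 4 * N v := by
    rw [sub_sub_cancel, h.smul]
    nlinarith [mul_le_mul_of_nonneg_right hlt.le (h.nonneg y), mul_le_mul_of_nonneg_right hc hNv.le]
  have hw : v - φ v • y ≠ 0 := by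
    intro h0
    rw [h0, sub_zero] at hsub
    nlinarith
  have hle : distPSg N v (LinearMap.ker φ) ≤ dPg N v (v - φ v • y) := by
    refine csInf_le ⟨0, ?_⟩ ⟨_, ?_, hw, rfl⟩
    · rintro r ⟨w, -, -, rfl⟩
      exact h.dPg_nonneg _ _
    · simp [hy]
  have := h.dPg_smul_le hv (by linarith) hsub one_ne_zero
  rw [one_smul] at this
  linarith

/-- Inverses of nearby units are nearby. -/
theorem exists_inv_close (h : IsProjNorm N) (A : (Matrix (Fin n) (Fin n) k)ˣ) :
    ∃ δ : ℝ, 0 < δ ∧ δ ≤ 1 ∧ ∀ B : (Matrix (Fin n) (Fin n) k)ˣ,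
      (∀ v, N ((B.val - A.val).mulVec v) ≤ δ * N v) →
      ∀ v, N ((B⁻¹.val - A⁻¹.val).mulVec v) ≤ N v := by
  obtain ⟨M, hM, hA⟩ := h.exists_mulVec_le A⁻¹.val
  refine ⟨min 1 (min (1 / (2 * M)) (1 / (2 * M ^ 2))), by positivity, min_le_left _ _,
    fun B hB v => ?_⟩
  set δ := min 1 (min (1 / (2 * M)) (1 / (2 * M ^ 2)))
  have h1 : δ * M ≤ 1 / 2 := by
    have : δ ≤ 1 / (2 * M) := (min_le_right _ _).trans (min_le_left _ _)
    calc δ * M ≤ 1 / (2 * M) * M := by gcongr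
      _ = 1 / 2 := by field_simp
  have h2 : δ * M ^ 2 ≤ 1 / 2 := by
    have : δ ≤ 1 / (2 * M ^ 2) := (min_le_right _ _).trans (min_le_right _ _)
    calc δ * M ^ 2 ≤ 1 / (2 * M ^ 2) * M ^ 2 := by gcongr
      _ = 1 / 2 := by field_simp
  have key : (B⁻¹.val - A⁻¹.val) = -(A⁻¹.val * ((B.val - A.val) * B⁻¹.val)) := by
    rw [sub_mul, mul_sub, Units.mul_inv, mul_one, Units.inv_mul_cancel_left, neg_sub]
  have hdiff : N ((B⁻¹.val - A⁻¹.val).mulVec v) ≤ M * (δ * N (B⁻¹.val.mulVec v)) := by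
    rw [key, Matrix.neg_mulVec, h.map_neg, ← Matrix.mulVec_mulVec, ← Matrix.mulVec_mulVec]
    exact (hA _).trans (mul_le_mul_of_nonneg_left (hB _) hM.le)
  have hBv : N (B⁻¹.val.mulVec v) ≤ 2 * M * N v := by
    have h3 := h.le_add_sub (B⁻¹.val.mulVec v) (A⁻¹.val.mulVec v)
    rw [← Matrix.sub_mulVec] at h3
    nlinarith [hA v, h.nonneg (B⁻¹.val.mulVec v)]
  have hδ0 : 0 ≤ δ := by positivity
  calc _ ≤ M * (δ * (2 * M * N v)) := hdiff.trans (by gcongr)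
    _ = 2 * (δ * M ^ 2) * N v := by ring
    _ ≤ N v := by nlinarith [h.nonneg v]

end IsProjNorm

section LocalField

variable {k : Type*} [NormedField k] {n : ℕ} {N : (Fin n → k) → ℝ}

theorem isProjNorm_of_isNonarchimedean (hna : IsNonarchimedean fun x : k => ‖x‖)
    (hN : ∀ v : Fin n → k, N v = ⨆ i, ‖v i‖) (hn : 2 ≤ n) : IsProjNorm N := by
  have : Nonempty (Fin n) := ⟨⟨0, by omega⟩⟩
  have hle (v : Fin n → k) (i : Fin n) : ‖v i‖ ≤ N v :=
    hN v ▸ le_ciSup (f := fun i => ‖v i‖) (Set.finite_range _).bddAbove i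
  have hex (v : Fin n → k) : ∃ i, N v = ‖v i‖ := by
    obtain ⟨i, hi⟩ := exists_eq_ciSup_of_finite (f := fun i => ‖v i‖)
    exact ⟨i, by rw [hN, hi]⟩
  have hsmul (a : k) (v : Fin n → k) : N (a • v) = ‖a‖ * N v := by
    rw [hN, hN, Real.mul_iSup_of_nonneg (norm_nonneg a)]
    simp
  have hmax (u v : Fin n → k) : N (u + v) ≤ max (N u) (N v) := by
    obtain ⟨i, hi⟩ := hex (u + v)
    rw [hi]
    exact (hna _ _).trans (max_le_max (hle u i) (hle v i))
  have hnn (v : Fin n → k) : 0 ≤ N v := by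
    obtain ⟨i, hi⟩ := hex v
    exact hi ▸ norm_nonneg _
  refine ⟨fun u v => (hmax u v).trans (max_le_add_of_nonneg (hnn u) (hnn v)), hsmul, hle, ?_⟩
  intro u w hu η hη huw
  obtain ⟨i, hi⟩ := hex u
  have hu0 : 0 < N u := by
    obtain ⟨j, hj⟩ := Function.ne_iff.mp hu
    exact (norm_pos_iff.mpr hj).trans_le (hle u j)
  have hlt : N (u - w) < N u := by nlinarith
  have hneg : N (w - u) = N (u - w) := by
    have := hsmul (-1) (u - w)
    simpa using this
  have hwu : N w = N u := by
    refine le_antisymm ?_ ?_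
    · have := hmax u (w - u)
      rw [add_sub_cancel, hneg, max_eq_left hlt.le] at this
      exact this
    · have := hmax w (u - w)
      rw [add_sub_cancel] at this
      rcases le_max_iff.mp this with h | h
      · exact h
      · linarith
  have hui : ‖(u i)⁻¹‖ = (N u)⁻¹ := by rw [norm_inv, hi]
  refine ⟨(u i)⁻¹, (u i)⁻¹, ?_, ?_, ?_⟩
  · rw [hsmul, hui, inv_mul_cancel₀ hu0.ne']
  · rw [hsmul, hui, hwu, inv_mul_cancel₀ hu0.ne']
  · rw [← smul_sub, hsmul, hui]
    have h1 : (N u)⁻¹ * N (u - w) ≤ η := by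
      rw [inv_mul_le_iff₀ hu0]
      linarith
    have h2 : 0 ≤ (N u)⁻¹ * N (u - w) := mul_nonneg (inv_nonneg.mpr hu0.le) (hnn _)
    linarith

/-- `σ` plays the role of the inclusion of the reals in the field. -/
theorem isProjNorm_of_sqrt (σ : ℝ →+* k) (hσ : ∀ r, ‖σ r‖ = |r|)
    (hN : ∀ v : Fin n → k, N v = Real.sqrt (∑ i, ‖v i‖ ^ 2)) : IsProjNorm N := by
  have hN' (v : Fin n → k) : N v = ‖(WithLp.toLp 2 v : PiLp 2 fun _ : Fin n => k)‖ := by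
    rw [hN, PiLp.norm_eq_of_L2]
  have hadd (u v : Fin n → k) : N (u + v) ≤ N u + N v := by
    simp only [hN', WithLp.toLp_add]
    exact norm_add_le _ _
  have hsmul (a : k) (v : Fin n → k) : N (a • v) = ‖a‖ * N v := by
    simp only [hN', WithLp.toLp_smul]
    exact norm_smul _ _
  have hle (v : Fin n → k) (i : Fin n) : ‖v i‖ ≤ N v := by
    rw [hN']
    exact PiLp.norm_apply_le (WithLp.toLp 2 v : PiLp 2 fun _ : Fin n => k) i
  refine ⟨hadd, hsmul, hle, ?_⟩
  intro u w hu η hη huw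
  have hu0 : 0 < N u := by
    obtain ⟨j, hj⟩ := Function.ne_iff.mp hu
    exact (norm_pos_iff.mpr hj).trans_le (hle u j)
  have hdist : |N u - N w| ≤ N (u - w) := by
    simp only [hN', WithLp.toLp_sub]
    exact abs_norm_sub_norm_le _ _
  have hw0 : 0 < N w := by nlinarith [(abs_le.mp hdist).2]
  refine ⟨σ (N u)⁻¹, σ (N w)⁻¹, ?_, ?_, ?_⟩
  · rw [hsmul, hσ, abs_of_pos (by positivity), inv_mul_cancel₀ hu0.ne']
  · rw [hsmul, hσ, abs_of_pos (by positivity), inv_mul_cancel₀ hw0.ne']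
  · have hsplit : σ (N u)⁻¹ • u - σ (N w)⁻¹ • w
        = σ (N u)⁻¹ • (u - w) + σ ((N u)⁻¹ - (N w)⁻¹) • w := by
      rw [map_sub, smul_sub, sub_smul]
      abel
    have h1 : (N u)⁻¹ * N (u - w) ≤ η := by
      rw [inv_mul_le_iff₀ hu0]
      linarith
    have h2 : |(N u)⁻¹ - (N w)⁻¹| * N w = (N u)⁻¹ * |N u - N w| := by
      rw [inv_sub_inv hu0.ne' hw0.ne', abs_div, abs_of_pos (mul_pos hu0 hw0), abs_sub_comm]
      field_simp
    have h3 : (N u)⁻¹ * |N u - N w| ≤ (N u)⁻¹ * N (u - w) := by gcongr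
    rw [hsplit]
    refine (hadd _ _).trans ?_
    rw [hsmul, hsmul, hσ, hσ, h2, abs_of_pos (by positivity)]
    linarith

end LocalField

section Schottky

variable {k : Type*} [Field k] {E : Type*} [AddCommGroup E] [Module k E]

/-- The map with eigenvalue `l` on `p`, eigenvalue `l⁻¹` on `q`, and the identity on
`ker f ⊓ ker g`, where `f p = D`, `g q = -D` and `f q = g p = 0`. -/
def schottkyMap (f g : Module.Dual k E) (p q : E) (D l : k) : E →ₗ[k] E :=
  LinearMap.transvection (((l - 1) / D) • f) p ∘ₗ
    LinearMap.transvection (((l⁻¹ - 1) / (-D)) • g) q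

variable {f g : Module.Dual k E} {p q : E} {D l : k}

theorem schottkyMap_apply (hfq : f q = 0) (v : E) :
    schottkyMap f g p q D l v =
      ((l - 1) / D * f v) • p + (v + ((l⁻¹ - 1) / (-D) * g v) • q) := by
  simp [schottkyMap, LinearMap.transvection.apply, hfq, add_comm]

theorem det_schottkyMap [FiniteDimensional k E] (hfp : f p = D) (hgq : g q = -D) (hD : D ≠ 0)
    (hl : l ≠ 0) : LinearMap.det (schottkyMap f g p q D l) = 1 := by
  rw [schottkyMap, LinearMap.det_comp, LinearMap.transvection.det, LinearMap.transvection.det]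
  simp only [LinearMap.smul_apply, hfp, hgq, smul_eq_mul]
  rw [div_mul_cancel₀ _ hD, div_mul_cancel₀ _ (neg_ne_zero.mpr hD)]
  simp [hl]

theorem schottkyMap_comp_swap (hfp : f p = D) (hgq : g q = -D) (hfq : f q = 0) (hgp : g p = 0)
    (hD : D ≠ 0) (hl : l ≠ 0) :
    schottkyMap f g p q D l ∘ₗ schottkyMap g f q p (-D) l = LinearMap.id := by
  ext v
  rw [LinearMap.comp_apply, schottkyMap_apply hfq, schottkyMap_apply hgp]
  simp only [map_add, map_smul, hfp, hgq, hfq, hgp, smul_eq_mul, LinearMap.id_apply]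
  match_scalars <;> field_simp <;> ring

end Schottky

section PingPong

variable {k : Type*} [NormedField k] {n : ℕ} {N : (Fin n → k) → ℝ}

theorem IsProjNorm.list_prod_mulVec (h : IsProjNorm N) {ι : Type*}
    (B : ι × Bool → Matrix (Fin n) (Fin n) k) (f : ι × Bool → Module.Dual k (Fin n → k))
    (p : ι × Bool → Fin n → k) {c η α : ℝ}
    (hstep : ∀ s v, v ≠ 0 → c * N v ≤ ‖f s v‖ → ∃ (ρ : k) (e : Fin n → k), ρ ≠ 0 ∧ N e ≤ η ∧
      (B s).mulVec v = ρ • (p s + e) ∧ Real.exp α * N v ≤ N ((B s).mulVec v))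
    (hnext : ∀ s r, (s.1 = r.1 → s.2 = r.2) → ∀ (ρ : k) (e : Fin n → k), N e ≤ η →
      c * N (ρ • (p r + e)) ≤ ‖f s (ρ • (p r + e))‖)
    {v : Fin n → k} (hv : v ≠ 0) (hgood : ∀ s, c * N v ≤ ‖f s v‖) (L : List (ι × Bool)) :
    ∀ s, FreeGroup.IsReduced (s :: L) → ∃ (ρ : k) (e : Fin n → k), ρ ≠ 0 ∧ N e ≤ η ∧
      ((s :: L).map B).prod.mulVec v = ρ • (p s + e) ∧
      Real.exp (α * ((s :: L).length : ℝ)) * N v ≤ N (((s :: L).map B).prod.mulVec v) := by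
  induction L with
  | nil => intro s _; simpa using hstep s v hv (hgood s)
  | cons r L ih =>
    intro s hs
    obtain ⟨hsr, hr⟩ := FreeGroup.isReduced_cons_cons.mp hs
    obtain ⟨ρ, e, -, he, hw, hexp⟩ := ih r hr
    have hcons : ((s :: r :: L).map B).prod.mulVec v
        = (B s).mulVec (((r :: L).map B).prod.mulVec v) := by
      rw [List.map_cons, List.prod_cons, Matrix.mulVec_mulVec]
    have hw0 : ((r :: L).map B).prod.mulVec v ≠ 0 := by
      intro h0
      rw [h0, h.map_zero] at hexp
      exact absurd hexp (not_le.mpr (mul_pos (Real.exp_pos _) (h.pos hv)))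
    obtain ⟨ρ', e', hρ', he', hw', hexp'⟩ := hstep s _ hw0 (hw ▸ hnext s r hsr ρ e he)
    refine ⟨ρ', e', hρ', he', hcons.trans hw', ?_⟩
    rw [hcons]
    refine le_trans ?_ hexp'
    rw [List.length_cons, Nat.cast_succ, mul_add, mul_one, add_comm, Real.exp_add, mul_assoc]
    exact mul_le_mul_of_nonneg_left hexp (Real.exp_pos α).le

/-- The value of a homomorphism on a generator or its inverse. -/
def letterVal {ι G : Type*} [Group G] (ψ : FreeGroup ι →* G) (s : ι × Bool) : G :=
  cond s.2 (ψ (FreeGroup.of s.1)) (ψ (FreeGroup.of s.1))⁻¹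

theorem prod_map_letterVal {ι G : Type*} [Group G] [DecidableEq ι] (ψ : FreeGroup ι →* G)
    (g : FreeGroup ι) : (g.toWord.map (letterVal ψ)).prod = ψ g := by
  conv_rhs => rw [← FreeGroup.mk_toWord (x := g), ← FreeGroup.lift.apply_symm_apply ψ]
  rfl

end PingPong

section Main

theorem exists_pos_forall_le {ι : Type*} [Finite ι] (f : ι → ℝ) (hf : ∀ i, 0 < f i) :
    ∃ d, 0 < d ∧ ∀ i, d ≤ f i := by
  rcases isEmpty_or_nonempty ι with _ | _
  · exact ⟨1, one_pos, fun i => isEmptyElim i⟩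
  · obtain ⟨i, hi⟩ := Finite.exists_min f
    exact ⟨f i, hf i, hi⟩

variable {k : Type*} [NormedField k]

theorem exists_injective_norm_le (hk : ∃ x : k, 1 < ‖x‖) (ι : Type*) [Fintype ι] {τ : ℝ}
    (hτ : 0 < τ) : ∃ t : ι → k, Function.Injective t ∧ ∀ s, ‖t s‖ ≤ τ := by
  obtain ⟨x, hx⟩ := hk
  have hx0 : 0 < ‖x⁻¹‖ := by rw [norm_inv]; positivity
  have hx1 : ‖x⁻¹‖ < 1 := by rw [norm_inv]; exact inv_lt_one_of_one_lt₀ hx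
  obtain ⟨K, hK⟩ := exists_pow_lt_of_lt_one hτ hx1
  refine ⟨fun s => x⁻¹ ^ (K + (Fintype.equivFin ι s : ℕ)), fun s r hsr => ?_, fun s => ?_⟩
  · have hsr' := congrArg norm hsr
    simp only [norm_pow] at hsr'
    have := (pow_right_injective₀ hx0 hx1.ne) hsr'
    exact (Fintype.equivFin ι).injective (Fin.ext (by omega))
  · rw [norm_pow]
    exact (pow_le_pow_of_le_one hx0.le hx1.le (Nat.le_add_right _ _)).trans hK.le

theorem exists_pos_forall_le_norm_sub {ι : Type*} [Finite ι] {t : ι → k}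
    (ht : Function.Injective t) : ∃ d, 0 < d ∧ ∀ s r, s ≠ r → d ≤ ‖t s - t r‖ := by
  obtain ⟨d, hd, hle⟩ := exists_pos_forall_le
    (fun z : {z : ι × ι // z.1 ≠ z.2} => ‖t z.1.1 - t z.1.2‖)
    fun z => norm_pos_iff.mpr (sub_ne_zero.mpr (ht.ne z.2))
  exact ⟨d, hd, fun s r hsr => hle ⟨(s, r), hsr⟩⟩

variable {n : ℕ} {N : (Fin n → k) → ℝ}

/-- A matrix close to a `schottkyMap` with large eigenvalue `l` contracts the vectors on which `f`
is large towards `p`, and expands their norm. -/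
theorem IsProjNorm.exists_mulVec_eq_smul_add (h : IsProjNorm N)
    {f g : Module.Dual k (Fin n → k)} {p q : Fin n → k} {D l : k}
    {B : Matrix (Fin n) (Fin n) k} {c d η Λ R G P α : ℝ} (hfq : f q = 0)
    (hB : ∀ v, N (B.mulVec v - schottkyMap f g p q D l v) ≤ N v)
    (hd : 0 < d) (hD : d ≤ ‖D‖) (hl : 1 < ‖l‖) (hG : ∀ v, ‖g v‖ ≤ G * N v) (hP : N q ≤ P)
    (hc : 0 < c) (hη : 0 < η) (hΛ0 : 0 < Λ) (hΛ : Λ ≤ ‖(l - 1) / D‖)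
    (hΛη : 2 + 2 / d * G * P ≤ Λ * c * η) (hΛα : Real.exp α ≤ Λ * c * R)
    (hR : ∀ e, N e ≤ η → R ≤ N (p + e)) {v : Fin n → k} (hv : v ≠ 0) (hfv : c * N v ≤ ‖f v‖) :
    ∃ (ρ : k) (e : Fin n → k), ρ ≠ 0 ∧ N e ≤ η ∧ B.mulVec v = ρ • (p + e) ∧
      Real.exp α * N v ≤ N (B.mulVec v) := by
  have hNv := h.pos hv
  set ρ : k := (l - 1) / D * f v with hρdef
  set κ : k := (l⁻¹ - 1) / (-D) with hκdef
  have hρ : Λ * (c * N v) ≤ ‖ρ‖ := by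
    rw [hρdef, norm_mul]
    gcongr
  have hρ0 : 0 < ‖ρ‖ := (by positivity : 0 < Λ * (c * N v)).trans_le hρ
  have hρne : ρ ≠ 0 := norm_pos_iff.mp hρ0
  have hκ : ‖κ‖ ≤ 2 / d := by
    rw [hκdef, norm_div, norm_neg]
    have : ‖l⁻¹ - 1‖ ≤ 2 := by
      refine (norm_sub_le _ _).trans ?_
      rw [norm_inv, norm_one]
      linarith [inv_lt_one_of_one_lt₀ hl]
    gcongr
  have hGv : 0 ≤ G * N v := (norm_nonneg _).trans (hG v)
  have herr : N (B.mulVec v - ρ • p) ≤ η * ‖ρ‖ := by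
    have hsplit : B.mulVec v - ρ • p
        = (B.mulVec v - schottkyMap f g p q D l v) + (v + (κ * g v) • q) := by
      rw [schottkyMap_apply hfq]
      abel
    have hq : N ((κ * g v) • q) ≤ 2 / d * (G * N v) * P := by
      rw [h.smul, norm_mul]
      have := hG v
      have := h.nonneg q
      gcongr
    calc N (B.mulVec v - ρ • p) ≤ N v + (N v + 2 / d * (G * N v) * P) := by
          rw [hsplit]
          exact (h.add_le _ _).trans
            (add_le_add (hB v) ((h.add_le _ _).trans (add_le_add le_rfl hq)))
      _ = (2 + 2 / d * G * P) * N v := by ring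
      _ ≤ Λ * c * η * N v := by gcongr
      _ = η * (Λ * (c * N v)) := by ring
      _ ≤ η * ‖ρ‖ := by gcongr
  have he : N (ρ⁻¹ • (B.mulVec v - ρ • p)) ≤ η := by
    rw [h.smul, norm_inv, inv_mul_le_iff₀ hρ0]
    linarith
  have hBv : B.mulVec v = ρ • (p + ρ⁻¹ • (B.mulVec v - ρ • p)) := by
    rw [smul_add, smul_inv_smul₀ hρne, add_sub_cancel]
  refine ⟨ρ, _, hρne, he, hBv, ?_⟩
  rw [hBv, h.smul]
  have hRe := hR _ he
  have hR0 : 0 < R := by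
    by_contra! hneg
    have : Λ * c * R ≤ 0 := mul_nonpos_of_nonneg_of_nonpos (by positivity) hneg
    linarith [Real.exp_pos α]
  calc Real.exp α * N v ≤ Λ * c * R * N v := by gcongr
    _ = Λ * (c * N v) * R := by ring
    _ ≤ _ := by gcongr

/-- The functional whose kernel is the repelling hyperplane of the letter `s`. -/
def letterFunctional {ι : Type*} (φ ξ : Module.Dual k (Fin n → k)) (t : ι × Bool → k)
    (s : ι × Bool) : Module.Dual k (Fin n → k) :=
  φ - t (s.1, !s.2) • ξ

/-- The attracting point of the letter `s`. -/
def letterPoint {ι : Type*} (x y : Fin n → k) (t : ι × Bool → k) (s : ι × Bool) : Fin n → k :=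
  x + t s • y

/-- The linear map attached to the letter `s`. -/
def letterMap {ι : Type*} (φ ξ : Module.Dual k (Fin n → k)) (x y : Fin n → k) (t : ι × Bool → k)
    (l : k) (s : ι × Bool) : (Fin n → k) →ₗ[k] (Fin n → k) :=
  schottkyMap (letterFunctional φ ξ t s) (letterFunctional φ ξ t (s.1, !s.2))
    (letterPoint x y t s) (letterPoint x y t (s.1, !s.2)) (t s - t (s.1, !s.2)) l

section Letters

variable {ι : Type*} {φ ξ : Module.Dual k (Fin n → k)} {x y : Fin n → k} {t : ι × Bool → k} {l : k}

theorem letterFunctional_letterPoint (hφx : φ x = 0) (hφy : φ y = 1) (hξx : ξ x = 1)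
    (hξy : ξ y = 0) (s r : ι × Bool) :
    letterFunctional φ ξ t s (letterPoint x y t r) = t r - t (s.1, !s.2) := by
  simp [letterFunctional, letterPoint, hφx, hφy, hξx, hξy]

theorem letter_ne_inv (s : ι × Bool) : s ≠ (s.1, !s.2) := by
  intro hs
  simpa using congrArg Prod.snd hs

theorem letterMap_comp_inv (hφx : φ x = 0) (hφy : φ y = 1) (hξx : ξ x = 1)
    (hξy : ξ y = 0) (ht : Function.Injective t) (hl : l ≠ 0) (s : ι × Bool) :
    letterMap φ ξ x y t l s ∘ₗ letterMap φ ξ x y t l (s.1, !s.2) = LinearMap.id := by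
  have key := letterFunctional_letterPoint (t := t) hφx hφy hξx hξy
  have := schottkyMap_comp_swap (f := letterFunctional φ ξ t s)
    (g := letterFunctional φ ξ t (s.1, !s.2)) (p := letterPoint x y t s)
    (q := letterPoint x y t (s.1, !s.2)) (D := t s - t (s.1, !s.2)) (l := l)
    (key _ _) (by rw [key]; simp) (by rw [key]; simp) (by rw [key]; simp)
    (sub_ne_zero.mpr (ht.ne (letter_ne_inv s))) hl
  simpa [letterMap] using this

theorem det_letterMap (hφx : φ x = 0) (hφy : φ y = 1) (hξx : ξ x = 1)
    (hξy : ξ y = 0) (ht : Function.Injective t) (hl : l ≠ 0) (s : ι × Bool) :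
    LinearMap.det (letterMap φ ξ x y t l s) = 1 := by
  have key := letterFunctional_letterPoint (t := t) hφx hφy hξx hξy
  exact det_schottkyMap (key _ _) (by rw [key]; simp)
    (sub_ne_zero.mpr (ht.ne (letter_ne_inv s))) hl

theorem exists_hom_letterVal_eq (hφx : φ x = 0) (hφy : φ y = 1) (hξx : ξ x = 1)
    (hξy : ξ y = 0) (ht : Function.Injective t) (hl : l ≠ 0) :
    ∃ ψ : FreeGroup ι →* (Matrix (Fin n) (Fin n) k)ˣ,
      (∀ γ, (ψ γ : Matrix (Fin n) (Fin n) k).det = 1) ∧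
      ∀ s, (letterVal ψ s).val = LinearMap.toMatrix' (letterMap φ ξ x y t l s) := by
  have hinv (s : ι × Bool) : LinearMap.toMatrix' (letterMap φ ξ x y t l s) *
      LinearMap.toMatrix' (letterMap φ ξ x y t l (s.1, !s.2)) = 1 := by
    rw [← LinearMap.toMatrix'_comp, letterMap_comp_inv hφx hφy hξx hξy ht hl,
      LinearMap.toMatrix'_id]
  let U (i : ι) : (Matrix (Fin n) (Fin n) k)ˣ :=
    ⟨LinearMap.toMatrix' (letterMap φ ξ x y t l (i, true)),
      LinearMap.toMatrix' (letterMap φ ξ x y t l (i, false)), hinv (i, true), hinv (i, false)⟩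
  refine ⟨FreeGroup.lift U, fun γ => ?_, ?_⟩
  · have hdet : (Units.map Matrix.detMonoidHom).comp (FreeGroup.lift U) = 1 := by
      ext i
      simp [U, det_letterMap hφx hφy hξx hξy ht hl]
    simpa using congrArg Units.val (DFunLike.congr_fun hdet γ)
  · rintro ⟨i, _ | _⟩ <;> simp [letterVal, U]

end Letters

/-- The ping-pong theorem for the hyperplane `ker φ`. -/
theorem IsProjNorm.exists_pingPong_hom (h : IsProjNorm N) (hk : ∃ x : k, 1 < ‖x‖) (m : ℕ) (α : ℝ)
    {ε : ℝ} (hε0 : 0 < ε) (hε1 : ε < 1) {φ ξ : Module.Dual k (Fin n → k)} {x y : Fin n → k}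
    (hφx : φ x = 0) (hφy : φ y = 1) (hξx : ξ x = 1) (hξy : ξ y = 0) :
    ∃ (ψ : FreeGroup (Fin m) →* (Matrix (Fin n) (Fin n) k)ˣ) (δ : ℝ), 0 < δ ∧
      (∀ γ : FreeGroup (Fin m), (ψ γ : Matrix (Fin n) (Fin n) k).det = 1) ∧
      ∀ ψ' : FreeGroup (Fin m) →* (Matrix (Fin n) (Fin n) k)ˣ,
        (∀ i : Fin m,
          opNg N ((ψ' (FreeGroup.of i) : Matrix (Fin n) (Fin n) k)
            - (ψ (FreeGroup.of i) : Matrix (Fin n) (Fin n) k)) < δ) →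
        ∀ g : FreeGroup (Fin m), g ≠ 1 →
          ∀ v : Fin n → k, v ≠ 0 → ε ≤ distPSg N v (LinearMap.ker φ) →
            dPg N x ((ψ' g : Matrix (Fin n) (Fin n) k).mulVec v) ≤ ε ∧
            Real.exp (α * (FreeGroup.norm g : ℝ)) * N v ≤
              N ((ψ' g : Matrix (Fin n) (Fin n) k).mulVec v) := by
  have hx : x ≠ 0 := by rintro rfl; simp at hξx
  have hNx := h.pos hx
  have hNy := h.nonneg y
  obtain ⟨F₁, hF₁, hφF₁⟩ := h.exists_functional_le φ
  obtain ⟨F₂, hF₂, hξF₂⟩ := h.exists_functional_le ξ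
  obtain ⟨c₀, hc₀def⟩ : ∃ c₀, c₀ = ε / (4 * (N y + 1)) := ⟨_, rfl⟩
  have hc₀ : 0 < c₀ := by rw [hc₀def]; positivity
  have hc₀y : c₀ * N y ≤ ε / 4 := by
    rw [hc₀def, div_mul_eq_mul_div, div_le_div_iff₀ (by positivity) (by norm_num)]
    nlinarith
  obtain ⟨τ, hτ, hτ1, hτF, hτx⟩ : ∃ τ : ℝ, 0 < τ ∧ τ ≤ 1 ∧ τ * F₂ ≤ c₀ / 2 ∧
      τ * N y ≤ ε / 8 * N x := by
    refine ⟨min 1 (min (c₀ / 2 / F₂) (ε / 8 * N x / (N y + 1))), by positivity, min_le_left _ _,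
      ?_, ?_⟩
    · rw [← le_div_iff₀ hF₂]
      exact (min_le_right _ _).trans (min_le_left _ _)
    · have : min 1 (min (c₀ / 2 / F₂) (ε / 8 * N x / (N y + 1))) * (N y + 1) ≤ ε / 8 * N x := by
        rw [← le_div_iff₀ (by positivity)]
        exact (min_le_right _ _).trans (min_le_right _ _)
      refine le_trans ?_ this
      gcongr
      linarith
  obtain ⟨t, ht, htτ⟩ := exists_injective_norm_le hk (Fin m × Bool) hτ
  obtain ⟨d, hd, htd⟩ := exists_pos_forall_le_norm_sub ht
  set f := letterFunctional φ ξ t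
  set p := letterPoint x y t with hp
  have hfp (s r : Fin m × Bool) : f s (p r) = t r - t (s.1, !s.2) :=
    letterFunctional_letterPoint hφx hφy hξx hξy s r
  have hpx (s : Fin m × Bool) : N (x - p s) ≤ ε / 8 * N x := by
    have : x - p s = (-t s) • y := by simp [hp, letterPoint]
    rw [this, h.smul, norm_neg]
    exact (mul_le_mul_of_nonneg_right (htτ s) hNy).trans hτx
  have hξv (s : Fin m × Bool) (v : Fin n → k) : ‖t s * ξ v‖ ≤ τ * F₂ * N v := by
    rw [norm_mul, mul_assoc]
    exact mul_le_mul (htτ s) (hξF₂ v) (norm_nonneg _) hτ.le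
  obtain ⟨G, hGdef⟩ : ∃ G, G = F₁ + F₂ := ⟨_, rfl⟩
  have hG0 : 0 < G := by rw [hGdef]; positivity
  have hfG (s : Fin m × Bool) (v : Fin n → k) : ‖f s v‖ ≤ G * N v := by
    have h1 := hφF₁ v
    have h2 := hξv (s.1, !s.2) v
    have h3 : τ * F₂ * N v ≤ 1 * F₂ * N v := by
      have := h.nonneg v
      gcongr
    have h4 : ‖f s v‖ ≤ ‖φ v‖ + ‖t (s.1, !s.2) * ξ v‖ := norm_sub_le _ _
    rw [hGdef]
    linarith
  have hpP (s : Fin m × Bool) : N (p s) ≤ 2 * N x := by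
    have h1 := h.le_add_sub (p s) x
    rw [h.sub_comm] at h1
    nlinarith [hpx s]
  obtain ⟨η, hη, hη1, hηd, hηx⟩ : ∃ η : ℝ, 0 < η ∧ η ≤ 1 ∧ G * η ≤ d / 2 ∧
      η ≤ ε / 8 * N x := by
    refine ⟨min 1 (min (d / 2 / G) (ε / 8 * N x)), by positivity, min_le_left _ _, ?_, ?_⟩
    · rw [mul_comm, ← le_div_iff₀ hG0]
      exact (min_le_right _ _).trans (min_le_left _ _)
    · exact (min_le_right _ _).trans (min_le_right _ _)
  obtain ⟨c, hc, hcc₀, hcd⟩ : ∃ c : ℝ, 0 < c ∧ c ≤ c₀ / 2 ∧ c * (2 * N x + 1) ≤ d / 2 := by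
    refine ⟨min (c₀ / 2) (d / 2 / (2 * N x + 1)), by positivity, min_le_left _ _, ?_⟩
    rw [← le_div_iff₀ (by positivity)]
    exact min_le_right _ _
  have hxe (s : Fin m × Bool) (e : Fin n → k) (he : N e ≤ η) :
      N (x - (p s + e)) ≤ ε / 4 * N x := by
    have h1 := h.sub_le (x - p s) e
    rw [sub_sub] at h1
    linarith [hpx s]
  have hR (s : Fin m × Bool) (e : Fin n → k) (he : N e ≤ η) : N x / 2 ≤ N (p s + e) := by
    have h1 := h.le_add_sub x (p s + e)
    nlinarith [hxe s e he]
  obtain ⟨Λ, hΛ0, hΛη, hΛα⟩ : ∃ Λ : ℝ, 0 < Λ ∧ 2 + 2 / d * G * (2 * N x) ≤ Λ * c * η ∧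
      Real.exp α ≤ Λ * c * (N x / 2) := by
    refine ⟨max ((2 + 2 / d * G * (2 * N x)) / (c * η)) (Real.exp α / (c * (N x / 2))),
      by positivity, ?_, ?_⟩
    · rw [mul_assoc (max _ _), ← div_le_iff₀ (by positivity)]
      exact le_max_left _ _
    · rw [mul_assoc (max _ _), ← div_le_iff₀ (by positivity)]
      exact le_max_right _ _
  obtain ⟨l, hl1, hlΛ⟩ : ∃ l : k, 1 < ‖l‖ ∧ Λ * (2 * τ) ≤ ‖l - 1‖ := by
    obtain ⟨z, hz⟩ := hk
    obtain ⟨K, hK⟩ := pow_unbounded_of_one_lt (Λ * (2 * τ) + 1) hz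
    refine ⟨z ^ K, ?_, ?_⟩
    · rw [norm_pow]
      nlinarith [mul_pos hΛ0 hτ]
    · have := norm_sub_norm_le (z ^ K) 1
      rw [norm_pow, norm_one] at this
      linarith
  have hl0 : l ≠ 0 := norm_pos_iff.mp (zero_lt_one.trans hl1)
  have hμ (s : Fin m × Bool) : Λ ≤ ‖(l - 1) / (t s - t (s.1, !s.2))‖ := by
    have hD0 : 0 < ‖t s - t (s.1, !s.2)‖ := hd.trans_le (htd _ _ (letter_ne_inv s))
    have hD : ‖t s - t (s.1, !s.2)‖ ≤ 2 * τ :=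
      (norm_sub_le _ _).trans (by linarith [htτ s, htτ (s.1, !s.2)])
    rw [norm_div, le_div_iff₀ hD0]
    exact (mul_le_mul_of_nonneg_left hD hΛ0.le).trans hlΛ
  obtain ⟨ψ, hdet, hψ⟩ := exists_hom_letterVal_eq (ι := Fin m) (n := n) hφx hφy hξx hξy ht hl0
  choose δ hδ0 hδ1 hδ using fun i : Fin m => h.exists_inv_close (ψ (FreeGroup.of i))
  obtain ⟨δ', hδ'0, hδ'⟩ := exists_pos_forall_le δ hδ0
  refine ⟨ψ, δ', hδ'0, hdet, fun ψ' hψ' g hg v hv hdist => ?_⟩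
  have hclose (s : Fin m × Bool) (w : Fin n → k) :
      N ((letterVal ψ' s).val.mulVec w - letterMap φ ξ x y t l s w) ≤ N w := by
    rw [← LinearMap.toMatrix'_mulVec, ← hψ s, ← Matrix.sub_mulVec]
    have hgen (u : Fin n → k) := h.mulVec_le_of_opNg_lt ((hψ' s.1).trans_le (hδ' s.1)) u
    obtain ⟨i, _ | _⟩ := s
    · exact hδ i _ hgen w
    · exact (hgen w).trans (mul_le_of_le_one_left (h.nonneg w) (hδ1 i))
  have hgood (s : Fin m × Bool) : c * N v ≤ ‖f s v‖ := by
    have h1 := h.le_norm_of_le_distPSg hφy hε0 hε1 hc₀y hv hdist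
    have h2 := hξv (s.1, !s.2) v
    have h3 : ‖φ v‖ - ‖t (s.1, !s.2) * ξ v‖ ≤ ‖f s v‖ := norm_sub_norm_le _ _
    have hNv := h.nonneg v
    nlinarith [mul_le_mul_of_nonneg_right hτF hNv, mul_le_mul_of_nonneg_right hcc₀ hNv]
  have hnext (s r : Fin m × Bool) (hsr : s.1 = r.1 → s.2 = r.2) (ρ : k) (e : Fin n → k)
      (he : N e ≤ η) : c * N (ρ • (p r + e)) ≤ ‖f s (ρ • (p r + e))‖ := by
    have hne : r ≠ (s.1, !s.2) := by
      rintro rfl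
      simpa using hsr rfl
    have h1 : d - d / 2 ≤ ‖f s (p r + e)‖ := by
      have h2 := norm_sub_le (f s (p r + e)) (f s e)
      rw [map_add, add_sub_cancel_right, hfp] at h2
      have h3 := (hfG s e).trans (mul_le_mul_of_nonneg_left he hG0.le)
      rw [map_add, hfp]
      linarith [htd _ _ hne]
    have h4 : c * N (p r + e) ≤ d / 2 := by
      refine le_trans ?_ hcd
      gcongr
      exact (h.add_le _ _).trans (add_le_add (hpP r) (he.trans hη1))
    rw [h.smul, map_smul, smul_eq_mul, norm_mul, mul_left_comm]
    gcongr
    linarith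
  have hstep (s : Fin m × Bool) (w : Fin n → k) (hw : w ≠ 0) (hfw : c * N w ≤ ‖f s w‖) :=
    h.exists_mulVec_eq_smul_add (f := f s) (p := p s) (q := p (s.1, !s.2))
      (by rw [hfp]; simp) (hclose s) hd
      (htd _ _ (letter_ne_inv s)) hl1 (hfG (s.1, !s.2)) (hpP (s.1, !s.2)) hc hη hΛ0 (hμ s) hΛη
      hΛα (hR s) hw hfw
  have hprod : (g.toWord.map fun s => (letterVal ψ' s).val).prod = (ψ' g).val := by
    rw [← prod_map_letterVal ψ' g, ← Units.coeHom_apply, map_list_prod, List.map_map]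
    rfl
  rw [← hprod, FreeGroup.norm]
  cases hL : g.toWord with
  | nil => exact absurd (FreeGroup.toWord_eq_nil_iff.mp hL) hg
  | cons s L =>
    obtain ⟨ρ, e, hρ, he, hw, hexp⟩ :=
      h.list_prod_mulVec _ f p hstep hnext hv hgood L s (hL ▸ FreeGroup.isReduced_toWord)
    refine ⟨?_, hexp⟩
    rw [hw]
    linarith [h.dPg_smul_le hx (by linarith) (hxe s e he) hρ]

end Main

/-- robust ping-pong representations of free groups: for a local field `k`,
a flag `x ∈ ℙ(V)` with `V` a hyperplane, `α > 0` and `0 < ε < 1`, there exist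
`ψ : F_m → SL_n(k)` and `δ > 0` such that every `ψ'` that is `δ`-close to `ψ` on the free
basis maps, for each `g ≠ 1`, the complement of `N_ε(ℙ(V))` into `B_ε(x)` and expands the
norm of vectors there by a factor `e^{α|g|}`. -/
theorem stmt5 {k : Type*} [NormedField k] {n : ℕ} (N : (Fin n → k) → ℝ)
    (hLF :
      ((IsNonarchimedean fun x : k => ‖x‖) ∧ CompleteSpace k ∧ LocallyCompactSpace k ∧
        (∃ x : k, 1 < ‖x‖) ∧ ∀ v : Fin n → k, N v = ⨆ i, ‖v i‖) ∨
      (((∃ e : k ≃+* ℝ, ∀ x : k, ‖e x‖ = ‖x‖) ∨ (∃ e : k ≃+* ℂ, ∀ x : k, ‖e x‖ = ‖x‖)) ∧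
        ∀ v : Fin n → k, N v = Real.sqrt (∑ i, ‖v i‖ ^ 2)))
    (hn : 2 ≤ n) (m : ℕ) (hm : 1 ≤ m) (α : ℝ) (hα : 0 < α) (ε : ℝ) (hε0 : 0 < ε)
    (hε1 : ε < 1) (x₀ : Fin n → k) (hx₀ : x₀ ≠ 0)
    (V : Submodule k (Fin n → k)) (hV : Module.finrank k V = n - 1) (hxV : x₀ ∈ V) :
    ∃ (ψ : FreeGroup (Fin m) →* (Matrix (Fin n) (Fin n) k)ˣ) (δ : ℝ), 0 < δ ∧
      (∀ γ : FreeGroup (Fin m), (ψ γ : Matrix (Fin n) (Fin n) k).det = 1) ∧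
      ∀ ψ' : FreeGroup (Fin m) →* (Matrix (Fin n) (Fin n) k)ˣ,
        (∀ i : Fin m,
          opNg N ((ψ' (FreeGroup.of i) : Matrix (Fin n) (Fin n) k)
            - (ψ (FreeGroup.of i) : Matrix (Fin n) (Fin n) k)) < δ) →
        ∀ g : FreeGroup (Fin m), g ≠ 1 →
          ∀ v : Fin n → k, v ≠ 0 → ε ≤ distPSg N v V →
            dPg N x₀ ((ψ' g : Matrix (Fin n) (Fin n) k).mulVec v) ≤ ε ∧
            Real.exp (α * (FreeGroup.norm g : ℝ)) * N v ≤
              N ((ψ' g : Matrix (Fin n) (Fin n) k).mulVec v) := by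
  have hk : ∃ x : k, 1 < ‖x‖ := by
    rcases hLF with ⟨-, -, -, hk, -⟩ | ⟨⟨e, he⟩ | ⟨e, he⟩, -⟩
    · exact hk
    · exact ⟨e.symm 2, by rw [← he]; simp⟩
    · exact ⟨e.symm 2, by rw [← he]; simp⟩
  have hN : IsProjNorm N := by
    rcases hLF with ⟨hna, -, -, -, hN⟩ | ⟨⟨e, he⟩ | ⟨e, he⟩, hN⟩
    · exact isProjNorm_of_isNonarchimedean hna hN hn
    · exact isProjNorm_of_sqrt e.symm.toRingHom (fun r => by simp [← he]) hN
    · exact isProjNorm_of_sqrt (e.symm.toRingHom.comp Complex.ofRealHom)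
        (fun r => by simp [← he]) hN
  have hVtop : V < ⊤ := by
    refine lt_top_iff_ne_top.mpr fun htop => ?_
    rw [htop, finrank_top, Module.finrank_fin_fun] at hV
    omega
  obtain ⟨φ, hφ0, hVφ⟩ := Submodule.exists_le_ker_of_lt_top V hVtop
  obtain ⟨z, hz⟩ : ∃ z, φ z ≠ 0 := by
    by_contra! hall
    exact hφ0 (LinearMap.ext hall)
  have hφy : φ ((φ z)⁻¹ • z) = 1 := by simp [hz]
  obtain rfl : V = LinearMap.ker φ := by
    refine Submodule.eq_of_le_of_finrank_le hVφ ?_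
    have hrank := LinearMap.finrank_range_add_finrank_ker φ
    rw [LinearMap.range_eq_top.mpr (LinearMap.surjective hφ0), finrank_top, Module.finrank_self,
      Module.finrank_fin_fun] at hrank
    omega
  obtain ⟨i, hi⟩ := Function.ne_iff.mp hx₀
  have hi : x₀ i ≠ 0 := hi
  set y := (φ z)⁻¹ • z
  let ξ₀ : Module.Dual k (Fin n → k) := (x₀ i)⁻¹ • LinearMap.proj i
  have hφx : φ x₀ = 0 := hxV
  exact hN.exists_pingPong_hom hk m α hε0 hε1 (ξ := ξ₀ - ξ₀ y • φ) hφx hφy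
    (by simp [ξ₀, hφx, hi]) (by simp [hφy])
end
end

section
/- Let F be a finite group, d ≥ 2, and ψ_0 : F → GL_d(ℝ) a faithful homomorphism such that every ψ_0(f) is orthogonal and the only ψ_0(F)-invariant complex subspaces of ℂ^d are {0} and ℂ^d. Let n ≥ d+1, let ξ > 0 be such that π and ξ are algebraically independent over ℚ, let λ ≥ 8^n, and define ψ : ℤ × F → GL_n(ℝ) by ψ(0, f) := diag(ψ_0(f), 1, I_{n−d−1}) for f ∈ F and ψ(t) := diag(λ·I_d, λ^{−d}, Θ) for t := (1, 1_F), where Θ is: the empty block if n = d+1; the 1×1 matrix (1) if n = d+2; diag(R_ξ, …, R_{ξ^s}) if n = 2s+d+1 with s ≥ 1; and diag(2R_ξ, …, 2R_{ξ^s}, 4^{−s}) if n = 2s+d+2 with s ≥ 1, where R_τ denotes the 2×2 rotation matrix by angle τ. Then for every θ with 0 < θ < 1 there exists θ' > 0 with the following two properties. (a) There is δ > 0 such that every homomorphism φ : ℤ × F → GL_n(ℂ) with ‖φ(t) − ψ(t)‖ < δ and ‖φ(0,f) − ψ(0,f)‖ < δ for all f ∈ F belongs to the set Ψ_{θ'}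 of all homomorphisms φ for which there exists w ∈ GL_n(ℂ) with ‖w − I‖ < θ', φ(0,f) = w·ψ(0,f)·w⁻¹ for all f ∈ F, and ‖φ(t) − ψ(t)‖ < θ'. (b) For every φ ∈ Ψ_{θ'} there exist w_φ ∈ GL_n(ℂ) with ‖w_φ − I‖ < θ and ‖w_φ⁻¹ − I‖ < θ, scalars λ_1, λ_2 ∈ ℂ with |λ_1 − λ| < θ and |λ_2 − λ^{−d}| < θ, and Θ' ∈ GL_{n−d−1}(ℂ) with ‖Θ' − Θ‖ < θ, such that φ(t) = w_φ·diag(λ_1·I_d, λ_2, Θ')·w_φ⁻¹ and φ(0,f) = w_φ·ψ(0,f)·w_φ⁻¹ for all f ∈ F. Moreover, when n = d+1 one may take θ' = θ/(10⁴·‖ψ(t)‖). -/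
noncomputable section

/-- Euclidean norm on `Fin n → ℂ`. -/
def eN {n : ℕ} (v : Fin n → ℂ) : ℝ :=
  Real.sqrt (∑ i, ‖v i‖ ^ 2)

/-- Operator norm of a complex matrix with respect to the Euclidean norm. -/
def opN {n : ℕ} (A : Matrix (Fin n) (Fin n) ℂ) : ℝ :=
  sInf {c : ℝ | 0 ≤ c ∧ ∀ v : Fin n → ℂ, eN (A.mulVec v) ≤ c * eN v}

/-- Entry `(i, j)` of a block diagonal matrix of `2×2` rotation blocks scaled by `c`, the
`m`-th block being the rotation by angle `ξ^(m+1)`. -/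
def rotEnt (c ξ : ℝ) (i j : ℕ) : ℝ :=
  if i / 2 = j / 2 then
    c * (if i % 2 = 0 then
          (if j % 2 = 0 then Real.cos (ξ ^ (i / 2 + 1)) else -Real.sin (ξ ^ (i / 2 + 1)))
        else
          (if j % 2 = 0 then Real.sin (ξ ^ (i / 2 + 1)) else Real.cos (ξ ^ (i / 2 + 1))))
  else 0

/-- The block `Θ`: empty if `n = d+1`; `(1)` if `n = d+2`; `diag(R_ξ, …, R_{ξ^s})` if
`n = 2s+d+1`; `diag(2R_ξ, …, 2R_{ξ^s}, 4^{−s})` if `n = 2s+d+2`. -/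
def Theta (n d s : ℕ) (ξ : ℝ) : Matrix (Fin (n - d - 1)) (Fin (n - d - 1)) ℝ :=
  Matrix.of fun i j =>
    if n = d + 2 then (if i = j then 1 else 0)
    else if n = 2 * s + d + 1 then rotEnt 1 ξ i j
    else if (i : ℕ) = 2 * s ∨ (j : ℕ) = 2 * s then
      (if (i : ℕ) = (j : ℕ) then ((4 : ℝ) ^ s)⁻¹ else 0)
    else rotEnt 2 ξ i j

/-- The block diagonal matrix `diag(g, I_{n−d})` (i.e. `diag(g, 1, I_{n−d−1})`). -/
def embedB {R : Type*} [CommRing R] (d n : ℕ) (g : Matrix (Fin d) (Fin d) R) :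
    Matrix (Fin n) (Fin n) R :=
  Matrix.of fun i j =>
    if hi : (i : ℕ) < d then (if hj : (j : ℕ) < d then g ⟨i, hi⟩ ⟨j, hj⟩ else 0)
    else if (i : ℕ) = (j : ℕ) then 1 else 0

/-- The block diagonal matrix `diag(a·I_d, b, Th)`. -/
def psiTgen {R : Type*} [CommRing R] (n d : ℕ) (a b : R)
    (Th : Matrix (Fin (n - d - 1)) (Fin (n - d - 1)) R) : Matrix (Fin n) (Fin n) R :=
  Matrix.of fun i j =>
    if (i : ℕ) < d then (if (i : ℕ) = (j : ℕ) then a else 0)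
    else if (i : ℕ) = d then (if (i : ℕ) = (j : ℕ) then b else 0)
    else if _h : d + 1 ≤ (i : ℕ) ∧ d + 1 ≤ (j : ℕ) then
      Th ⟨(i : ℕ) - d - 1, by have := i.2; omega⟩ ⟨(j : ℕ) - d - 1, by have := j.2; omega⟩
    else 0

/-- Membership in the set `Ψ_{θ'}` of homomorphisms `φ : ℤ × F → GL_n(ℂ)` that agree with
`ψ` on `F` up to conjugation by some `w` with `‖w − I‖ < θ'` and are `θ'`-close to `ψ` on
`t`. -/
def memPsi {F : Type*} [Group F] (n d s : ℕ)
    (ψ₀ : F →* (Matrix (Fin d) (Fin d) ℝ)ˣ) (lam ξ : ℝ) (θ' : ℝ)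
    (φ : Multiplicative ℤ × F →* (Matrix (Fin n) (Fin n) ℂ)ˣ) : Prop :=
  ∃ w : (Matrix (Fin n) (Fin n) ℂ)ˣ,
    opN ((w : Matrix (Fin n) (Fin n) ℂ) - 1) < θ' ∧
    (∀ f : F, (φ (1, f) : Matrix (Fin n) (Fin n) ℂ) =
      (w : Matrix (Fin n) (Fin n) ℂ) *
        (embedB d n (ψ₀ f : Matrix (Fin d) (Fin d) ℝ)).map Complex.ofReal *
          ((w⁻¹ : _) : Matrix (Fin n) (Fin n) ℂ)) ∧
    opN ((φ (Multiplicative.ofAdd (1 : ℤ), 1) : Matrix (Fin n) (Fin n) ℂ) -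
      (psiTgen n d lam (lam ^ (-(d : ℤ))) (Theta n d s ξ)).map Complex.ofReal) < θ'

open Filter Topology
open scoped Matrix.Norms.L2Operator

/-- `1 + a` as a unit with inverse `1 - a`, for `a` of square zero. -/
def oneAddUnit {𝔸 : Type*} [Ring 𝔸] (a : 𝔸) (h : a * a = 0) : 𝔸ˣ :=
  ⟨1 + a, 1 - a, by rw [add_mul, mul_sub, mul_sub, h]; simp,
    by rw [mul_add, sub_mul, sub_mul, h]; simp⟩

theorem block_diagonalization_near {𝔸 : Type*} [NormedRing 𝔸] [NormedAlgebra ℂ 𝔸] [CompleteSpace 𝔸]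
    {p q N₀ S R : 𝔸} {μ : ℂ} (hpq : p + q = 1) (hp : p * p = p)
    (hl : N₀ * p = μ • p) (hr : p * N₀ = μ • p) (hS : S = N₀ - μ • 1 + p)
    (hSR : S * R = 1) (hRS : R * S = 1) {ε : ℝ} (hε : 0 < ε) :
    ∀ᶠ M in 𝓝 N₀, ∃ v : 𝔸ˣ, ∃ N : 𝔸, ‖(v : 𝔸) - 1‖ < ε ∧ ‖((v⁻¹ : 𝔸ˣ) : 𝔸) - 1‖ < ε ∧
      ‖N - N₀‖ < ε ∧ p * N = N * p ∧ M = v * N * ((v⁻¹ : 𝔸ˣ) : 𝔸) := by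
  have hq : q = 1 - p := by rw [← hpq]; abel
  have hpq0 : p * q = 0 := by rw [hq, mul_sub, hp, mul_one, sub_self]
  have hqp0 : q * p = 0 := by rw [hq, sub_mul, hp, one_mul, sub_self]
  have hqq : q * q = q := by rw [hq, sub_mul, one_mul, ← hq, hpq0, sub_zero]
  have hSp : S * p = p := by
    rw [hS, add_mul, sub_mul, hl, hp, smul_mul_assoc, one_mul, sub_self, zero_add]
  have hpS : p * S = p := by
    rw [hS, mul_add, mul_sub, hr, hp, mul_smul_comm, mul_one, sub_self, zero_add]
  have hSq : S * q = q * S := by rw [hq, mul_sub, sub_mul, hSp, hpS, mul_one, one_mul]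
  let c : 𝔸 → 𝔸 → 𝔸 →L[ℂ] 𝔸 := fun a b =>
    ((ContinuousLinearMap.mul ℂ 𝔸).flip b).comp (ContinuousLinearMap.mul ℂ 𝔸 a)
  let X : 𝔸 × 𝔸 × 𝔸 →L[ℂ] 𝔸 := (c q p).comp (ContinuousLinearMap.fst ℂ 𝔸 (𝔸 × 𝔸))
  let Y : 𝔸 × 𝔸 × 𝔸 →L[ℂ] 𝔸 := (c p q).comp
    ((ContinuousLinearMap.fst ℂ 𝔸 𝔸).comp (ContinuousLinearMap.snd ℂ 𝔸 (𝔸 × 𝔸)))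
  let B : 𝔸 × 𝔸 × 𝔸 →L[ℂ] 𝔸 := (c p p + c q q).comp
    ((ContinuousLinearMap.snd ℂ 𝔸 𝔸).comp (ContinuousLinearMap.snd ℂ 𝔸 (𝔸 × 𝔸)))
  have hX : ∀ x, X x = q * x.1 * p := fun x => rfl
  have hY : ∀ x, Y x = p * x.2.1 * q := fun x => rfl
  have hB : ∀ x, B x = p * x.2.2 * p + q * x.2.2 * q := fun x => rfl
  let x₀ : 𝔸 × 𝔸 × 𝔸 := (0, 0, N₀)
  have hX0 : X x₀ = 0 := by simp [hX, x₀]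
  have hY0 : Y x₀ = 0 := by simp [hY, x₀]
  have hB0 : B x₀ = N₀ := by
    have h1 : q * N₀ = N₀ * q := by rw [hq, mul_sub, sub_mul, hl, hr, mul_one, one_mul]
    have h2 : p * N₀ = N₀ * p := by rw [hl, hr]
    rw [hB]; show p * N₀ * p + q * N₀ * q = N₀
    rw [h1, h2, mul_assoc, mul_assoc, hp, hqq, ← mul_add, hpq, mul_one]
  let G : 𝔸 × 𝔸 × 𝔸 → 𝔸 := fun x => (1 + X x) * (1 + Y x) * B x * (1 - Y x) * (1 - X x)
  have hG0 : G x₀ = N₀ := by simp [G, hX0, hY0, hB0]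
  have dX := X.hasStrictFDerivAt (x := x₀)
  have dY := Y.hasStrictFDerivAt (x := x₀)
  have dB := B.hasStrictFDerivAt (x := x₀)
  have dG := ((((dX.const_add 1).mul' (dY.const_add 1)).mul' dB).mul' (dY.const_sub 1)).mul'
    (dX.const_sub 1)
  have key : map G (𝓝 x₀) = 𝓝 (G x₀) := dG.map_nhds_eq_of_surj ?_
  · have hXX : ∀ x, X x * X x = 0 := fun x => by
      rw [hX, mul_assoc, ← mul_assoc p, ← mul_assoc p, hpq0, zero_mul, zero_mul, mul_zero]
    have hYY : ∀ x, Y x * Y x = 0 := fun x => by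
      rw [hY, mul_assoc, ← mul_assoc q, ← mul_assoc q, hqp0, zero_mul, zero_mul, mul_zero]
    let v : 𝔸 × 𝔸 × 𝔸 → 𝔸ˣ := fun x =>
      oneAddUnit (X x) (hXX x) * oneAddUnit (Y x) (hYY x)
    have hv : ∀ x, (v x : 𝔸) = (1 + X x) * (1 + Y x) := fun x => rfl
    have hv' : ∀ x, (((v x)⁻¹ : 𝔸ˣ) : 𝔸) = (1 - Y x) * (1 - X x) := fun x => by
      simp only [v, mul_inv_rev]; rfl
    have cv : Continuous fun x => ‖(1 + X x) * (1 + Y x) - 1‖ := by fun_prop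
    have cw : Continuous fun x => ‖(1 - Y x) * (1 - X x) - 1‖ := by fun_prop
    have cB : Continuous fun x => ‖B x - N₀‖ := by fun_prop
    rw [hG0] at key
    rw [← key, eventually_map]
    filter_upwards [cv.continuousAt.eventually_lt_const (u := ε) (by simpa [hX0, hY0]),
      cw.continuousAt.eventually_lt_const (u := ε) (by simpa [hX0, hY0]),
      cB.continuousAt.eventually_lt_const (u := ε) (by simpa [hB0])] with x h₁ h₂ h₃
    refine ⟨v x, B x, by rwa [hv], by rwa [hv'], h₃, ?_, ?_⟩
    · rw [hB]
      simp only [mul_add, add_mul, ← mul_assoc, hp, hpq0, zero_mul, add_zero]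
      simp only [mul_assoc, hp, hqp0, mul_zero, add_zero]
    · rw [hv, hv']; simp only [G, mul_assoc]
  · refine LinearMap.range_eq_top.2 fun Z => ⟨(-(R * Z), Z * R, Z), ?_⟩
    have h₁ : q * (R * Z) * p * N₀ = μ • (q * (R * Z) * p) := by
      rw [mul_assoc _ p, hr, mul_smul_comm]
    have h₂ : N₀ * (p * (Z * R) * q) = μ • (p * (Z * R) * q) := by
      rw [← mul_assoc, ← mul_assoc, hl]; simp only [smul_mul_assoc, mul_assoc]
    have h₃ : N₀ * (q * (R * Z) * p) = q * Z * p + μ • (q * (R * Z) * p) := by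
      have : N₀ = S + μ • 1 - p := by rw [hS]; abel
      rw [this, sub_mul, add_mul, smul_mul_assoc, one_mul, ← mul_assoc p, ← mul_assoc p, hpq0,
        zero_mul, zero_mul, sub_zero, ← mul_assoc S, ← mul_assoc S, hSq, mul_assoc q S,
        ← mul_assoc S R, hSR, one_mul]
    have h₄ : p * (Z * R) * q * N₀ = p * Z * q + μ • (p * (Z * R) * q) := by
      have : N₀ = S + μ • 1 - p := by rw [hS]; abel
      rw [this, mul_sub, mul_add, mul_smul_comm, mul_one, mul_assoc _ q p, hqp0, mul_zero,
        sub_zero, mul_assoc _ q S, ← hSq, mul_assoc p, mul_assoc Z, ← mul_assoc R, hRS, one_mul,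
        ← mul_assoc]
    have h₅ : Z = p * Z * p + p * Z * q + q * Z * p + q * Z * q := by
      calc Z = (p + q) * Z * (p + q) := by rw [hpq, one_mul, mul_one]
        _ = _ := by simp only [add_mul, mul_add]; abel
    have hXZ : X (-(R * Z), Z * R, Z) = -(q * (R * Z) * p) := by
      rw [hX, mul_neg, neg_mul]
    have hYZ : Y (-(R * Z), Z * R, Z) = p * (Z * R) * q := hY _
    have hBZ : B (-(R * Z), Z * R, Z) = p * Z * p + q * Z * q := hB _
    simp only [ContinuousLinearMap.coe_coe, add_apply, smul_apply,
      neg_apply, MulOpposite.smul_eq_mul_unop, MulOpposite.unop_op,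
      smul_eq_mul, Pi.mul_apply, hX0, hY0, hB0, hXZ, hYZ, hBZ]
    simp only [add_zero, sub_zero, one_mul, mul_one, mul_neg, neg_neg, neg_mul, add_mul, h₁, h₂,
      h₃, h₄]
    refine Eq.trans ?_ h₅.symm
    abel

theorem opN_eq_norm {n : ℕ} (A : Matrix (Fin n) (Fin n) ℂ) : opN A = ‖A‖ := by
  have hN : ∀ v : Fin n → ℂ, eN v = ‖WithLp.toLp 2 v‖ := fun v => by
    rw [EuclideanSpace.norm_eq]; rfl
  rw [← Matrix.l2_opNorm_toEuclideanCLM, ContinuousLinearMap.norm_def]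
  unfold opN
  congr 1
  ext c
  refine and_congr_right fun _ => ⟨fun h x => ?_, fun h v => ?_⟩
  · have := h x.ofLp
    rwa [hN, hN] at this
  · simpa [hN] using h (WithLp.toLp 2 v)

theorem l2_opNorm_one_le {m : Type*} [Fintype m] [DecidableEq m] :
    ‖(1 : Matrix m m ℂ)‖ ≤ 1 := by
  rw [← Matrix.l2_opNorm_toEuclideanCLM, map_one]
  exact ContinuousLinearMap.norm_id_le

theorem l2_opNorm_submatrix_le {m n : Type*} [Fintype m] [Fintype n] [DecidableEq m]
    [DecidableEq n] {e : m → n} (he : Function.Injective e) (A : Matrix n n ℂ) :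
    ‖A.submatrix e e‖ ≤ ‖A‖ := by
  let P : Matrix m n ℂ := (1 : Matrix n n ℂ).submatrix e id
  have hA : A.submatrix e e = P * A * P.conjTranspose := by
    have h₁ : P * A = A.submatrix e id := by
      ext i j; simp [P, Matrix.mul_apply, Matrix.one_apply]
    rw [h₁]
    ext i j; simp [P, Matrix.mul_apply, Matrix.one_apply]
  have hP : P * P.conjTranspose = 1 := by
    ext i j; simp [P, Matrix.mul_apply, Matrix.one_apply, he.eq_iff]
  have hP1 : ‖P‖ ≤ 1 := by
    have h := Matrix.l2_opNorm_conjTranspose_mul_self P.conjTranspose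
    rw [Matrix.conjTranspose_conjTranspose, hP, Matrix.l2_opNorm_conjTranspose] at h
    nlinarith [l2_opNorm_one_le (m := m), norm_nonneg P]
  rw [hA]
  calc ‖P * A * P.conjTranspose‖ ≤ ‖P‖ * ‖A‖ * ‖P.conjTranspose‖ :=
        (Matrix.l2_opNorm_mul _ _).trans (by gcongr; exact Matrix.l2_opNorm_mul _ _)
    _ ≤ 1 * ‖A‖ * 1 := by rw [Matrix.l2_opNorm_conjTranspose]; gcongr
    _ = ‖A‖ := by ring

theorem norm_entry_le_l2_opNorm {n : Type*} [Fintype n] [DecidableEq n] (A : Matrix n n ℂ)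
    (i j : n) : ‖A i j‖ ≤ ‖A‖ := by
  have h := A.l2_opNorm_mulVec (EuclideanSpace.single j 1)
  have h' := PiLp.norm_apply_le (WithLp.toLp 2 (A.mulVec (EuclideanSpace.single j (1 : ℂ)).ofLp)) i
  simp at h h'
  exact h'.trans h

section Irreducible

variable {F : Type*} {d : ℕ} {ρ : F → Matrix (Fin d) (Fin d) ℂ}

theorem exists_eq_scalar_of_commute (hd : 0 < d)
    (hirr : ∀ W : Submodule ℂ (Fin d → ℂ), (∀ f, ∀ w ∈ W, (ρ f).mulVec w ∈ W) → W = ⊥ ∨ W = ⊤)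
    {A : Matrix (Fin d) (Fin d) ℂ} (hA : ∀ f, A * ρ f = ρ f * A) :
    ∃ c : ℂ, A = Matrix.scalar (Fin d) c := by
  have : Nonempty (Fin d) := ⟨⟨0, hd⟩⟩
  obtain ⟨c, hc⟩ := Module.End.exists_eigenvalue (Matrix.toLin' A)
  refine ⟨c, ?_⟩
  have htop := (hirr (Module.End.eigenspace (Matrix.toLin' A) c) fun f w hw => by
    rw [Module.End.mem_eigenspace_iff, Matrix.toLin'_apply] at hw ⊢
    rw [Matrix.mulVec_mulVec, hA, ← Matrix.mulVec_mulVec, hw, Matrix.mulVec_smul]).resolve_left hc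
  refine Matrix.toLin'.injective (LinearMap.ext fun v => ?_)
  have hv : v ∈ Module.End.eigenspace (Matrix.toLin' A) c := htop ▸ Submodule.mem_top
  rw [Module.End.mem_eigenspace_iff.1 hv]
  simp [← Matrix.smul_one_eq_diagonal]

theorem eq_zero_of_mulVec_eq_self (hd : 2 ≤ d)
    (hirr : ∀ W : Submodule ℂ (Fin d → ℂ), (∀ f, ∀ w ∈ W, (ρ f).mulVec w ∈ W) → W = ⊥ ∨ W = ⊤)
    {x : Fin d → ℂ} (hx : ∀ f, (ρ f).mulVec x = x) : x = 0 := by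
  by_contra hx0
  rcases hirr (ℂ ∙ x) fun f w hw => by
    obtain ⟨c, rfl⟩ := Submodule.mem_span_singleton.1 hw
    rwa [Matrix.mulVec_smul, hx] with h | h
  · exact hx0 (Submodule.span_singleton_eq_bot.1 h)
  · have h₁ := finrank_span_singleton (K := ℂ) hx0
    rw [h, finrank_top, Module.finrank_fin_fun] at h₁
    omega

theorem eq_zero_of_vecMul_eq_self (hd : 2 ≤ d)
    (hirr : ∀ W : Submodule ℂ (Fin d → ℂ), (∀ f, ∀ w ∈ W, (ρ f).mulVec w ∈ W) → W = ⊥ ∨ W = ⊤)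
    {y : Fin d → ℂ} (hy : ∀ f, Matrix.vecMul y (ρ f) = y) : y = 0 := by
  let L : (Fin d → ℂ) →ₗ[ℂ] ℂ := dotProductBilin ℂ ℂ y
  have hL : ∀ v, L v = y ⬝ᵥ v := fun v => rfl
  rcases hirr (LinearMap.ker L) fun f w hw => by
    rw [LinearMap.mem_ker, hL] at hw ⊢
    rw [Matrix.dotProduct_mulVec, hy, hw] with h | h
  · have h₁ := L.finrank_range_add_finrank_ker
    have h₂ := (LinearMap.range L).finrank_le
    rw [h, finrank_bot, Module.finrank_fin_fun] at h₁
    rw [Module.finrank_self] at h₂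
    omega
  · rw [← dotProduct_eq_zero_iff]
    intro w
    have : w ∈ LinearMap.ker L := h ▸ Submodule.mem_top
    rwa [LinearMap.mem_ker, hL] at this

end Irreducible

section Blocks

variable {R : Type*} [CommRing R] {n d : ℕ}

/-- The inclusion of the indices of the lower right block. -/
def tailIdx (n d : ℕ) (i : Fin (n - d - 1)) : Fin n :=
  ⟨d + 1 + i, by have := i.2; omega⟩

theorem tailIdx_injective : Function.Injective (tailIdx n d) := fun i j h => by
  simpa [tailIdx, Fin.ext_iff] using h

theorem exists_tailIdx {i : Fin n} (h : d < i) : ∃ k, i = tailIdx n d k :=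
  ⟨⟨i - d - 1, by have := i.2; omega⟩, by ext; simp [tailIdx]; omega⟩

theorem not_tailIdx_le (k : Fin (n - d - 1)) : ¬ (tailIdx n d k : ℕ) ≤ d := by
  simp [tailIdx]; omega

theorem psiTgen_of_le {a b : R} {Th : Matrix (Fin (n - d - 1)) (Fin (n - d - 1)) R} {i : Fin n}
    (h : (i : ℕ) ≤ d) (j : Fin n) :
    psiTgen n d a b Th i j = if i = j then (if (i : ℕ) < d then a else b) else 0 := by
  rcases h.lt_or_eq with h | h
  · simp [psiTgen, h, Fin.ext_iff]
  · simp [psiTgen, h, Fin.ext_iff]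

theorem psiTgen_tailIdx_of_le {a b : R} {Th : Matrix (Fin (n - d - 1)) (Fin (n - d - 1)) R}
    (k : Fin (n - d - 1)) {j : Fin n} (h : (j : ℕ) ≤ d) :
    psiTgen n d a b Th (tailIdx n d k) j = 0 := by
  have h₁ : ¬ (d + 1 + (k : ℕ) < d) := by omega
  have h₂ : ¬ (d + 1 + (k : ℕ) = d) := by omega
  simp [psiTgen, tailIdx, h₁, h₂]
  exact fun _ _ => by omega

theorem psiTgen_tailIdx {a b : R} {Th : Matrix (Fin (n - d - 1)) (Fin (n - d - 1)) R}
    (k l : Fin (n - d - 1)) :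
    psiTgen n d a b Th (tailIdx n d k) (tailIdx n d l) = Th k l := by
  have h₁ : ¬ (d + 1 + (k : ℕ) < d) := by omega
  have h₂ : ¬ (d + 1 + (k : ℕ) = d) := by omega
  have h₃ : ∀ m : Fin (n - d - 1), d + 1 + (m : ℕ) - d - 1 = m := by intro m; omega
  simp [psiTgen, tailIdx, h₁, h₂, h₃]
  exact fun h => by have := h (by omega); omega

theorem psiTgen_tailIdx_sum {a b : R} {Th : Matrix (Fin (n - d - 1)) (Fin (n - d - 1)) R}
    (k : Fin (n - d - 1)) (g : Fin n → R) :
    ∑ j, psiTgen n d a b Th (tailIdx n d k) j * g j = ∑ l, Th k l * g (tailIdx n d l) := by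
  refine (Fintype.sum_of_injective _ tailIdx_injective _ _ (fun j hj => ?_) fun l => ?_).symm
  · have : (j : ℕ) ≤ d := by
      by_contra h
      obtain ⟨l, rfl⟩ := exists_tailIdx (not_le.1 h)
      exact hj ⟨l, rfl⟩
    rw [psiTgen_tailIdx_of_le k this, zero_mul]
  · rw [psiTgen_tailIdx]

theorem psiTgen_mul (a b a' b' : R) (Th Th' : Matrix (Fin (n - d - 1)) (Fin (n - d - 1)) R) :
    psiTgen n d a b Th * psiTgen n d a' b' Th' = psiTgen n d (a * a') (b * b') (Th * Th') := by
  ext i j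
  rw [Matrix.mul_apply]
  by_cases hi : (i : ℕ) ≤ d
  · simp only [psiTgen_of_le hi, ite_mul, zero_mul, Finset.sum_ite_eq, Finset.mem_univ, if_true]
    split_ifs <;> simp
  · obtain ⟨k, rfl⟩ := exists_tailIdx (not_le.1 hi)
    rw [psiTgen_tailIdx_sum]
    by_cases hj : (j : ℕ) ≤ d
    · simp [psiTgen_tailIdx_of_le _ hj]
    · obtain ⟨l, rfl⟩ := exists_tailIdx (not_le.1 hj)
      simp only [psiTgen_tailIdx, Matrix.mul_apply]

theorem psiTgen_one : psiTgen n d (1 : R) 1 1 = 1 := by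
  ext i j
  by_cases hi : (i : ℕ) ≤ d
  · simp [psiTgen_of_le hi, Matrix.one_apply]
  · obtain ⟨k, rfl⟩ := exists_tailIdx (not_le.1 hi)
    by_cases hj : (j : ℕ) ≤ d
    · rw [psiTgen_tailIdx_of_le _ hj, Matrix.one_apply_ne]
      rintro rfl
      exact not_tailIdx_le k hj
    · obtain ⟨l, rfl⟩ := exists_tailIdx (not_le.1 hj)
      simp [psiTgen_tailIdx, Matrix.one_apply, tailIdx_injective.eq_iff]

theorem psiTgen_add (a b a' b' : R) (Th Th' : Matrix (Fin (n - d - 1)) (Fin (n - d - 1)) R) :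
    psiTgen n d a b Th + psiTgen n d a' b' Th' = psiTgen n d (a + a') (b + b') (Th + Th') := by
  ext i j
  simp only [psiTgen, Matrix.add_apply, Matrix.of_apply]
  split_ifs <;> simp

theorem psiTgen_smul (c a b : R) (Th : Matrix (Fin (n - d - 1)) (Fin (n - d - 1)) R) :
    c • psiTgen n d a b Th = psiTgen n d (c * a) (c * b) (c • Th) := by
  ext i j
  simp only [psiTgen, Matrix.smul_apply, Matrix.of_apply]
  split_ifs <;> simp

theorem psiTgen_map {S : Type*} [CommRing S] (f : R →+* S) (a b : R)
    (Th : Matrix (Fin (n - d - 1)) (Fin (n - d - 1)) R) :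
    (psiTgen n d a b Th).map f = psiTgen n d (f a) (f b) (Th.map f) := by
  ext i j
  simp only [psiTgen, Matrix.map_apply, Matrix.of_apply]
  split_ifs <;> simp

theorem psiTgen_zero_one_zero :
    psiTgen n d (0 : R) 1 0 = Matrix.diagonal fun i : Fin n => if (i : ℕ) = d then 1 else 0 := by
  ext i j
  by_cases hi : (i : ℕ) ≤ d
  · rw [psiTgen_of_le hi, Matrix.diagonal_apply]
    split_ifs <;> first | rfl | omega
  · have hi' : (i : ℕ) ≠ d := by omega
    rw [Matrix.diagonal_apply, if_neg hi', ite_self]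
    obtain ⟨k, rfl⟩ := exists_tailIdx (not_le.1 hi)
    by_cases hj : (j : ℕ) ≤ d
    · rw [psiTgen_tailIdx_of_le _ hj]
    · obtain ⟨l, rfl⟩ := exists_tailIdx (not_le.1 hj)
      simp [psiTgen_tailIdx]

theorem embedB_castLE_sum (hdn : d ≤ n) (g : Matrix (Fin d) (Fin d) R) (k : Fin d)
    (x : Fin n → R) :
    ∑ j, embedB d n g (Fin.castLE hdn k) j * x j = g.mulVec (fun l => x (Fin.castLE hdn l)) k := by
  refine (Fintype.sum_of_injective _ (Fin.castLE_injective hdn) _ _ (fun j hj => ?_)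
    fun l => ?_).symm
  · have : ¬ (j : ℕ) < d := fun h => hj ⟨⟨j, h⟩, rfl⟩
    simp [embedB, this]
  · simp [embedB]

theorem sum_embedB_castLE (hdn : d ≤ n) (g : Matrix (Fin d) (Fin d) R) (k : Fin d)
    (x : Fin n → R) :
    ∑ i, x i * embedB d n g i (Fin.castLE hdn k) =
      Matrix.vecMul (fun l => x (Fin.castLE hdn l)) g k := by
  refine (Fintype.sum_of_injective _ (Fin.castLE_injective hdn) _ _ (fun j hj => ?_)
    fun l => ?_).symm
  · have : ¬ (j : ℕ) < d := fun h => hj ⟨⟨j, h⟩, rfl⟩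
    have h' : (j : ℕ) ≠ k := by have := k.2; omega
    simp [embedB, this, h']
  · simp [embedB]

theorem embedB_of_le (g : Matrix (Fin d) (Fin d) R) {i : Fin n} (h : d ≤ i) (j : Fin n) :
    embedB d n g i j = if i = j then 1 else 0 := by
  simp [embedB, not_lt.2 h, Fin.ext_iff]

theorem embedB_of_le_right (g : Matrix (Fin d) (Fin d) R) {j : Fin n} (h : d ≤ j) (i : Fin n) :
    embedB d n g i j = if i = j then 1 else 0 := by
  by_cases hi : (i : ℕ) < d
  · have : i ≠ j := by rintro rfl; omega
    simp [embedB, hi, not_lt.2 h, this]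
  · exact embedB_of_le g (not_lt.1 hi) j

theorem embedB_map {S : Type*} [CommRing S] (f : R →+* S) (g : Matrix (Fin d) (Fin d) R) :
    (embedB d n g).map f = embedB d n (g.map f) := by
  ext i j
  simp only [embedB, Matrix.map_apply, Matrix.of_apply]
  split_ifs <;> simp

theorem psiTgen_commute_embedB (a b : R) (Th : Matrix (Fin (n - d - 1)) (Fin (n - d - 1)) R)
    (g : Matrix (Fin d) (Fin d) R) (hdn : d ≤ n) :
    psiTgen n d a b Th * embedB d n g = embedB d n g * psiTgen n d a b Th := by
  ext i j
  rw [Matrix.mul_apply, Matrix.mul_apply]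
  by_cases hi : (i : ℕ) < d
  · simp only [psiTgen_of_le hi.le, hi, if_true, ite_mul, zero_mul, Finset.sum_ite_eq,
      Finset.mem_univ]
    have := embedB_castLE_sum hdn g ⟨i, hi⟩ fun k => psiTgen n d a b Th k j
    rw [show Fin.castLE hdn ⟨i, hi⟩ = i from rfl] at this
    rw [this]
    simp only [Matrix.mulVec, dotProduct]
    by_cases hj : (j : ℕ) < d
    · rw [Finset.sum_eq_single ⟨j, hj⟩]
      · rw [psiTgen_of_le (by simpa using hj.le)]; simp [embedB, hi, hj, mul_comm]
      · intro k _ hk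
        rw [psiTgen_of_le (by simp), if_neg, mul_zero]
        rintro rfl; exact hk rfl
      · simp
    · rw [Finset.sum_eq_zero]
      · simp [embedB, hi, hj]
      · intro k _
        rw [psiTgen_of_le (by simp), if_neg, mul_zero]
        rintro rfl; exact hj (by simp)
  · simp only [embedB_of_le g (not_lt.1 hi), ite_mul, one_mul, zero_mul, Finset.sum_ite_eq,
      Finset.mem_univ, if_true]
    by_cases hi' : (i : ℕ) ≤ d
    · simp only [psiTgen_of_le hi', hi, if_false, ite_mul, zero_mul, Finset.sum_ite_eq,
        Finset.mem_univ, if_true, embedB_of_le g (not_lt.1 hi), mul_ite, mul_one, mul_zero]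
    · obtain ⟨k, rfl⟩ := exists_tailIdx (not_le.1 hi')
      rw [psiTgen_tailIdx_sum]
      have hl : ∀ l : Fin (n - d - 1), d ≤ (tailIdx n d l : ℕ) := fun l => by
        simp [tailIdx]; omega
      simp only [embedB_of_le g (hl _)]
      by_cases hj : (j : ℕ) ≤ d
      · rw [psiTgen_tailIdx_of_le k hj]
        refine Finset.sum_eq_zero fun l _ => ?_
        rw [if_neg, mul_zero]
        rintro rfl
        exact not_tailIdx_le l hj
      · obtain ⟨l, rfl⟩ := exists_tailIdx (not_le.1 hj)
        simp [psiTgen_tailIdx, tailIdx_injective.eq_iff]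

end Blocks

section Commutant

variable {F : Type*} {n d : ℕ} {ρ : F → Matrix (Fin d) (Fin d) ℂ}

theorem exists_scalar_block_of_commute (hd : 2 ≤ d) (hdn : d ≤ n)
    (hirr : ∀ W : Submodule ℂ (Fin d → ℂ), (∀ f, ∀ w ∈ W, (ρ f).mulVec w ∈ W) → W = ⊥ ∨ W = ⊤)
    {N : Matrix (Fin n) (Fin n) ℂ} (hN : ∀ f, N * embedB d n (ρ f) = embedB d n (ρ f) * N) :
    ∃ c : ℂ, (∀ i j : Fin n, (i : ℕ) < d → N i j = if i = j then c else 0) ∧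
      ∀ i j : Fin n, d ≤ (i : ℕ) → (j : ℕ) < d → N i j = 0 := by
  have hent : ∀ f i j, ∑ k, N i k * embedB d n (ρ f) k j = ∑ k, embedB d n (ρ f) i k * N k j :=
    fun f i j => by rw [← Matrix.mul_apply, ← Matrix.mul_apply, hN]
  obtain ⟨c, hc⟩ := exists_eq_scalar_of_commute (A := N.submatrix (Fin.castLE hdn) (Fin.castLE hdn))
    (by omega) hirr fun f => by
      ext i j
      have := hent f (Fin.castLE hdn i) (Fin.castLE hdn j)
      rw [sum_embedB_castLE, embedB_castLE_sum] at this
      exact this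
  have hright : ∀ j : Fin n, d ≤ (j : ℕ) → (fun l => N (Fin.castLE hdn l) j) = 0 := fun j hj =>
    eq_zero_of_mulVec_eq_self hd hirr fun f => by
      ext i
      have := hent f (Fin.castLE hdn i) j
      rw [embedB_castLE_sum] at this
      rw [← this]
      simp [embedB_of_le_right (ρ f) hj]
  have hleft : ∀ i : Fin n, d ≤ (i : ℕ) → (fun l => N i (Fin.castLE hdn l)) = 0 := fun i hi =>
    eq_zero_of_vecMul_eq_self hd hirr fun f => by
      ext j
      have := hent f i (Fin.castLE hdn j)
      rw [sum_embedB_castLE] at this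
      rw [this]
      simp [embedB_of_le (ρ f) hi]
  refine ⟨c, fun i j hi => ?_, fun i j hi hj => congrFun (hleft i hi) ⟨j, hj⟩⟩
  by_cases hj : (j : ℕ) < d
  · have := congrFun (congrFun hc ⟨i, hi⟩) ⟨j, hj⟩
    simpa [Matrix.diagonal_apply, Fin.ext_iff] using this
  · have h := congrFun (hright j (not_lt.1 hj)) ⟨i, hi⟩
    rw [if_neg (by rintro rfl; exact hj hi)]
    exact h

theorem eq_psiTgen_of_commute (hd : 2 ≤ d) (hdn : d ≤ n)
    (hirr : ∀ W : Submodule ℂ (Fin d → ℂ), (∀ f, ∀ w ∈ W, (ρ f).mulVec w ∈ W) → W = ⊥ ∨ W = ⊤)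
    {N : Matrix (Fin n) (Fin n) ℂ} (hN : ∀ f, N * embedB d n (ρ f) = embedB d n (ρ f) * N)
    (hp : n = d + 1 ∨ psiTgen n d 0 1 0 * N = N * psiTgen n d 0 1 0) {Z D : Fin n}
    (hZ : (Z : ℕ) = 0) (hD : (D : ℕ) = d) :
    N = psiTgen n d (N Z Z) (N D D) (N.submatrix (tailIdx n d) (tailIdx n d)) := by
  obtain ⟨c, hc, hl⟩ := exists_scalar_block_of_commute hd hdn hirr hN
  have hp' : ∀ k : Fin (n - d - 1), N (tailIdx n d k) D = 0 ∧ N D (tailIdx n d k) = 0 := by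
    intro k
    rcases hp with h | h
    · have := k.2; omega
    · have hne : (tailIdx n d k : ℕ) ≠ d := fun h => not_tailIdx_le k h.le
      have h₁ := congrFun (congrFun h (tailIdx n d k)) D
      have h₂ := congrFun (congrFun h D) (tailIdx n d k)
      rw [psiTgen_zero_one_zero, Matrix.diagonal_mul, Matrix.mul_diagonal] at h₁ h₂
      simp only [hD, hne, if_true, if_false, zero_mul, mul_one, one_mul, mul_zero] at h₁ h₂
      exact ⟨h₁.symm, h₂⟩
  have hNZ : N Z Z = c := by simp [hc Z Z (by omega)]
  ext i j
  rw [hNZ]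
  rcases lt_trichotomy (i : ℕ) d with hi | hi | hi
  · rw [psiTgen_of_le hi.le, if_pos hi, hc i j hi]
  · obtain rfl : i = D := Fin.ext (hi.trans hD.symm)
    rw [psiTgen_of_le hi.le, if_neg hi.not_lt]
    rcases lt_trichotomy (j : ℕ) d with hj | hj | hj
    · rw [hl _ _ hi.ge hj, if_neg]
      rintro rfl; omega
    · obtain rfl : j = i := Fin.ext (hj.trans hi.symm)
      simp
    · obtain ⟨l, rfl⟩ := exists_tailIdx hj
      rw [(hp' l).2, if_neg]
      intro h; rw [← h] at hj; omega
  · obtain ⟨k, rfl⟩ := exists_tailIdx hi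
    rcases lt_trichotomy (j : ℕ) d with hj | hj | hj
    · rw [psiTgen_tailIdx_of_le _ hj.le, hl _ _ hi.le hj]
    · obtain rfl : j = D := Fin.ext (hj.trans hD.symm)
      rw [psiTgen_tailIdx_of_le _ hj.le, (hp' k).1]
    · obtain ⟨l, rfl⟩ := exists_tailIdx hj
      rw [psiTgen_tailIdx, Matrix.submatrix_apply]

end Commutant

section Gap

theorem rotEnt_pair_eq_zero {c τ μ x y : ℝ} (hc : μ ≠ c) (hμ : 0 < μ) (h0 : 0 < c)
    (h₁ : c * Real.cos τ * x - c * Real.sin τ * y = μ * x)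
    (h₂ : c * Real.sin τ * x + c * Real.cos τ * y = μ * y) : x = 0 ∧ y = 0 := by
  have hD : 0 < (c * Real.cos τ - μ) ^ 2 + (c * Real.sin τ) ^ 2 := by
    have h := Real.cos_le_one τ
    have h' := Real.sin_sq_add_cos_sq τ
    have h'' : 0 < (c - μ) ^ 2 := by
      have : c - μ ≠ 0 := sub_ne_zero.2 hc.symm
      positivity
    have hcμ : 0 ≤ c * μ * (1 - Real.cos τ) := mul_nonneg (by positivity) (sub_nonneg.2 h)
    have : (c * Real.cos τ - μ) ^ 2 + (c * Real.sin τ) ^ 2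
        = (c - μ) ^ 2 + 2 * (c * μ * (1 - Real.cos τ)) := by linear_combination c ^ 2 * h'
    linarith
  constructor
  · refine (mul_eq_zero.1 ?_).resolve_left hD.ne'
    linear_combination (c * Real.cos τ - μ) * h₁ + c * Real.sin τ * h₂
  · refine (mul_eq_zero.1 ?_).resolve_left hD.ne'
    linear_combination (c * Real.cos τ - μ) * h₂ - c * Real.sin τ * h₁

theorem eq_zero_of_rotEnt_eigen {m s : ℕ} {c ξ μ : ℝ} (hc : μ ≠ c) (hμ : 0 < μ) (h0 : 0 < c)
    (hm : 2 * s ≤ m) {M : Matrix (Fin m) (Fin m) ℝ}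
    (hM : ∀ i j : Fin m, (i : ℕ) < 2 * s → M i j = if (j : ℕ) < 2 * s then rotEnt c ξ i j else 0)
    {v : Fin m → ℝ} (hv : M.mulVec v = μ • v) {i : Fin m} (hi : (i : ℕ) < 2 * s) : v i = 0 := by
  obtain ⟨k, hk⟩ : ∃ k, (i : ℕ) / 2 = k := ⟨_, rfl⟩
  let a : Fin m := ⟨2 * k, by omega⟩
  let b : Fin m := ⟨2 * k + 1, by omega⟩
  have hab : a ≠ b := by simp [a, b]
  have ha : ∀ j : ℕ, (2 * k) / 2 = k ∧ (2 * k + 1) / 2 = k ∧ (2 * k) % 2 = 0 ∧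
    (2 * k + 1) % 2 ≠ 0 := fun j => by omega
  obtain ⟨e₁, e₂, e₃, e₄⟩ := ha 0
  have hrow : ∀ r : Fin m, (r : ℕ) / 2 = k → M r a * v a + M r b * v b = μ * v r := by
    intro r hr
    have h := congrFun hv r
    rw [Matrix.mulVec, dotProduct, Fintype.sum_eq_add a b hab] at h
    · simpa using h
    · intro x hx
      rw [hM r x (by omega)]
      split_ifs with hx'
      · rw [rotEnt, if_neg, zero_mul]
        intro h'
        have h₁ : (x : ℕ) ≠ 2 * k := fun h => hx.1 (Fin.ext h)
        have h₂ : (x : ℕ) ≠ 2 * k + 1 := fun h => hx.2 (Fin.ext h)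
        omega
      · rw [zero_mul]
  have ha' : (a : ℕ) < 2 * s := by simp only [a]; omega
  have hb' : (b : ℕ) < 2 * s := by simp only [b]; omega
  have h₁ := hrow a e₁
  have h₂ := hrow b e₂
  rw [hM a a ha', hM a b ha', if_pos ha', if_pos hb'] at h₁
  rw [hM b a hb', hM b b hb', if_pos ha', if_pos hb'] at h₂
  simp only [rotEnt, a, b, e₁, e₂, e₃, e₄, if_true, if_false] at h₁ h₂
  have h := rotEnt_pair_eq_zero (τ := ξ ^ (k + 1)) (x := v a) (y := v b) hc hμ h0
    (by simp only [a, b]; linear_combination h₁) (by simp only [a, b]; linear_combination h₂)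
  rcases (by omega : (i : ℕ) = 2 * k ∨ (i : ℕ) = 2 * k + 1) with h' | h'
  · rw [show i = a from Fin.ext h']; exact h.1
  · rw [show i = b from Fin.ext h']; exact h.2

theorem isUnit_det_Theta_sub {n d s : ℕ}
    (hcase : n = d + 1 ∨ n = d + 2 ∨ (n = 2 * s + d + 1 ∧ 1 ≤ s) ∨ (n = 2 * s + d + 2 ∧ 1 ≤ s))
    {ξ μ : ℝ} (hμ : 0 < μ) (hμ1 : μ < 1) (hμs : n = 2 * s + d + 2 → μ < ((4 : ℝ) ^ s)⁻¹) :
    IsUnit (Theta n d s ξ - μ • 1).det := by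
  rw [isUnit_iff_ne_zero]
  intro hdet
  obtain ⟨v, hv0, hv⟩ := Matrix.exists_mulVec_eq_zero_iff.2 hdet
  rw [Matrix.sub_mulVec, Matrix.smul_mulVec, Matrix.one_mulVec, sub_eq_zero] at hv
  refine hv0 (funext fun i => ?_)
  have hi := i.2
  rcases hcase with h | h | h | h
  · omega
  · have hT : Theta n d s ξ = 1 := by
      ext i j; simp [Theta, h, Matrix.one_apply]
    have := congrFun hv i
    rw [hT, Matrix.one_mulVec, Pi.smul_apply, smul_eq_mul] at this
    have h' : (1 - μ) * v i = 0 := by linear_combination this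
    exact (mul_eq_zero.1 h').resolve_left (by linarith)
  · have h1 : n ≠ d + 2 := by omega
    refine eq_zero_of_rotEnt_eigen (s := s) (c := 1) (ξ := ξ) hμ1.ne hμ one_pos (by omega)
      (fun i j _ => ?_) hv
      (by omega)
    have := j.2
    rw [if_pos (by omega), Theta, Matrix.of_apply, if_neg h1, if_pos h.1]
  · have h1 : n ≠ d + 2 := by omega
    have h2 : n ≠ 2 * s + d + 1 := by omega
    by_cases hi' : (i : ℕ) < 2 * s
    · refine eq_zero_of_rotEnt_eigen (s := s) (c := 2) (ξ := ξ) (by linarith) hμ two_pos (by omega)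
        (fun i j hi'' => ?_) hv hi'
      have := j.2
      rw [Theta, Matrix.of_apply, if_neg h1, if_neg h2]
      by_cases hj : (j : ℕ) < 2 * s
      · rw [if_neg (by omega), if_pos hj]
      · rw [if_pos (by omega), if_neg (by omega), if_neg hj]
    · have hi2 : (i : ℕ) = 2 * s := by omega
      have := congrFun hv i
      rw [Matrix.mulVec, dotProduct, Finset.sum_eq_single i] at this
      · rw [Theta, Matrix.of_apply, if_neg h1, if_neg h2, if_pos (Or.inl hi2), if_pos rfl,
          Pi.smul_apply, smul_eq_mul] at this
        have h' : (((4 : ℝ) ^ s)⁻¹ - μ) * v i = 0 := by linear_combination this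
        exact (mul_eq_zero.1 h').resolve_left (by linarith [hμs h.1])
      · intro j _ hj
        rw [Theta, Matrix.of_apply, if_neg h1, if_neg h2, if_pos (Or.inl hi2),
          if_neg (fun h => hj (Fin.ext h.symm)), zero_mul]
      · simp

end Gap

theorem exists_block_diagonalization_mem {𝔸 : Type*} [NormedRing 𝔸] [NormedAlgebra ℂ 𝔸]
    [FiniteDimensional ℂ 𝔸] {C : Subalgebra ℂ 𝔸} {p q N₀ S R : 𝔸} {μ : ℂ} (hpC : p ∈ C)
    (hqC : q ∈ C) (hN₀C : N₀ ∈ C) (hSC : S ∈ C) (hRC : R ∈ C) (hpq : p + q = 1) (hp : p * p = p)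
    (hl : N₀ * p = μ • p) (hr : p * N₀ = μ • p) (hS : S = N₀ - μ • 1 + p)
    (hSR : S * R = 1) (hRS : R * S = 1) {ε : ℝ} (hε : 0 < ε) :
    ∃ r : ℝ, 0 < r ∧ ∀ M ∈ C, ‖M - N₀‖ < r →
      ∃ v : 𝔸ˣ, ∃ N : 𝔸, (v : 𝔸) ∈ C ∧ N ∈ C ∧ ‖(v : 𝔸) - 1‖ < ε ∧
        ‖((v⁻¹ : 𝔸ˣ) : 𝔸) - 1‖ < ε ∧ ‖N - N₀‖ < ε ∧ p * N = N * p ∧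
        M = v * N * ((v⁻¹ : 𝔸ˣ) : 𝔸) := by
  have := FiniteDimensional.complete ℂ C
  obtain ⟨r, hr, h⟩ := Metric.eventually_nhds_iff.1 (block_diagonalization_near (𝔸 := C)
    (p := ⟨p, hpC⟩) (q := ⟨q, hqC⟩) (N₀ := ⟨N₀, hN₀C⟩) (S := ⟨S, hSC⟩) (R := ⟨R, hRC⟩) (μ := μ)
    (Subtype.ext hpq) (Subtype.ext hp) (Subtype.ext hl) (Subtype.ext hr) (Subtype.ext hS)
    (Subtype.ext hSR) (Subtype.ext hRS) hε)
  refine ⟨r, hr, fun M hM hMr => ?_⟩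
  obtain ⟨v, N, hv, hv', hN, hpN, hMN⟩ := h (y := ⟨M, hM⟩) (by rwa [dist_eq_norm])
  exact ⟨Units.map (C.val : C →* 𝔸) v, N, (v : C).2, N.2, hv, hv', hN,
    congrArg Subtype.val hpN, congrArg Subtype.val hMN⟩

section NormalForm

variable {F : Type*} {n d : ℕ} {ρ : F → Matrix (Fin d) (Fin d) ℂ}

theorem exists_conj_psiTgen_of_commute (hd : 2 ≤ d) (hdn : d + 1 ≤ n)
    (hirr : ∀ W : Submodule ℂ (Fin d → ℂ), (∀ f, ∀ w ∈ W, (ρ f).mulVec w ∈ W) → W = ⊥ ∨ W = ⊤)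
    {l μ : ℂ} {T : Matrix (Fin (n - d - 1)) (Fin (n - d - 1)) ℂ} (hl : l ≠ μ)
    (hT : IsUnit (T - μ • 1).det) {ε : ℝ} (hε : 0 < ε) :
    ∃ r : ℝ, 0 < r ∧ (n = d + 1 → r = ε) ∧ ∀ M : Matrix (Fin n) (Fin n) ℂ,
      (∀ f, M * embedB d n (ρ f) = embedB d n (ρ f) * M) → ‖M - psiTgen n d l μ T‖ < r →
      ∃ v : (Matrix (Fin n) (Fin n) ℂ)ˣ,
        ‖(v : Matrix (Fin n) (Fin n) ℂ) - 1‖ < ε ∧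
        ‖((v⁻¹ : _) : Matrix (Fin n) (Fin n) ℂ) - 1‖ < ε ∧
        (∀ f, (v : Matrix (Fin n) (Fin n) ℂ) * embedB d n (ρ f) = embedB d n (ρ f) * v) ∧
        ∃ a b T', ‖psiTgen n d a b T' - psiTgen n d l μ T‖ < ε ∧
          M = (v : Matrix (Fin n) (Fin n) ℂ) * psiTgen n d a b T' *
            ((v⁻¹ : _) : Matrix (Fin n) (Fin n) ℂ) := by
  let Z : Fin n := ⟨0, by omega⟩
  let D : Fin n := ⟨d, by omega⟩
  by_cases hnd : n = d + 1
  · refine ⟨ε, hε, fun _ => rfl, fun M hM hMr => ⟨1, by simpa, by simpa, by simp, ?_⟩⟩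
    have h := eq_psiTgen_of_commute hd (by omega) hirr hM (Or.inl hnd) (Z := Z) (D := D) rfl rfl
    exact ⟨_, _, _, h ▸ hMr, by simpa using h⟩
  let C : Subalgebra ℂ (Matrix (Fin n) (Fin n) ℂ) :=
    Subalgebra.centralizer ℂ (Set.range fun f => embedB d n (ρ f))
  have memC : ∀ M : Matrix (Fin n) (Fin n) ℂ,
      M ∈ C ↔ ∀ f, M * embedB d n (ρ f) = embedB d n (ρ f) * M := fun M => by
    simp only [C, Subalgebra.mem_centralizer_iff, Set.forall_mem_range, eq_comm]
  have hpsi : ∀ a b T', psiTgen n d a b T' ∈ C := fun a b T' =>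
    (memC _).2 fun f => psiTgen_commute_embedB a b T' _ (by omega)
  have hlμ : l - μ ≠ 0 := sub_ne_zero.2 hl
  obtain ⟨r, hr, h⟩ := exists_block_diagonalization_mem (C := C) (hpsi 0 1 0) (hpsi 1 0 1)
    (hpsi l μ T) (hpsi (l - μ) 1 (T - μ • 1)) (hpsi (l - μ)⁻¹ 1 (T - μ • 1)⁻¹) (μ := μ)
    (by simp [psiTgen_add, psiTgen_one])
    (by simp [psiTgen_mul])
    (by simp [psiTgen_mul, psiTgen_smul])
    (by simp [psiTgen_mul, psiTgen_smul])
    (by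
      rw [sub_add_eq_add_sub, eq_sub_iff_add_eq, psiTgen_add, ← psiTgen_one (n := n) (d := d),
        psiTgen_smul, psiTgen_add]
      simp [add_comm])
    (by simp [psiTgen_mul, psiTgen_one, hlμ, Matrix.mul_nonsing_inv _ hT])
    (by simp [psiTgen_mul, psiTgen_one, hlμ, Matrix.nonsing_inv_mul _ hT]) hε
  refine ⟨r, hr, fun h => absurd h hnd, fun M hM hMr => ?_⟩
  obtain ⟨v, N, hvC, hNC, hv, hv', hN, hpN, hMN⟩ := h M ((memC M).2 hM) hMr
  have hN' := eq_psiTgen_of_commute hd (by omega) hirr ((memC N).1 hNC) (Or.inr hpN)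
    (Z := Z) (D := D) rfl rfl
  exact ⟨v, hv, hv', (memC _).1 hvC, _, _, _, hN' ▸ hN, hN' ▸ hMN⟩

end NormalForm

section Units

variable {𝔸 : Type*} [NormedRing 𝔸]

theorem norm_units_inv_le (h1 : ‖(1 : 𝔸)‖ ≤ 1) {w : 𝔸ˣ} {r : ℝ} (hr : r ≤ 1 / 2)
    (hw : ‖(w : 𝔸) - 1‖ < r) :
    ‖((w⁻¹ : 𝔸ˣ) : 𝔸)‖ ≤ 2 ∧ ‖((w⁻¹ : 𝔸ˣ) : 𝔸) - 1‖ ≤ 2 * r := by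
  have h : ((w⁻¹ : 𝔸ˣ) : 𝔸) - 1 = -(((w⁻¹ : 𝔸ˣ) : 𝔸) * ((w : 𝔸) - 1)) := by
    rw [mul_sub, Units.inv_mul, mul_one, neg_sub]
  have hle : ‖((w⁻¹ : 𝔸ˣ) : 𝔸) - 1‖ ≤ ‖((w⁻¹ : 𝔸ˣ) : 𝔸)‖ * r := by
    rw [h, norm_neg]
    exact (norm_mul_le _ _).trans (by gcongr)
  have h2 : ‖((w⁻¹ : 𝔸ˣ) : 𝔸)‖ ≤ 2 := by
    have := norm_add_le (((w⁻¹ : 𝔸ˣ) : 𝔸) - 1) 1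
    rw [sub_add_cancel] at this
    have := mul_le_mul_of_nonneg_left hr (norm_nonneg ((w⁻¹ : 𝔸ˣ) : 𝔸))
    linarith
  have hr0 : 0 ≤ r := (norm_nonneg _).trans hw.le
  exact ⟨h2, hle.trans (by gcongr)⟩

theorem norm_conj_sub_le (h1 : ‖(1 : 𝔸)‖ ≤ 1) {w : 𝔸ˣ} {r : ℝ} (hr : r ≤ 1 / 2)
    (hw : ‖(w : 𝔸) - 1‖ < r) {T N : 𝔸} (hT : ‖T - N‖ < r) (hN : 1 ≤ ‖N‖) :
    ‖((w⁻¹ : 𝔸ˣ) : 𝔸) * T * w - N‖ ≤ 10 * r * ‖N‖ := by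
  obtain ⟨h2, -⟩ := norm_units_inv_le h1 hr hw
  have hr0 : 0 ≤ r := (norm_nonneg _).trans hw.le
  have h : ((w⁻¹ : 𝔸ˣ) : 𝔸) * T * w - N =
      ((w⁻¹ : 𝔸ˣ) : 𝔸) * ((T - N) * w + (N * (w - 1) - (w - 1) * N)) := by
    have : (T - N) * w + (N * (w - 1) - (w - 1) * N) = T * w - w * N := by noncomm_ring
    rw [this, mul_sub, mul_assoc, ← mul_assoc _ (w : 𝔸) N, Units.inv_mul, one_mul]
  have hw2 : ‖(w : 𝔸)‖ ≤ 2 := by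
    have := norm_add_le ((w : 𝔸) - 1) 1
    rw [sub_add_cancel] at this
    linarith
  have e1 : ‖(T - N) * w‖ ≤ r * 2 := (norm_mul_le _ _).trans (by gcongr)
  have e2 : ‖N * ((w : 𝔸) - 1)‖ ≤ ‖N‖ * r := (norm_mul_le _ _).trans (by gcongr)
  have e3 : ‖((w : 𝔸) - 1) * N‖ ≤ r * ‖N‖ := (norm_mul_le _ _).trans (by gcongr)
  have e4 := norm_add_le ((T - N) * w) (N * ((w : 𝔸) - 1) - (w - 1) * N)
  have e5 := norm_sub_le (N * ((w : 𝔸) - 1)) ((w - 1) * N)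
  have e6 := mul_le_mul_of_nonneg_left hN hr0
  rw [h]
  calc _ ≤ 2 * (4 * r * ‖N‖) := (norm_mul_le _ _).trans (by gcongr; linarith)
    _ ≤ _ := by have := mul_nonneg hr0 (norm_nonneg N); linarith

theorem norm_mul_sub_one_le (h1 : ‖(1 : 𝔸)‖ ≤ 1) {a b : 𝔸} {x y : ℝ} (hx : ‖a - 1‖ ≤ x)
    (hy : ‖b - 1‖ ≤ y) : ‖a * b - 1‖ ≤ x * (1 + y) + y := by
  have h : a * b - 1 = (a - 1) * b + (b - 1) := by noncomm_ring
  have hb : ‖b‖ ≤ 1 + y := by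
    have := norm_add_le (b - 1) 1
    rw [sub_add_cancel] at this
    linarith
  have hx0 := (norm_nonneg _).trans hx
  rw [h]
  exact (norm_add_le _ _).trans (add_le_add ((norm_mul_le _ _).trans (by gcongr)) hy)

end Units

section Averaging

variable {R : Type*} [CommRing R] {n d : ℕ}

theorem embedB_mul (hdn : d ≤ n) (g h : Matrix (Fin d) (Fin d) R) :
    embedB d n g * embedB d n h = embedB d n (g * h) := by
  ext i j
  rw [Matrix.mul_apply]
  by_cases hi : (i : ℕ) < d
  · obtain ⟨k, rfl⟩ : ∃ k : Fin d, i = Fin.castLE hdn k := ⟨⟨i, hi⟩, rfl⟩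
    rw [embedB_castLE_sum]
    by_cases hj : (j : ℕ) < d
    · simp [embedB, hj, Matrix.mulVec, dotProduct, Matrix.mul_apply]
    · simp [embedB, hj, Matrix.mulVec, dotProduct]
  · simp [embedB_of_le _ (not_lt.1 hi)]

theorem embedB_one : embedB d n (1 : Matrix (Fin d) (Fin d) R) = 1 := by
  ext i j
  simp only [embedB, Matrix.of_apply, Matrix.one_apply, Fin.ext_iff]
  split_ifs <;> first | rfl | omega

end Averaging

/-- Sufficiently close homomorphisms from a finite group are conjugate by a unit near `1`. -/
theorem exists_conj_of_near {F 𝔸 : Type*} [Group F] [Fintype F] [NormedRing 𝔸] [NormedAlgebra ℂ 𝔸]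
    [CompleteSpace 𝔸] (E : F →* 𝔸) {θ : ℝ} (hθ : 0 < θ) :
    ∃ δ : ℝ, 0 < δ ∧ ∀ φ : F →* 𝔸, (∀ f, ‖φ f - E f‖ < δ) →
      ∃ w : 𝔸ˣ, ‖(w : 𝔸) - 1‖ < θ ∧ ∀ f, φ f = w * E f * ((w⁻¹ : 𝔸ˣ) : 𝔸) := by
  have hm : 0 < min θ 1 := lt_min hθ one_pos
  set K : ℝ := 1 + ∑ f, ‖E f‖ with hK
  have hKpos : 0 < K := by positivity
  refine ⟨min θ 1 / K, by positivity, fun φ hφ => ?_⟩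
  set w : 𝔸 := (Fintype.card F : ℂ)⁻¹ • ∑ f, φ f * E f⁻¹ with hw
  have hcard : (Fintype.card F : ℂ) ≠ 0 := by simp
  have hw1 : w - 1 = (Fintype.card F : ℂ)⁻¹ • ∑ f, (φ f - E f) * E f⁻¹ := by
    simp only [sub_mul, Finset.sum_sub_distrib, smul_sub, ← map_mul, mul_inv_cancel, map_one]
    simp [← Nat.cast_smul_eq_nsmul ℂ, smul_smul, hcard, hw]
  have hlt : ‖w - 1‖ < min θ 1 := by
    have hcardR : (1 : ℝ) ≤ Fintype.card F := by exact_mod_cast Fintype.card_pos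
    have hs : ‖∑ f, (φ f - E f) * E f⁻¹‖ ≤ min θ 1 / K * ∑ f, ‖E f‖ := by
      rw [Finset.mul_sum, ← Equiv.sum_comp (Equiv.inv F) (fun f => min θ 1 / K * ‖E f‖)]
      exact norm_sum_le_of_le _ fun f _ => (norm_mul_le _ _).trans (by gcongr; exact (hφ f).le; rfl)
    calc ‖w - 1‖ ≤ ‖∑ f, (φ f - E f) * E f⁻¹‖ := by
          rw [hw1, norm_smul, norm_inv, Complex.norm_natCast]
          exact mul_le_of_le_one_left (norm_nonneg _) (inv_le_one_of_one_le₀ hcardR)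
      _ ≤ min θ 1 / K * ∑ f, ‖E f‖ := hs
      _ < min θ 1 / K * K := by gcongr; linarith
      _ = min θ 1 := div_mul_cancel₀ _ hKpos.ne'
  have hinter : ∀ g, φ g * w = w * E g := fun g => by
    rw [hw, mul_smul_comm, smul_mul_assoc, Finset.mul_sum, Finset.sum_mul,
      ← Equiv.sum_comp (Equiv.mulLeft g) (fun f => φ f * E f⁻¹ * E g)]
    congr 1
    refine Finset.sum_congr rfl fun f _ => ?_
    simp only [Equiv.coe_mulLeft, map_mul, mul_inv_rev, mul_assoc]
    rw [← map_mul E g⁻¹ g, inv_mul_cancel, map_one, mul_one]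
  let u : 𝔸ˣ := Units.oneSub (1 - w)
    (by rw [← norm_neg, neg_sub]; exact hlt.trans_le (min_le_right _ _))
  have hu : (u : 𝔸) = w := by simp [u]
  refine ⟨u, by rw [hu]; exact hlt.trans_le (min_le_left _ _), fun f => ?_⟩
  rw [Units.eq_mul_inv_iff_mul_eq, hu, hinter]

theorem zpow_neg_natCast_bounds {d n : ℕ} (hd : 2 ≤ d) (hn : 0 < n) {lam : ℝ}
    (hlam : (8 : ℝ) ^ n ≤ lam) :
    1 < lam ∧ 0 < lam ^ (-(d : ℤ)) ∧ lam ^ (-(d : ℤ)) < 1 ∧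
      ∀ s < n, lam ^ (-(d : ℤ)) < ((4 : ℝ) ^ s)⁻¹ := by
  have h1 : (1 : ℝ) < 8 ^ n := one_lt_pow₀ (by norm_num) hn.ne'
  have h3 : lam ≤ lam ^ d := le_self_pow₀ (by linarith) (by omega)
  have h4 : ∀ s < n, lam ^ (-(d : ℤ)) < ((4 : ℝ) ^ s)⁻¹ := fun s hs => by
    have h2 : (4 : ℝ) ^ s < 8 ^ n :=
      (pow_le_pow_left₀ (by norm_num) (by norm_num) s).trans_lt
        (pow_lt_pow_right₀ (by norm_num) hs)
    rw [zpow_neg, zpow_natCast]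
    exact inv_strictAnti₀ (by positivity) (by linarith)
  exact ⟨by linarith, zpow_pos (by linarith) _, by simpa using h4 0 hn, h4⟩

theorem isUnit_det_Theta_map_sub {n d s : ℕ}
    (hcase : n = d + 1 ∨ n = d + 2 ∨ (n = 2 * s + d + 1 ∧ 1 ≤ s) ∨ (n = 2 * s + d + 2 ∧ 1 ≤ s))
    {ξ μ : ℝ} (hμ : 0 < μ) (hμ1 : μ < 1) (hμs : n = 2 * s + d + 2 → μ < ((4 : ℝ) ^ s)⁻¹) :
    IsUnit ((Theta n d s ξ).map Complex.ofReal - (μ : ℂ) • 1).det := by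
  have h := (isUnit_det_Theta_sub (ξ := ξ) hcase hμ hμ1 hμs).map Complex.ofRealHom
  rw [RingHom.map_det] at h
  convert h
  ext i j
  by_cases hij : i = j <;> simp [hij]

theorem norm_sub_of_psiTgen {n d : ℕ} (hd : 0 < d) (hn : d + 1 ≤ n) {a b a' b' : ℂ}
    {T T' : Matrix (Fin (n - d - 1)) (Fin (n - d - 1)) ℂ} :
    ‖a - a'‖ ≤ ‖psiTgen n d a b T - psiTgen n d a' b' T'‖ ∧
    ‖b - b'‖ ≤ ‖psiTgen n d a b T - psiTgen n d a' b' T'‖ ∧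
    ‖T - T'‖ ≤ ‖psiTgen n d a b T - psiTgen n d a' b' T'‖ := by
  refine ⟨?_, ?_, ?_⟩
  · simpa [psiTgen, hd] using norm_entry_le_l2_opNorm
      (psiTgen n d a b T - psiTgen n d a' b' T') ⟨0, by omega⟩ ⟨0, by omega⟩
  · simpa [psiTgen] using norm_entry_le_l2_opNorm
      (psiTgen n d a b T - psiTgen n d a' b' T') ⟨d, by omega⟩ ⟨d, by omega⟩
  · convert l2_opNorm_submatrix_le tailIdx_injective (psiTgen n d a b T - psiTgen n d a' b' T')
    ext i j
    simp [psiTgen_tailIdx]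

/-- Lemma on local rigidity of `ℤ × F`: with `ψ : ℤ × F → GL_n(ℝ)` as in the
construction, for every `0 < θ < 1` there is `θ' > 0` (equal to `θ/(10⁴·‖ψ(t)‖)` when
`n = d+1`) such that (a) `Ψ_{θ'}` is a neighborhood of `ψ` among homomorphisms into
`GL_n(ℂ)`, and (b) every `φ ∈ Ψ_{θ'}` is simultaneously conjugate, by some `w_φ` with
`‖w_φ^{±1} − I‖ < θ`, to a standard form `diag(λ₁·I_d, λ₂, Θ')` on `t` and to `ψ` on `F`. -/
theorem stmt8 {F : Type*} [Group F] [Fintype F] (d : ℕ) (hd : 2 ≤ d)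
    (ψ₀ : F →* (Matrix (Fin d) (Fin d) ℝ)ˣ) (hinj : Function.Injective ψ₀)
    (horth : ∀ f : F, (ψ₀ f : Matrix (Fin d) (Fin d) ℝ).transpose * (ψ₀ f : Matrix (Fin d) (Fin d) ℝ) = 1)
    (hirr : ∀ W : Submodule ℂ (Fin d → ℂ),
      (∀ (f : F), ∀ w ∈ W,
        ((ψ₀ f : Matrix (Fin d) (Fin d) ℝ).map Complex.ofReal).mulVec w ∈ W) →
      W = ⊥ ∨ W = ⊤)
    (n s : ℕ) (hn : d + 1 ≤ n)
    (hcase : n = d + 1 ∨ n = d + 2 ∨ (n = 2 * s + d + 1 ∧ 1 ≤ s) ∨ (n = 2 * s + d + 2 ∧ 1 ≤ s))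
    (ξ : ℝ) (hξ : 0 < ξ) (halg : AlgebraicIndependent ℚ ![Real.pi, ξ])
    (lam : ℝ) (hlam : (8 : ℝ) ^ n ≤ lam) :
    ∀ θ : ℝ, 0 < θ → θ < 1 →
      ∃ θ' : ℝ, 0 < θ' ∧
        -- when n = d+1 one may take θ' = θ/(10⁴·‖ψ(t)‖)
        (n = d + 1 → θ' = θ / (10 ^ 4 *
          opN ((psiTgen n d lam (lam ^ (-(d : ℤ))) (Theta n d s ξ)).map Complex.ofReal))) ∧
        -- (a) Ψ_{θ'} contains a neighborhood of ψ
        (∃ δ : ℝ, 0 < δ ∧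
          ∀ φ : Multiplicative ℤ × F →* (Matrix (Fin n) (Fin n) ℂ)ˣ,
            opN ((φ (Multiplicative.ofAdd (1 : ℤ), 1) : Matrix (Fin n) (Fin n) ℂ) -
              (psiTgen n d lam (lam ^ (-(d : ℤ))) (Theta n d s ξ)).map Complex.ofReal) < δ →
            (∀ f : F, opN ((φ (1, f) : Matrix (Fin n) (Fin n) ℂ) -
              (embedB d n (ψ₀ f : Matrix (Fin d) (Fin d) ℝ)).map Complex.ofReal) < δ) →
            memPsi n d s ψ₀ lam ξ θ' φ) ∧
        -- (b) normal form for the elements of Ψ_{θ'}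
        (∀ φ : Multiplicative ℤ × F →* (Matrix (Fin n) (Fin n) ℂ)ˣ,
          memPsi n d s ψ₀ lam ξ θ' φ →
          ∃ wφ : (Matrix (Fin n) (Fin n) ℂ)ˣ,
            opN ((wφ : Matrix (Fin n) (Fin n) ℂ) - 1) < θ ∧
            opN (((wφ⁻¹ : _) : Matrix (Fin n) (Fin n) ℂ) - 1) < θ ∧
            ∃ lam₁ lam₂ : ℂ, ‖lam₁ - (lam : ℂ)‖ < θ ∧ ‖lam₂ - (lam : ℂ) ^ (-(d : ℤ))‖ < θ ∧
              ∃ Θ' : Matrix (Fin (n - d - 1)) (Fin (n - d - 1)) ℂ,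
                opN (Θ' - (Theta n d s ξ).map Complex.ofReal) < θ ∧
                (φ (Multiplicative.ofAdd (1 : ℤ), 1) : Matrix (Fin n) (Fin n) ℂ) =
                  (wφ : Matrix (Fin n) (Fin n) ℂ) * psiTgen n d lam₁ lam₂ Θ' *
                    ((wφ⁻¹ : _) : Matrix (Fin n) (Fin n) ℂ) ∧
                ∀ f : F, (φ (1, f) : Matrix (Fin n) (Fin n) ℂ) =
                  (wφ : Matrix (Fin n) (Fin n) ℂ) *
                    (embedB d n (ψ₀ f : Matrix (Fin d) (Fin d) ℝ)).map Complex.ofReal *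
                      ((wφ⁻¹ : _) : Matrix (Fin n) (Fin n) ℂ)) := by
  intro θ hθ hθ1
  obtain ⟨hlam1, hμ0, hμ1, hμs⟩ := zpow_neg_natCast_bounds hd (by omega) hlam
  set μ : ℝ := lam ^ (-(d : ℤ)) with hμ
  have hμC : (lam : ℂ) ^ (-(d : ℤ)) = (μ : ℂ) := by rw [hμ, Complex.ofReal_zpow]
  simp only [memPsi, opN_eq_norm, ← hμ, hμC]
  set ρ : F → Matrix (Fin d) (Fin d) ℂ := fun f =>
    (ψ₀ f : Matrix (Fin d) (Fin d) ℝ).map Complex.ofReal with hρ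
  set T : Matrix (Fin (n - d - 1)) (Fin (n - d - 1)) ℂ := (Theta n d s ξ).map Complex.ofReal
  have hN₀ : (psiTgen n d lam μ (Theta n d s ξ)).map Complex.ofReal =
      psiTgen n d (lam : ℂ) (μ : ℂ) T := psiTgen_map Complex.ofRealHom _ _ _
  have hE : ∀ f, (embedB d n (ψ₀ f : Matrix (Fin d) (Fin d) ℝ)).map Complex.ofReal =
      embedB d n (ρ f) := fun f => embedB_map Complex.ofRealHom _
  simp only [hN₀, hE]
  set N₀ : Matrix (Fin n) (Fin n) ℂ := psiTgen n d (lam : ℂ) (μ : ℂ) T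
  have hone : ‖(1 : Matrix (Fin n) (Fin n) ℂ)‖ ≤ 1 := l2_opNorm_one_le
  have hN₀1 : 1 ≤ ‖N₀‖ := by
    have h := norm_entry_le_l2_opNorm N₀ ⟨0, by omega⟩ ⟨0, by omega⟩
    have h0 : N₀ ⟨0, by omega⟩ ⟨0, by omega⟩ = (lam : ℂ) := by
      simp [N₀, psiTgen, (by omega : 0 < d)]
    rw [h0, Complex.norm_real, Real.norm_of_nonneg (by linarith)] at h
    linarith
  obtain ⟨r, hr, hr1, hr2⟩ := exists_conj_psiTgen_of_commute (n := n) hd hn hirr (l := (lam : ℂ))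
    (μ := (μ : ℂ)) (T := T) (by exact_mod_cast (hμ1.trans hlam1).ne')
    (isUnit_det_Theta_map_sub hcase hμ0 hμ1 fun h => hμs s (by omega)) (ε := θ / 10) (by positivity)
  set m : ℝ := min θ (10 * r)
  have hm : 0 < m := lt_min hθ (by positivity)
  have hmθ : m ≤ θ := min_le_left _ _
  have hmr : m ≤ 10 * r := min_le_right _ _
  set θ' : ℝ := m / (10 ^ 4 * ‖N₀‖) with hθ'
  have hθ'0 : 0 < θ' := by positivity
  have hθ'N : 10 ^ 4 * (θ' * ‖N₀‖) = m := by rw [hθ']; field_simp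
  have hθ'm : 10 ^ 4 * θ' ≤ m := by
    have := mul_le_mul_of_nonneg_left hN₀1 hθ'0.le
    linarith
  refine ⟨θ', hθ'0, fun h => ?_, ?_, ?_⟩
  · rw [hθ', show m = θ from min_eq_left (by rw [hr1 h]; linarith)]
  · let E : F →* Matrix (Fin n) (Fin n) ℂ :=
      { toFun := fun f => embedB d n (ρ f)
        map_one' := by
          rw [← hE, map_one, Units.val_one, embedB_one]
          exact Matrix.map_one _ Complex.ofReal_zero Complex.ofReal_one
        map_mul' := fun f g => by
          rw [embedB_mul (by omega), ← hE, map_mul, Units.val_mul]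
          exact (embedB_map Complex.ofRealHom _).trans
            (congrArg _ (Matrix.map_mul (f := Complex.ofRealHom))) }
    obtain ⟨δ, hδ, h⟩ := exists_conj_of_near E hθ'0
    refine ⟨min δ θ', lt_min hδ hθ'0, fun φ ht hf => ?_⟩
    obtain ⟨w, hw, hwE⟩ := h ((Units.coeHom _).comp (φ.comp (MonoidHom.inr _ F)))
      fun f => (hf f).trans_le (min_le_left _ _)
    exact ⟨w, hw, hwE, ht.trans_le (min_le_right _ _)⟩
  · rintro φ ⟨w, hw, hwE, hwt⟩
    have hθ'2 : θ' ≤ 1 / 2 := by linarith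
    have hw' := (norm_units_inv_le hone hθ'2 hw).2
    obtain ⟨v, hv, hv', hvE, a, b, T', hT', hM⟩ := hr2
      (((w⁻¹ : _) : Matrix (Fin n) (Fin n) ℂ) *
        (φ (Multiplicative.ofAdd (1 : ℤ), 1) : Matrix (Fin n) (Fin n) ℂ) * w)
      (fun f => by
        have hc : (φ (Multiplicative.ofAdd (1 : ℤ), 1) : Matrix (Fin n) (Fin n) ℂ) * φ (1, f) =
            φ (1, f) * φ (Multiplicative.ofAdd (1 : ℤ), 1) := by
          rw [← Units.val_mul, ← Units.val_mul, ← map_mul, ← map_mul]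
          simp
        have hEf : embedB d n (ρ f) = ((w⁻¹ : _) : Matrix (Fin n) (Fin n) ℂ) *
            (φ (1, f) : Matrix (Fin n) (Fin n) ℂ) * w := by
          rw [hwE f]
          simp [mul_assoc]
        rw [hEf]
        simp only [mul_assoc, Units.mul_inv_cancel_left]
        rw [← mul_assoc (φ _ : Matrix (Fin n) (Fin n) ℂ), hc, mul_assoc])
      ((norm_conj_sub_le hone hθ'2 hw hwt hN₀1).trans_lt (by linarith))
    obtain ⟨ha, hb, hT⟩ := norm_sub_of_psiTgen (by omega) hn (a := a) (b := b) (T := T')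
      (a' := (lam : ℂ)) (b' := (μ : ℂ)) (T' := T)
    refine ⟨w * v, ?_, ?_, a, b, by linarith, by linarith, T', by linarith, ?_, fun f => ?_⟩
    · rw [Units.val_mul]
      refine (norm_mul_sub_one_le hone hw.le hv.le).trans_lt ?_
      nlinarith
    · rw [mul_inv_rev, Units.val_mul]
      refine (norm_mul_sub_one_le hone hv'.le hw').trans_lt ?_
      nlinarith
    · rw [mul_inv_rev, Units.val_mul, Units.val_mul]
      calc (φ (Multiplicative.ofAdd (1 : ℤ), 1) : Matrix (Fin n) (Fin n) ℂ)
          = w * (((w⁻¹ : _) : Matrix (Fin n) (Fin n) ℂ) *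
            (φ (Multiplicative.ofAdd (1 : ℤ), 1) : Matrix (Fin n) (Fin n) ℂ) * w) *
            ((w⁻¹ : _) : Matrix (Fin n) (Fin n) ℂ) := by simp [mul_assoc]
        _ = _ := by rw [hM]; simp only [mul_assoc]
    · rw [hwE f, mul_inv_rev, Units.val_mul, Units.val_mul,
        mul_assoc (w : Matrix (Fin n) (Fin n) ℂ) (v : Matrix (Fin n) (Fin n) ℂ),
        hvE f]
      simp only [mul_assoc, Units.mul_inv_cancel_left]
      rfl
end
end

section
/- Let k be a field equipped with a nonarchimedean absolute value |·|, let n ≥ 1, and let C, C' be n×n matrices over k with ‖C'‖ ≤ ‖C‖ and ‖C‖ ≥ 1. Then for every 0 ≤ j ≤ n, the coefficients of t^j in the characteristic polynomials χ_C(t) = det(t·I − C) and χ_{C'}(t) = det(t·I − C') differ in absolute value by at most ‖C − C'‖ · ‖C‖^{n−1}; that is, ‖χ_C − χ_{C'}‖ ≤ ‖C − C'‖ · ‖C‖^{n−1}. -/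
noncomputable section

/-- The sup-of-entries norm of a square matrix, with respect to an absolute value `v`. -/
def matNormAbs {k : Type*} [Field k] (v : AbsoluteValue k ℝ) {n : ℕ}
    (A : Matrix (Fin n) (Fin n) k) : ℝ :=
  ⨆ i, ⨆ j, v (A i j)

open Polynomial in
/-- The coefficients of `p` are bounded by `r` in absolute value. -/
def CoeffsBounded {k : Type*} [Field k] (v : AbsoluteValue k ℝ) (r : ℝ) (p : k[X]) : Prop :=
  ∀ j, v (p.coeff j) ≤ r

namespace CoeffsBounded

open Polynomial

variable {k : Type*} [Field k] {v : AbsoluteValue k ℝ} {r s : ℝ} {p q : k[X]}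

theorem zero (hr : 0 ≤ r) : CoeffsBounded v r (0 : k[X]) := fun j => by simpa using hr

theorem neg (hp : CoeffsBounded v r p) : CoeffsBounded v r (-p) := fun j => by
  simpa using hp j

theorem const {a : k} (ha : v a ≤ r) : CoeffsBounded v r (C a) := fun j => by
  rw [coeff_C]
  split_ifs
  · exact ha
  · simpa using (v.nonneg a).trans ha

theorem X_of_one_le (hr : 1 ≤ r) : CoeffsBounded v r (X : k[X]) := fun j => by
  rw [coeff_X]
  split_ifs
  · simpa using hr
  · simpa using zero_le_one.trans hr

theorem add (hna : ∀ x y : k, v (x + y) ≤ max (v x) (v y))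
    (hp : CoeffsBounded v r p) (hq : CoeffsBounded v r q) : CoeffsBounded v r (p + q) := fun j => by
  rw [coeff_add]
  exact (hna _ _).trans (max_le (hp j) (hq j))

theorem sum (hna : ∀ x y : k, v (x + y) ≤ max (v x) (v y)) (hr : 0 ≤ r) {ι : Type*}
    {t : Finset ι} {f : ι → k[X]} (hf : ∀ i ∈ t, CoeffsBounded v r (f i)) :
    CoeffsBounded v r (∑ i ∈ t, f i) :=
  Finset.sum_induction f (CoeffsBounded v r) (fun _ _ => add hna) (zero hr) hf

theorem mul (hna : ∀ x y : k, v (x + y) ≤ max (v x) (v y)) (hr : 0 ≤ r) (hs : 0 ≤ s)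
    (hp : CoeffsBounded v r p) (hq : CoeffsBounded v s q) :
    CoeffsBounded v (r * s) (p * q) := fun j => by
  rw [coeff_mul]
  refine Finset.sum_induction _ (fun x => v x ≤ r * s)
    (fun x y hx hy => (hna x y).trans (max_le hx hy)) (by simpa using mul_nonneg hr hs) ?_
  intro x _
  rw [map_mul]
  exact mul_le_mul (hp _) (hq _) (v.nonneg _) hr

theorem prod (hna : ∀ x y : k, v (x + y) ≤ max (v x) (v y)) (hr : 0 ≤ r) {ι : Type*}
    (t : Finset ι) {f : ι → k[X]} (hf : ∀ i, CoeffsBounded v r (f i)) :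
    CoeffsBounded v (r ^ t.card) (∏ i ∈ t, f i) := by
  classical
  induction t using Finset.induction_on with
  | empty => simpa using const (v := v) (a := 1) (r := 1) (by simp)
  | insert a t ha ih =>
    rw [Finset.prod_insert ha, Finset.card_insert_of_notMem ha, pow_succ']
    exact mul hna hr (pow_nonneg hr _) (hf a) ih

theorem prod_sub_prod (hna : ∀ x y : k, v (x + y) ≤ max (v x) (v y)) (hr : 0 < r) (hs : 0 ≤ s)
    {ι : Type*} (t : Finset ι) {f g : ι → k[X]} (hf : ∀ i, CoeffsBounded v r (f i))
    (hg : ∀ i, CoeffsBounded v r (g i)) (hfg : ∀ i, CoeffsBounded v s (f i - g i)) :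
    CoeffsBounded v (s * (r ^ t.card / r)) (∏ i ∈ t, f i - ∏ i ∈ t, g i) := by
  classical
  induction t using Finset.induction_on with
  | empty => simpa using zero (v := v) (by positivity : 0 ≤ s * r⁻¹)
  | insert a t ha ih =>
    rw [Finset.prod_insert ha, Finset.prod_insert ha, Finset.card_insert_of_notMem ha,
      show f a * ∏ i ∈ t, f i - g a * ∏ i ∈ t, g i =
        (f a - g a) * ∏ i ∈ t, f i + g a * (∏ i ∈ t, f i - ∏ i ∈ t, g i) by ring]
    refine add hna ?_ ?_
    · convert mul hna hs (pow_nonneg hr.le _) (hfg a) (prod hna hr.le t hf) using 1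
      field_simp
      ring
    · convert mul hna hr.le (by positivity) (hg a) ih using 1
      field_simp
      ring

theorem det_sub_det (hna : ∀ x y : k, v (x + y) ≤ max (v x) (v y)) (hr : 0 < r) (hs : 0 ≤ s)
    {ι : Type*} [Fintype ι] [DecidableEq ι] {A B : Matrix ι ι k[X]}
    (hA : ∀ i j, CoeffsBounded v r (A i j)) (hB : ∀ i j, CoeffsBounded v r (B i j))
    (hAB : ∀ i j, CoeffsBounded v s (A i j - B i j)) :
    CoeffsBounded v (s * (r ^ Fintype.card ι / r)) (A.det - B.det) := by
  rw [Matrix.det_apply, Matrix.det_apply, ← Finset.sum_sub_distrib]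
  refine sum hna (by positivity) fun σ _ => ?_
  rw [← smul_sub]
  have h := prod_sub_prod hna hr hs Finset.univ (fun i => hA (σ i) i) (fun i => hB (σ i) i)
    (fun i => hAB (σ i) i)
  rcases Int.units_eq_one_or (Equiv.Perm.sign σ) with hσ | hσ
  · simpa [hσ] using h
  · simpa only [hσ, Units.neg_smul, one_smul, Finset.card_univ] using h.neg

theorem charmatrix (hna : ∀ x y : k, v (x + y) ≤ max (v x) (v y)) (hr : 1 ≤ r)
    {ι : Type*} [Fintype ι] [DecidableEq ι] {A : Matrix ι ι k} (hA : ∀ i j, v (A i j) ≤ r)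
    (i j : ι) : CoeffsBounded v r (A.charmatrix i j) := by
  rw [Matrix.charmatrix_apply, sub_eq_add_neg, Matrix.diagonal_apply]
  refine add hna ?_ (const (hA i j)).neg
  split_ifs
  · exact X_of_one_le hr
  · exact zero (zero_le_one.trans hr)

end CoeffsBounded

theorem le_matNormAbs {k : Type*} [Field k] (v : AbsoluteValue k ℝ) {n : ℕ}
    (A : Matrix (Fin n) (Fin n) k) (i j : Fin n) : v (A i j) ≤ matNormAbs v A :=
  (le_ciSup (f := fun j => v (A i j)) (Set.finite_range _).bddAbove j).trans
    (le_ciSup (f := fun i => ⨆ j, v (A i j)) (Set.finite_range _).bddAbove i)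

theorem matNormAbs_nonneg {k : Type*} [Field k] (v : AbsoluteValue k ℝ) {n : ℕ}
    (A : Matrix (Fin n) (Fin n) k) : 0 ≤ matNormAbs v A :=
  Real.iSup_nonneg fun _ => Real.iSup_nonneg fun _ => v.nonneg _

/-- over a field `k` with a nonarchimedean absolute value, if `C, C'` are n×n
matrices with `‖C'‖ ≤ ‖C‖` and `‖C‖ ≥ 1`, then every coefficient of `χ_C − χ_{C'}` has
absolute value at most `‖C − C'‖·‖C‖^{n−1}`. -/
theorem stmt14 {k : Type*} [Field k] (v : AbsoluteValue k ℝ)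
    (hna : ∀ x y : k, v (x + y) ≤ max (v x) (v y))
    (n : ℕ) (hn : 1 ≤ n) (C C' : Matrix (Fin n) (Fin n) k)
    (hle : matNormAbs v C' ≤ matNormAbs v C) (h1 : 1 ≤ matNormAbs v C) :
    ∀ j : ℕ, j ≤ n →
      v ((Matrix.charpoly C).coeff j - (Matrix.charpoly C').coeff j) ≤
        matNormAbs v (C - C') * matNormAbs v C ^ (n - 1) := by
  intro j _
  have hpos : 0 < matNormAbs v C := zero_lt_one.trans_le h1
  have hd (i j : Fin n) : CoeffsBounded v (matNormAbs v (C - C'))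
      (C.charmatrix i j - C'.charmatrix i j) := by
    rw [Matrix.charmatrix_apply, Matrix.charmatrix_apply, sub_sub_sub_cancel_left,
      ← Polynomial.C_sub]
    refine CoeffsBounded.const ?_
    rw [v.map_sub]
    exact le_matNormAbs v (C - C') i j
  have h := CoeffsBounded.det_sub_det hna hpos (matNormAbs_nonneg v (C - C'))
    (CoeffsBounded.charmatrix hna h1 (le_matNormAbs v C))
    (CoeffsBounded.charmatrix hna h1 fun i j => (le_matNormAbs v C' i j).trans hle)
    hd j
  rw [Polynomial.coeff_sub, Fintype.card_fin, ← pow_sub_one_mul (by omega : n ≠ 0),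
    mul_div_cancel_right₀ _ hpos.ne'] at h
  exact h
end
end
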